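/- The class of directed 3D aTAM systems is intrinsically universal by directed simulators: there exists a finite tile set U of 3-dimensional tile types, a temperature τ' ∈ ℤ⁺, and computable functions ℛ and S such that for every directed 3D aTAM system 𝒯 there is m ∈ ℕ for which 𝒰_𝒯 = (U, S(𝒯), τ') simulates 𝒯 at scale m under ℛ(𝒯) and 𝒰_𝒯 is itself directed. -/

import Mathlib

open scoped Classical

noncomputable section

namespace ATAM

/-- A glue: a label (a finite string over the alphabet) together with a
nonnegative integer strength. -/
abbrev Glue : Type := String × ℕ

/-- A `d`-dimensional tile type: for each of the `d` axes, a glue on the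
positive face and a glue on the negative face (`2d` glues in total). -/
abbrev TileType (d : ℕ) : Type := Fin d → Glue × Glue

/-- Points of the integer lattice `ℤ^d`. -/
abbrev Pt (d : ℕ) : Type := Fin d → ℤ

/-- A configuration: a partial placement of tile types on `ℤ^d`. -/
abbrev Config (d : ℕ) : Type := Pt d → Option (TileType d)

variable {d : ℕ}

/-- The domain of a configuration. -/
def dom (α : Config d) : Set (Pt d) := {p | α p ≠ none}

/-- Grid-graph adjacency on `ℤ^d` (Euclidean, equivalently `ℓ¹`, distance one). -/
def adj (p q : Pt d) : Prop := (∑ i, |p i - q i|) = 1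

/-- A set of lattice points is connected in the grid graph of `ℤ^d`. -/
def ConnectedSet (S : Set (Pt d)) : Prop :=
  ∀ p ∈ S, ∀ q ∈ S,
    Relation.ReflTransGen (fun a b => adj a b ∧ a ∈ S ∧ b ∈ S) p q

/-- The strength with which a tile of type `t` at `p` and a tile of type `t'`
at `q` interact: nonzero only if `p` and `q` are adjacent and the abutting
glues are equal (in label and strength) with positive strength. -/
def bond (t t' : TileType d) (p q : Pt d) : ℕ :=
  ∑ i : Fin d,
    ((if q = Function.update p i (p i + 1) ∧ (t i).1 = (t' i).2 ∧ 0 < (t i).1.2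
        then (t i).1.2 else 0) +
     (if p = Function.update q i (q i + 1) ∧ (t i).2 = (t' i).1 ∧ 0 < (t i).2.2
        then (t i).2.2 else 0))

/-- The strength of the bond between positions `p` and `q` in configuration `α`. -/
def bondAt (α : Config d) (p q : Pt d) : ℕ :=
  match α p, α q with
  | some t, some t' => bond t t' p q
  | _, _ => 0

/-- `α` is `τ`-stable: every cut of its binding graph has weight at least `τ`. -/
def Stable (τ : ℕ) (α : Config d) : Prop :=
  ∀ A B : Set (Pt d), A.Nonempty → B.Nonempty → Disjoint A B → A ∪ B = dom α →
    ∃ F : Finset (Pt d × Pt d),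
      (∀ e ∈ F, e.1 ∈ A ∧ e.2 ∈ B) ∧ τ ≤ ∑ e ∈ F, bondAt α e.1 e.2

/-- `β` extends `α`, i.e. `α` is a subassembly of `β` (`α ⊑ β`). -/
def Extends (α β : Config d) : Prop := ∀ p t, α p = some t → β p = some t

/-- A `d`-dimensional tile assembly system `(T, σ, τ)`: a finite tile set, a
finite `τ`-stable seed assembly over the tile set, and a temperature `τ ≥ 1`. -/
structure TAS (d : ℕ) where
  tileset : Finset (TileType d)
  seed : Config d
  temp : ℕ
  temp_pos : 0 < temp
  seed_nonempty : (dom seed).Nonempty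
  seed_connected : ConnectedSet (dom seed)
  seed_finite : (dom seed).Finite
  seed_tiles : ∀ p t, seed p = some t → t ∈ tileset
  seed_stable : Stable temp seed

/-- One step of the (unrestricted) aTAM: a single tile of the tile set
`τ`-stably attaches at an empty location. -/
def Attach (T : TAS d) (α β : Config d) : Prop :=
  ∃ p t, p ∉ dom α ∧ t ∈ T.tileset ∧
    β = Function.update α p (some t) ∧ Stable T.temp β

/-- `q` lies outside the minimal bounding box of `α`. -/
def OutsideBBox (α : Config d) (q : Pt d) : Prop :=
  ∃ i : Fin d, (∀ p ∈ dom α, q i < p i) ∨ (∀ p ∈ dom α, p i < q i)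

/-- There is a diffusion path for `p` with respect to `α`: a path in the grid
graph of `ℤ^d` from `p` to a point outside the minimal bounding box of `α`,
none of whose points lies in `dom α`. -/
def HasDiffusionPath (α : Config d) (p : Pt d) : Prop :=
  ∃ (k : ℕ) (x : ℕ → Pt d), x 0 = p ∧ (∀ j < k, adj (x j) (x (j + 1))) ∧
    (∀ j ≤ k, x j ∉ dom α) ∧ OutsideBBox α (x k)

/-- One step of the diffusion-restricted aTAM: additionally the attachment
location must admit a diffusion path. -/
def AttachD (T : TAS d) (α β : Config d) : Prop :=
  ∃ p t, p ∉ dom α ∧ t ∈ T.tileset ∧ HasDiffusionPath α p ∧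
    β = Function.update α p (some t) ∧ Stable T.temp β

/-- A (possibly stuttering) chain of single-tile attachment steps with respect
to the attachment relation `A`. -/
def Chain (A : Config d → Config d → Prop) (f : ℕ → Config d) : Prop :=
  ∀ n, f n = f (n + 1) ∨ A (f n) (f (n + 1))

/-- `β` is the (limiting) result of the sequence `f`. -/
def Limit (f : ℕ → Config d) (β : Config d) : Prop :=
  ∀ p t, β p = some t ↔ ∃ n, f n p = some t

/-- `β` is producible from `α` by zero or more (possibly infinitely many)
single-tile attachment steps, with respect to the attachment relation `A`. -/
def ProducesFrom (A : Config d → Config d → Prop) (α β : Config d) : Prop :=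
  ∃ f : ℕ → Config d, f 0 = α ∧ Chain A f ∧ Limit f β

/-- `α` admits no attachment step: it is terminal. -/
def Terminal (A : Config d → Config d → Prop) (α : Config d) : Prop :=
  ∀ β, ¬ A α β

/-- The system with seed `σ` and attachment relation `A` is directed: it has
exactly one producible terminal assembly. -/
def DirectedSys (A : Config d → Config d → Prop) (σ : Config d) : Prop :=
  ∃! α, ProducesFrom A σ α ∧ Terminal A α

/-- The `m`-block macrotile of `α` at block position `x`. -/
def mblock (m : ℕ) (α : Config d) (x : Pt d) : Config d :=
  fun y => if ∀ i, 0 ≤ y i ∧ y i < (m : ℤ) then α (fun i => (m : ℤ) * x i + y i) else none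

/-- A (partial) macrotile representation function. -/
abbrev RepFn (d : ℕ) : Type := Config d → Option (TileType d)

/-- `R` is a valid macrotile representation function into the tile set `Tset`:
it is monotone with respect to the subassembly relation on macrotiles, and its
values are tile types of `Tset`. -/
def ValidRep (Tset : Finset (TileType d)) (R : RepFn d) : Prop :=
  (∀ γ γ', Extends γ γ' → ∀ t, R γ = some t → R γ' = some t) ∧
  (∀ γ t, R γ = some t → t ∈ Tset)

/-- The induced assembly representation function `R*`. -/
def repStar (R : RepFn d) (m : ℕ) (α' : Config d) : Config d :=
  fun x => R (mblock m α' x)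

/-- Block position `x` holds a nonempty `m`-block of `α'`. -/
def NonemptyBlock (m : ℕ) (α' : Config d) (x : Pt d) : Prop :=
  ∃ y, mblock m α' x y ≠ none

/-- `α'` maps cleanly to `R*(α')`: every nonempty block position lies in the
domain of `R*(α')` or is (non-diagonally) adjacent to a point of that domain,
or `α'` has at most one nonempty block. -/
def MapsCleanly (R : RepFn d) (m : ℕ) (α' : Config d) : Prop :=
  (∀ x, NonemptyBlock m α' x →
      repStar R m α' x ≠ none ∨ ∃ u, adj x u ∧ repStar R m α' u ≠ none) ∨
  (∃ x₀, ∀ x, NonemptyBlock m α' x → x = x₀)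

/-- The system with attachment relation `A_S` and seed `σ_S` simulates the
system with attachment relation `A_T` and seed `σ_T` at scale `m` under the
representation function `R`: they have equivalent productions, the simulated
system follows the simulator, and the simulator models the simulated system. -/
structure SimulatesVia (A_T : Config d → Config d → Prop) (σ_T : Config d)
    (A_S : Config d → Config d → Prop) (σ_S : Config d)
    (R : RepFn d) (m : ℕ) : Prop where
  /-- `{R*(α') : α' ∈ 𝒜[𝒮]} = 𝒜[𝒯]` -/
  prod_eq : ∀ α, ProducesFrom A_T σ_T α ↔
      ∃ α', ProducesFrom A_S σ_S α' ∧ repStar R m α' = α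
  /-- `{R*(α') : α' ∈ 𝒜□[𝒮]} = 𝒜□[𝒯]` -/
  term_eq : ∀ α, (ProducesFrom A_T σ_T α ∧ Terminal A_T α) ↔
      ∃ α', (ProducesFrom A_S σ_S α' ∧ Terminal A_S α') ∧ repStar R m α' = α
  /-- every producible assembly of the simulator maps cleanly -/
  clean : ∀ α', ProducesFrom A_S σ_S α' → MapsCleanly R m α'
  /-- `𝒯` follows `𝒮` -/
  follows : ∀ α' β', ProducesFrom A_S σ_S α' → ProducesFrom A_S σ_S β' →
      ProducesFrom A_S α' β' →
      ProducesFrom A_T (repStar R m α') (repStar R m β')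
  /-- `𝒮` models `𝒯` -/
  models : ∀ α, ProducesFrom A_T σ_T α → ∃ Ps : Set (Config d),
      (∀ α' ∈ Ps, ProducesFrom A_S σ_S α' ∧ repStar R m α' = α) ∧
      ∀ β, ProducesFrom A_T σ_T β → ProducesFrom A_T α β →
        (∀ α' ∈ Ps, ∃ β', ProducesFrom A_S α' β' ∧ repStar R m β' = β) ∧
        (∀ α'' β', ProducesFrom A_S σ_S α'' → repStar R m α'' = α →
            ProducesFrom A_S α'' β' → repStar R m β' = β →
            ∃ α' ∈ Ps, ProducesFrom A_S α' α'')

/-- `US` simulates `T` at scale `m` under `R`, both with the standard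
(unrestricted) aTAM dynamics. -/
def Simulates (US T : TAS d) (R : RepFn d) (m : ℕ) : Prop :=
  SimulatesVia (Attach T) T.seed (Attach US) US.seed R m

/-- `US` simulates `T` at scale `m` under `R`, both with the
diffusion-restricted dynamics. -/
def SimulatesD (US T : TAS d) (R : RepFn d) (m : ℕ) : Prop :=
  SimulatesVia (AttachD T) T.seed (AttachD US) US.seed R m

end ATAM

open ATAM

namespace IU

/-! ## Part A: generic facts about the aTAM in dimension three -/

/-- The six directions. -/
abbrev Dir : Type := Fin 3 × Bool

def sg (d : Dir) : ℤ := if d.2 then 1 else -1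

def stp (d : Dir) (p : Pt 3) : Pt 3 := Function.update p d.1 (p d.1 + sg d)

def opp (d : Dir) : Dir := (d.1, !d.2)

def face (t : TileType 3) (d : Dir) : Glue := if d.2 then (t d.1).1 else (t d.1).2

def bondD (t t' : TileType 3) (d : Dir) : ℕ :=
  if face t d = face t' (opp d) ∧ 0 < (face t d).2 then (face t d).2 else 0

/-- Bond of a tile `t` placed at `p` with its neighbour in direction `d`. -/
def nb (α : Config 3) (t : TileType 3) (p : Pt 3) (d : Dir) : ℕ :=
  match α (stp d p) with
  | some t' => bondD t t' d
  | none => 0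

def wsum (α : Config 3) (p : Pt 3) (t : TileType 3) : ℕ := ∑ d : Dir, nb α t p d

@[simp] lemma opp_opp (d : Dir) : opp (opp d) = d := by
  rcases d with ⟨i, b⟩; simp [opp]

@[simp] lemma sg_opp (d : Dir) : sg (opp d) = - sg d := by
  rcases d with ⟨i, b⟩; cases b <;> simp [opp, sg]

lemma stp_same (d : Dir) (p : Pt 3) : stp d p d.1 = p d.1 + sg d := by simp [stp]

lemma stp_ne (d : Dir) (p : Pt 3) {i : Fin 3} (h : i ≠ d.1) : stp d p i = p i := by
  simp [stp, h]

lemma stp_ne' {b : Fin 3} {s : Bool} (p : Pt 3) {i : Fin 3} (h : i ≠ b) :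
    stp (b, s) p i = p i := stp_ne _ _ h

lemma stp_apply (d : Dir) (p : Pt 3) (i : Fin 3) :
    stp d p i = p i + if i = d.1 then sg d else 0 := by
  by_cases h : i = d.1
  · subst h; simp [stp]
  · simp [stp, h]

@[simp] lemma stp_opp_stp (d : Dir) (p : Pt 3) : stp (opp d) (stp d p) = p := by
  funext i
  rw [stp_apply, stp_apply, sg_opp]
  by_cases h : i = d.1 <;> simp [h, opp]

@[simp] lemma stp_stp_opp (d : Dir) (p : Pt 3) : stp d (stp (opp d) p) = p := by
  have := stp_opp_stp (opp d) p
  rwa [opp_opp] at this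

lemma sg_ne (d : Dir) : sg d ≠ 0 := by
  rcases d with ⟨i, b⟩; cases b <;> simp [sg]

lemma stp_ne_self (d : Dir) (p : Pt 3) : stp d p ≠ p := by
  intro h
  have := congrFun h d.1
  rw [stp_same] at this
  have := sg_ne d
  omega

lemma stp_inj {d d' : Dir} {p : Pt 3} (h : stp d p = stp d' p) : d = d' := by
  have h1 : d.1 = d'.1 := by
    by_contra hne
    have := congrFun h d.1
    rw [stp_same, stp_ne _ _ hne] at this
    have := sg_ne d
    omega
  have h2 := congrFun h d.1
  rw [stp_same, h1, stp_same] at h2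
  have h3 : sg d = sg d' := by rw [← h1] at h2; omega
  rcases d with ⟨i, b⟩; rcases d' with ⟨i', b'⟩
  simp only at h1
  subst h1
  cases b <;> cases b' <;> simp [sg] at h3 ⊢

lemma stp_eq_iff {d : Dir} {p q : Pt 3} : stp d p = q ↔ p = stp (opp d) q := by
  constructor
  · rintro rfl; simp
  · rintro rfl; simp

lemma bondD_symm (t t' : TileType 3) (d : Dir) : bondD t' t (opp d) = bondD t t' d := by
  unfold bondD
  rw [opp_opp]
  by_cases h : face t d = face t' (opp d)
  · simp [h]
  · rw [if_neg (fun hh => h hh.1.symm), if_neg (fun hh => h hh.1)]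

lemma bond_eq_sum (t t' : TileType 3) (p q : Pt 3) :
    bond t t' p q = ∑ d : Dir, if q = stp d p then bondD t t' d else 0 := by
  unfold bond
  rw [Fintype.sum_prod_type]
  apply Finset.sum_congr rfl
  intro i _
  rw [Fintype.sum_bool]
  congr 1
  · have : stp (i, true) p = Function.update p i (p i + 1) := by simp [stp, sg]
    rw [this]
    by_cases h : q = Function.update p i (p i + 1)
    · simp [h, bondD, face, opp]
    · simp [h]
  · have : stp (i, true) q = Function.update q i (q i + 1) := by simp [stp, sg]
    rw [← this]
    have e : (p = stp (i, true) q) ↔ (q = stp (i, false) p) := by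
      rw [eq_comm, stp_eq_iff]; rfl
    by_cases h : q = stp (i, false) p
    · rw [if_pos h]
      have h' := e.2 h
      simp only [h', true_and, bondD, face, opp]
      simp
    · have h' := fun h' => h (e.1 h')
      rw [if_neg h, if_neg (fun hh => h' hh.1)]

lemma bond_stp (t t' : TileType 3) (p : Pt 3) (d : Dir) :
    bond t t' p (stp d p) = bondD t t' d := by
  rw [bond_eq_sum, Finset.sum_eq_single d]
  · simp
  · intro b _ hb
    rw [if_neg]
    intro h
    exact hb (stp_inj h).symm
  · simp

lemma bond_symm (t t' : TileType 3) (p q : Pt 3) : bond t t' p q = bond t' t q p := by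
  rw [bond_eq_sum, bond_eq_sum]
  rw [← Equiv.sum_comp (Function.Involutive.toPerm opp opp_opp)]
  apply Finset.sum_congr rfl
  intro d _
  change (if q = stp (opp d) p then bondD t t' (opp d) else 0) = _
  rw [bondD_symm t' t d]
  have : (q = stp (opp d) p) ↔ (p = stp d q) := by
    rw [eq_comm, stp_eq_iff, opp_opp]
  simp only [this]

lemma bondAt_symm (α : Config 3) (p q : Pt 3) : bondAt α p q = bondAt α q p := by
  unfold bondAt
  cases h : α p <;> cases h' : α q <;> simp
  rw [bond_symm]

lemma bondAt_stp {α : Config 3} {p : Pt 3} {t : TileType 3} (h : α p = some t) (d : Dir) :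
    bondAt α p (stp d p) = nb α t p d := by
  unfold bondAt nb
  rw [h]
  cases h' : α (stp d p) <;> simp [bond_stp]

lemma bondAt_eq_sum {α : Config 3} {p : Pt 3} {t : TileType 3} (h : α p = some t) (q : Pt 3) :
    bondAt α p q = ∑ d : Dir, if q = stp d p then nb α t p d else 0 := by
  by_cases hq : ∃ d, q = stp d p
  · obtain ⟨d, rfl⟩ := hq
    rw [bondAt_stp h, Finset.sum_eq_single d]
    · simp
    · intro b _ hb
      rw [if_neg]
      intro h
      exact hb (stp_inj h).symm
    · simp
  · push Not at hq
    have : bondAt α p q = 0 := by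
      unfold bondAt
      rw [h]
      cases h' : α q
      · rfl
      · simp only [bond_eq_sum]
        simp [hq]
    rw [this]
    simp [hq]

lemma nb_mono {α β : Config 3} (h : Extends α β) (t : TileType 3) (p : Pt 3) (d : Dir) :
    nb α t p d ≤ nb β t p d := by
  unfold nb
  cases h' : α (stp d p) with
  | none => simp
  | some t' => rw [h _ _ h']

lemma wsum_mono {α β : Config 3} (h : Extends α β) (p : Pt 3) (t : TileType 3) :
    wsum α p t ≤ wsum β p t :=
  Finset.sum_le_sum fun d _ => nb_mono h t p d

lemma bondAt_mono {α β : Config 3} (h : Extends α β) (p q : Pt 3) :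
    bondAt α p q ≤ bondAt β p q := by
  unfold bondAt
  cases h1 : α p with
  | none => simp
  | some t =>
    cases h2 : α q with
    | none => simp
    | some t' => rw [h _ _ h1, h _ _ h2]

lemma nb_update {α : Config 3} {p : Pt 3} (t t' : TileType 3) (d : Dir) :
    nb (Function.update α p (some t')) t p d = nb α t p d := by
  unfold nb
  rw [Function.update_of_ne (stp_ne_self d p)]

lemma extends_refl (α : Config 3) : Extends α α := fun _ _ h => h
lemma extends_trans {α β γ : Config 3} (h : Extends α β) (h' : Extends β γ) : Extends α γ :=
  fun p t e => h' p t (h p t e)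
lemma extends_antisymm {α β : Config 3} (h : Extends α β) (h' : Extends β α) : α = β := by
  funext p
  cases e : α p with
  | some t => exact (h p t e).symm
  | none =>
    cases e' : β p with
    | none => rfl
    | some t => rw [h' p t e'] at e; cases e

lemma extends_update {α : Config 3} {p : Pt 3} (hp : α p = none) (t : TileType 3) :
    Extends α (Function.update α p (some t)) := by
  intro q s hq
  rw [Function.update_of_ne]
  · exact hq
  · rintro rfl; rw [hp] at hq; cases hq

lemma mem_dom {α : Config 3} {p : Pt 3} : p ∈ dom α ↔ α p ≠ none := Iff.rfl

lemma mem_dom_iff {α : Config 3} {p : Pt 3} : p ∈ dom α ↔ ∃ t, α p = some t := by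
  rw [mem_dom, Option.ne_none_iff_exists']

lemma dom_mono {α β : Config 3} (h : Extends α β) : dom α ⊆ dom β := by
  intro p hp
  obtain ⟨t, ht⟩ := mem_dom_iff.1 hp
  exact mem_dom_iff.2 ⟨t, h _ _ ht⟩

/-- Points of `β` obtained from `α` by successive `τ`-strong attachments inside `β`. -/
inductive Reach (τ : ℕ) (α β : Config 3) : Pt 3 → Prop
  | base (p : Pt 3) : α p ≠ none → Reach τ α β p
  | step (p : Pt 3) (t : TileType 3) (S : Finset Dir) : β p = some t →
      (∀ d ∈ S, Reach τ α β (stp d p)) → τ ≤ ∑ d ∈ S, nb β t p d → Reach τ α β p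

lemma wsum_of_stable {τ : ℕ} {α : Config 3} {p : Pt 3} {t : TileType 3}
    (hne : (dom α).Nonempty) (hp : α p = none)
    (h : Stable τ (Function.update α p (some t))) : τ ≤ wsum α p t := by
  obtain ⟨F, hF, hs⟩ := h {p} (dom α) ⟨p, rfl⟩ hne
    (by
      rw [Set.disjoint_singleton_left]
      intro h'; exact h' hp)
    (by
      ext q
      simp only [Set.mem_union, Set.mem_singleton_iff, mem_dom]
      by_cases hq : q = p
      · simp [hq]
      · simp [hq])
  have hup : Function.update α p (some t) p = some t := by simp
  refine hs.trans ?_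
  have h1 : ∀ e ∈ F, bondAt (Function.update α p (some t)) e.1 e.2
      = ∑ d : Dir, if e.2 = stp d p then nb α t p d else 0 := by
    intro e he
    have : e.1 = p := (hF e he).1
    rw [this, bondAt_eq_sum hup]
    simp only [nb_update]
  rw [Finset.sum_congr rfl h1, Finset.sum_comm]
  unfold wsum
  apply Finset.sum_le_sum
  intro d _
  rw [← Finset.sum_filter, Finset.sum_const, smul_eq_mul]
  have : (F.filter (fun e => e.2 = stp d p)).card ≤ 1 := by
    rw [Finset.card_le_one]
    intro a ha b hb
    rw [Finset.mem_filter] at ha hb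
    have e1 : a.1 = p := (hF a ha.1).1
    have e2 : b.1 = p := (hF b hb.1).1
    exact Prod.ext (e1.trans e2.symm) (ha.2.trans hb.2.symm)
  calc _ ≤ 1 * nb α t p d := Nat.mul_le_mul_right _ this
    _ = _ := one_mul _

lemma reach_cut {τ : ℕ} {α β : Config 3} (hext : Extends α β) {A B : Set (Pt 3)}
    (hAB : A ∪ B = dom β) (hdis : Disjoint A B) (hα : dom α ⊆ A) {p : Pt 3}
    (hr : Reach τ α β p) : p ∈ B →
    ∃ F : Finset (Pt 3 × Pt 3),
      (∀ e ∈ F, e.1 ∈ B ∧ e.2 ∈ A) ∧ τ ≤ ∑ e ∈ F, bondAt β e.1 e.2 := by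
  induction hr with
  | base p h => exact fun hB => absurd hB (Set.disjoint_left.1 hdis (hα h))
  | step p t S hp hS hw ih =>
    intro hB
    by_cases hex : ∃ d ∈ S, stp d p ∈ B
    · obtain ⟨d, hd, hdB⟩ := hex
      exact ih d hd hdB
    · push Not at hex
      have hdm : ∀ d ∈ S, nb β t p d ≠ 0 → stp d p ∈ A := by
        intro d hd hnb
        have : stp d p ∈ A ∪ B := by
          rw [hAB, mem_dom]
          intro h
          apply hnb
          unfold nb
          rw [h]
        exact this.resolve_right (hex d hd)
      refine ⟨(S.filter (fun d => nb β t p d ≠ 0)).image (fun d => (p, stp d p)), ?_, ?_⟩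
      · intro e he
        rw [Finset.mem_image] at he
        obtain ⟨d, hd, rfl⟩ := he
        rw [Finset.mem_filter] at hd
        exact ⟨hB, hdm d hd.1 hd.2⟩
      · rw [Finset.sum_image]
        · simp only [bondAt_stp hp]
          rw [Finset.sum_filter_ne_zero]
          exact hw
        · intro d _ d' _ h
          exact stp_inj (congrArg Prod.snd h)

lemma swap_cut {τ : ℕ} {β : Config 3} {A B : Set (Pt 3)} (h : ∃ F : Finset (Pt 3 × Pt 3),
      (∀ e ∈ F, e.1 ∈ B ∧ e.2 ∈ A) ∧ τ ≤ ∑ e ∈ F, bondAt β e.1 e.2) :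
    ∃ F : Finset (Pt 3 × Pt 3),
      (∀ e ∈ F, e.1 ∈ A ∧ e.2 ∈ B) ∧ τ ≤ ∑ e ∈ F, bondAt β e.1 e.2 := by
  obtain ⟨F, h1, h2⟩ := h
  refine ⟨F.image Prod.swap, ?_, ?_⟩
  · intro e he
    rw [Finset.mem_image] at he
    obtain ⟨e', he', rfl⟩ := he
    exact ⟨(h1 e' he').2, (h1 e' he').1⟩
  · rw [Finset.sum_image (fun a _ b _ h => Prod.swap_injective h)]
    simpa [bondAt_symm] using h2.trans (le_of_eq (Finset.sum_congr rfl fun e _ => bondAt_symm _ _ _))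

lemma stable_of_reach {τ : ℕ} {α β : Config 3} (hst : Stable τ α)
    (hext : Extends α β) (hr : ∀ p ∈ dom β, Reach τ α β p) : Stable τ β := by
  intro A B hA hB hdis hAB
  by_cases h1 : (A ∩ dom α).Nonempty
  · by_cases h2 : (B ∩ dom α).Nonempty
    · obtain ⟨F, hF, hs⟩ := hst (A ∩ dom α) (B ∩ dom α) h1 h2
        (hdis.mono Set.inter_subset_left Set.inter_subset_left)
        (by rw [← Set.union_inter_distrib_right, hAB]
            exact Set.inter_eq_right.2 (dom_mono hext))
      exact ⟨F, fun e he => ⟨(hF e he).1.1, (hF e he).2.1⟩,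
        hs.trans (Finset.sum_le_sum fun e _ => bondAt_mono hext _ _)⟩
    · obtain ⟨b, hb⟩ := hB
      apply swap_cut
      refine reach_cut hext hAB hdis ?_ (hr b (hAB ▸ Or.inr hb)) hb
      intro q hq
      have : q ∈ A ∪ B := hAB ▸ dom_mono hext hq
      exact this.resolve_right fun hqB => h2 ⟨q, hqB, hq⟩
  · obtain ⟨b, hb⟩ := hA
    refine reach_cut hext (by rw [Set.union_comm]; exact hAB) hdis.symm ?_
      (hr b (hAB ▸ Or.inl hb)) hb
    intro q hq
    have : q ∈ A ∪ B := hAB ▸ dom_mono hext hq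
    exact this.resolve_left fun hqA => h1 ⟨q, hqA, hq⟩

lemma stable_update {τ : ℕ} {α : Config 3} (hst : Stable τ α) {p : Pt 3} (hp : α p = none)
    {t : TileType 3} (hw : τ ≤ wsum α p t) : Stable τ (Function.update α p (some t)) := by
  apply stable_of_reach hst (extends_update hp t)
  intro q hq
  by_cases h : q = p
  · subst h
    refine Reach.step q t (Finset.univ.filter fun d => α (stp d q) ≠ none) (by simp) ?_ ?_
    · intro d hd
      exact Reach.base _ (Finset.mem_filter.1 hd).2
    · simp only [nb_update]
      refine hw.trans (le_of_eq ?_)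
      symm
      apply Finset.sum_filter_of_ne
      intro d _ hd h
      apply hd
      unfold nb
      rw [h]
  · apply Reach.base
    rw [mem_dom, Function.update_of_ne h] at hq
    exact hq

lemma attach_iff {T : TAS 3} {α β : Config 3} (hne : (dom α).Nonempty) (hst : Stable T.temp α) :
    Attach T α β ↔ ∃ p t, α p = none ∧ t ∈ T.tileset ∧ β = Function.update α p (some t) ∧
      T.temp ≤ wsum α p t := by
  constructor
  · rintro ⟨p, t, hp, ht, rfl, hs⟩
    have hp' : α p = none := by by_contra h; exact hp h
    exact ⟨p, t, hp', ht, rfl, wsum_of_stable hne hp' hs⟩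
  · rintro ⟨p, t, hp, ht, rfl, hs⟩
    exact ⟨p, t, fun h => h hp, ht, rfl, stable_update hst hp hs⟩

lemma terminal_iff {T : TAS 3} {α : Config 3} (hne : (dom α).Nonempty) (hst : Stable T.temp α) :
    Terminal (Attach T) α ↔ ∀ p t, α p = none → t ∈ T.tileset → wsum α p t < T.temp := by
  constructor
  · intro h p t hp ht
    by_contra hw
    exact h _ ((attach_iff hne hst).2 ⟨p, t, hp, ht, rfl, not_lt.1 hw⟩)
  · intro h β hβ
    obtain ⟨p, t, hp, ht, -, hw⟩ := (attach_iff hne hst).1 hβ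
    exact absurd hw (not_le.2 (h p t hp ht))

lemma reach_mono_right {τ : ℕ} {α β γ : Config 3} (h : Extends β γ) {p : Pt 3}
    (hr : Reach τ α β p) : Reach τ α γ p := by
  induction hr with
  | base p h' => exact .base p h'
  | step p t S hp _ hw ih =>
    exact .step p t S (h _ _ hp) ih (hw.trans (Finset.sum_le_sum fun d _ => nb_mono h t p d))

lemma reach_step_wsum {τ : ℕ} {α γ β : Config 3} {p : Pt 3} {t : TileType 3}
    (hγβ : Extends γ β) (hp : β p = some t) (hγ : ∀ q, γ q ≠ none → Reach τ α β q)
    (hw : τ ≤ wsum γ p t) : Reach τ α β p := by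
  refine Reach.step p t (Finset.univ.filter fun d => γ (stp d p) ≠ none) hp ?_ ?_
  · intro d hd
    exact hγ _ (Finset.mem_filter.1 hd).2
  · refine hw.trans ?_
    unfold wsum
    rw [← Finset.sum_filter_of_ne (p := fun d => γ (stp d p) ≠ none)]
    · exact Finset.sum_le_sum fun d _ => nb_mono hγβ t p d
    · intro d _ hd h
      apply hd
      unfold nb
      rw [h]

section produces
variable {T : TAS 3} {α β : Config 3}

lemma chain_extends {f : ℕ → Config 3} (hc : Chain (Attach T) f) (n : ℕ) :
    Extends (f n) (f (n+1)) := by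
  rcases hc n with h | ⟨p, t, hp, _, h, _⟩
  · rw [← h]; exact extends_refl _
  · rw [h]
    exact extends_update (by by_contra h'; exact hp h') t

lemma chain_extends_le {f : ℕ → Config 3} (hc : Chain (Attach T) f) {m n : ℕ} (h : m ≤ n) :
    Extends (f m) (f n) := by
  induction n, h using Nat.le_induction with
  | base => exact extends_refl _
  | succ n _ ih => exact extends_trans ih (chain_extends hc n)

lemma limit_extends {f : ℕ → Config 3} (hl : Limit f β) (n : ℕ) : Extends (f n) β :=
  fun p t h => (hl p t).2 ⟨n, h⟩

lemma produces_data (hne : (dom α).Nonempty)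
    (h : ProducesFrom (Attach T) α β) :
    Extends α β ∧ (∀ p t, β p = some t → α p = none → t ∈ T.tileset) ∧
      ∀ p ∈ dom β, Reach T.temp α β p := by
  obtain ⟨f, h0, hc, hl⟩ := h
  have hext : ∀ n, Extends α (f n) := fun n => h0 ▸ chain_extends_le hc (Nat.zero_le n)
  have hlim := limit_extends hl
  refine ⟨h0 ▸ hlim 0, ?_, ?_⟩
  · intro p t hp hα
    obtain ⟨n, hn⟩ := (hl p t).1 hp
    have : ∀ n, ∀ p t, f n p = some t → α p = none → t ∈ T.tileset := by
      intro n
      induction n with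
      | zero => intro p t h1 h2; rw [h0, h2] at h1; cases h1
      | succ n ih =>
        intro p t h1 h2
        rcases hc n with h | ⟨q, s, _, hs, h, _⟩
        · rw [← h] at h1; exact ih p t h1 h2
        · rw [h] at h1
          by_cases hq : p = q
          · subst hq; simp at h1; exact h1 ▸ hs
          · rw [Function.update_of_ne hq] at h1; exact ih p t h1 h2
    exact this n p t hn hα
  · have : ∀ n, ∀ p, f n p ≠ none → Reach T.temp α β p := by
      intro n
      induction n with
      | zero => intro p h1; rw [h0] at h1; exact .base p h1
      | succ n ih =>
        intro p h1
        rcases hc n with h | ⟨q, s, hq, hs, h, hst⟩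
        · rw [← h] at h1; exact ih p h1
        · by_cases hpq : p = q
          · subst hpq
            have hq' : f n p = none := by by_contra h'; exact hq h'
            have hw : T.temp ≤ wsum (f n) p s :=
              wsum_of_stable (hne.mono (dom_mono (hext n))) hq' (h ▸ hst)
            exact reach_step_wsum (hlim n) (hlim (n+1) p s (by rw [h]; simp)) ih hw
          · rw [h, Function.update_of_ne hpq] at h1; exact ih p h1
    intro p hp
    obtain ⟨t, ht⟩ := mem_dom_iff.1 hp
    obtain ⟨n, hn⟩ := (hl p t).1 ht
    exact this n p (by rw [hn]; simp)

/-- The fair greedy sequence from `α` towards `β`. -/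
def greedy (τ : ℕ) (α β : Config 3) (e : ℕ → Pt 3) : ℕ → Config 3
  | 0 => α
  | n+1 => if greedy τ α β e n (e n) = none ∧
        ∃ t, β (e n) = some t ∧ τ ≤ wsum (greedy τ α β e n) (e n) t
      then Function.update (greedy τ α β e n) (e n) (β (e n)) else greedy τ α β e n

lemma produces_of_data (hne : (dom α).Nonempty) (hst : Stable T.temp α)
    (hext : Extends α β) (ht : ∀ p t, β p = some t → α p = none → t ∈ T.tileset)
    (hr : ∀ p ∈ dom β, Reach T.temp α β p) : ProducesFrom (Attach T) α β := by
  obtain ⟨h, hh⟩ := exists_surjective_nat (Pt 3)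
  set e : ℕ → Pt 3 := fun n => h (Nat.unpair n).1 with he
  have hinf : ∀ p N, ∃ n, N ≤ n ∧ e n = p := by
    intro p N
    obtain ⟨k, hk⟩ := hh p
    exact ⟨Nat.pair k N, Nat.right_le_pair k N, by simp [he, hk]⟩
  set f := greedy T.temp α β e with hf
  have hsucc : ∀ n, f (n+1) = if f n (e n) = none ∧
        ∃ t, β (e n) = some t ∧ T.temp ≤ wsum (f n) (e n) t
      then Function.update (f n) (e n) (β (e n)) else f n := fun n => rfl
  have hE : ∀ n, Extends (f n) (f (n+1)) := by
    intro n
    rw [hsucc]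
    split_ifs with hc
    · obtain ⟨h1, t, h2, h3⟩ := hc
      rw [h2]; exact extends_update h1 t
    · exact extends_refl _
  have hEle : ∀ m n, m ≤ n → Extends (f m) (f n) := by
    intro m n hmn
    induction n, hmn using Nat.le_induction with
    | base => exact extends_refl _
    | succ n _ ih => exact extends_trans ih (hE n)
  have hB : ∀ n, Extends (f n) β := by
    intro n
    induction n with
    | zero => exact hext
    | succ n ih =>
      rw [hsucc]
      split_ifs with hc
      · intro p t hp
        by_cases hpe : p = e n
        · subst hpe; simpa using hp
        · rw [Function.update_of_ne hpe] at hp; exact ih p t hp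
      · exact ih
  have hS : ∀ n, Stable T.temp (f n) := by
    intro n
    induction n with
    | zero => exact hst
    | succ n ih =>
      rw [hsucc]
      split_ifs with hc
      · obtain ⟨h1, t, h2, h3⟩ := hc
        rw [h2]; exact stable_update ih h1 h3
      · exact ih
  have hfα : ∀ n, Extends α (f n) := fun n => hEle 0 n (Nat.zero_le _)
  refine ⟨f, rfl, ?_, ?_⟩
  · intro n
    by_cases hc : f n (e n) = none ∧
        ∃ t, β (e n) = some t ∧ T.temp ≤ wsum (f n) (e n) t
    · right
      obtain ⟨h1, t, h2, h3⟩ := hc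
      rw [attach_iff (hne.mono (dom_mono (hfα n))) (hS n)]
      refine ⟨e n, t, h1, ht _ _ h2 ?_, ?_, h3⟩
      · cases h4 : α (e n) with
        | none => rfl
        | some s => rw [hfα n _ _ h4] at h1; cases h1
      · rw [hsucc, if_pos ⟨h1, t, h2, h3⟩, h2]
    · left; rw [hsucc, if_neg hc]
  · have key : ∀ p, Reach T.temp α β p → ∃ n, f n p ≠ none := by
      intro p hp
      induction hp with
      | base p h => exact ⟨0, h⟩
      | step p t S hp _ hw ih =>
        have : ∃ N, ∀ d ∈ S, f N (stp d p) ≠ none := by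
          choose! g hg using ih
          refine ⟨S.sup g, fun d hd => ?_⟩
          exact dom_mono (hEle _ _ (Finset.le_sup hd)) (hg d hd)
        obtain ⟨N, hN⟩ := this
        obtain ⟨n, hn, hen⟩ := hinf p N
        by_cases hemp : f n p = none
        · refine ⟨n+1, ?_⟩
          have hw' : T.temp ≤ wsum (f n) p t := by
            refine hw.trans ?_
            calc _ = ∑ d ∈ S, nb (f n) t p d := by
                  apply Finset.sum_congr rfl
                  intro d hd
                  obtain ⟨s, hs⟩ := mem_dom_iff.1 (dom_mono (hEle N n hn) (hN d hd))
                  unfold nb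
                  rw [hs, hB n _ _ hs]
              _ ≤ _ := Finset.sum_le_univ_sum_of_nonneg (fun _ => Nat.zero_le _)
          rw [hsucc, hen, if_pos ⟨hemp, t, hp, hw'⟩]
          simp [hp]
        · exact ⟨n, hemp⟩
    intro p t
    constructor
    · intro hp
      obtain ⟨n, hn⟩ := key p (hr p (mem_dom_iff.2 ⟨t, hp⟩))
      obtain ⟨s, hs⟩ := mem_dom_iff.1 hn
      have := hB n _ _ hs
      rw [hp] at this
      cases this
      exact ⟨n, hs⟩
    · rintro ⟨n, hn⟩
      exact hB n _ _ hn

lemma produces_stable (hne : (dom α).Nonempty) (hst : Stable T.temp α)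
    (h : ProducesFrom (Attach T) α β) : Stable T.temp β := by
  obtain ⟨h1, _, h3⟩ := produces_data hne h
  exact stable_of_reach hst h1 h3

end produces

/-- `α` is producible in `T`. -/
def Pble (T : TAS 3) (α : Config 3) : Prop := ProducesFrom (Attach T) T.seed α

section prod
variable {T : TAS 3} {α β : Config 3}

lemma pble_iff : Pble T α ↔ Extends T.seed α ∧ (∀ p t, α p = some t → t ∈ T.tileset) ∧
    ∀ p ∈ dom α, Reach T.temp T.seed α p := by
  constructor
  · intro h
    obtain ⟨h1, h2, h3⟩ := produces_data T.seed_nonempty h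
    refine ⟨h1, ?_, h3⟩
    intro p t hp
    cases e : T.seed p with
    | none => exact h2 p t hp e
    | some s =>
      have := h1 _ _ e
      rw [hp] at this
      cases this
      exact T.seed_tiles _ _ e
  · rintro ⟨h1, h2, h3⟩
    exact produces_of_data T.seed_nonempty T.seed_stable h1 (fun p t hp _ => h2 p t hp) h3

lemma Pble.ext (h : Pble T α) : Extends T.seed α := (pble_iff.1 h).1
lemma Pble.tiles (h : Pble T α) : ∀ p t, α p = some t → t ∈ T.tileset := (pble_iff.1 h).2.1
lemma Pble.reach (h : Pble T α) : ∀ p ∈ dom α, Reach T.temp T.seed α p := (pble_iff.1 h).2.2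
lemma Pble.stable (h : Pble T α) : Stable T.temp α :=
  produces_stable T.seed_nonempty T.seed_stable h
lemma Pble.nonempty (h : Pble T α) : (dom α).Nonempty := T.seed_nonempty.mono (dom_mono h.ext)

lemma pble_seed : Pble T T.seed :=
  pble_iff.2 ⟨extends_refl _, T.seed_tiles, fun p hp => .base p hp⟩

lemma reach_relative {τ : ℕ} {σ : Config 3} (hσ : Extends σ α) {p : Pt 3}
    (hr : Reach τ σ β p) : Reach τ α β p := by
  induction hr with
  | base p h => exact .base p (dom_mono hσ h)
  | step p t S hp _ hw ih => exact .step p t S hp ih hw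

lemma Pble.from_iff (hα : Pble T α) (hβ : Pble T β) :
    ProducesFrom (Attach T) α β ↔ Extends α β := by
  constructor
  · exact fun h => (produces_data hα.nonempty h).1
  · intro h
    exact produces_of_data hα.nonempty hα.stable h (fun p t hp _ => hβ.tiles p t hp)
      (fun p hp => reach_relative hα.ext (hβ.reach p hp))

lemma Pble.trans (hα : Pble T α) (h : ProducesFrom (Attach T) α β) : Pble T β := by
  obtain ⟨h1, h2, h3⟩ := produces_data hα.nonempty h
  refine pble_iff.2 ⟨extends_trans hα.ext h1, ?_, ?_⟩
  · intro p t hp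
    cases e : α p with
    | none => exact h2 p t hp e
    | some s =>
      have := h1 _ _ e
      rw [hp] at this
      cases this
      exact hα.tiles _ _ e
  · intro p hp
    have := h3 p hp
    clear hp
    induction this with
    | base p h => exact reach_mono_right h1 (hα.reach p h)
    | step p t S hp _ hw ih => exact .step p t S hp ih hw

lemma Pble.update (hα : Pble T α) {p : Pt 3} (hp : α p = none) {t : TileType 3}
    (ht : t ∈ T.tileset) (hw : T.temp ≤ wsum α p t) :
    Pble T (Function.update α p (some t)) := by
  have hE := extends_update hp t
  refine pble_iff.2 ⟨extends_trans hα.ext hE, ?_, ?_⟩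
  · intro q s hq
    by_cases h : q = p
    · subst h; simp at hq; exact hq ▸ ht
    · rw [Function.update_of_ne h] at hq; exact hα.tiles _ _ hq
  · have hold : ∀ q, α q ≠ none → Reach T.temp T.seed (Function.update α p (some t)) q :=
      fun q hq => reach_mono_right hE (hα.reach q hq)
    intro q hq
    by_cases h : q = p
    · subst h
      exact reach_step_wsum hE (by simp) hold hw
    · rw [mem_dom, Function.update_of_ne h] at hq
      exact hold q hq

/-- Induction principle for producible assemblies. -/
lemma pble_induction {P : Config 3 → Prop} (h0 : P T.seed)
    (hstep : ∀ α p t, Pble T α → P α → α p = none → t ∈ T.tileset → T.temp ≤ wsum α p t →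
      P (Function.update α p (some t)))
    (hlim : ∀ (f : ℕ → Config 3) β, (∀ n, Extends (f n) (f (n+1))) → (∀ n, P (f n)) →
      (∀ n, Pble T (f n)) → Limit f β → Pble T β → P β)
    (h : Pble T α) : P α := by
  have hprod := h
  obtain ⟨f, hf0, hc, hl⟩ := h
  have : ∀ n, Pble T (f n) ∧ P (f n) := by
    intro n
    induction n with
    | zero => rw [hf0]; exact ⟨pble_seed, h0⟩
    | succ n ih =>
      rcases hc n with h | h
      · rw [← h]; exact ih
      · obtain ⟨p, t, hp, ht, e, hw⟩ := (attach_iff ih.1.nonempty ih.1.stable).1 h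
        rw [e]
        exact ⟨ih.1.update hp ht hw, hstep _ _ _ ih.1 ih.2 hp ht hw⟩
  exact hlim f α (chain_extends hc) (fun n => (this n).2) (fun n => (this n).1) hl hprod

/-- Every producible assembly extends to a producible assembly maximal among those
satisfying a chain-closed property. -/
lemma exists_maximal (Q : Set (Config 3)) (hQ : ∀ α ∈ Q, Pble T α)
    (hclosed : ∀ (c : Set (Config 3)) (γ : Config 3), c ⊆ Q → c.Nonempty →
      (∀ p t, γ p = some t ↔ ∃ α ∈ c, α p = some t) → Pble T γ → γ ∈ Q)
    (hα : α ∈ Q) : ∃ β ∈ Q, Extends α β ∧ ∀ γ ∈ Q, Extends β γ → γ = β := by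
  have := exists_maximal_of_chains_bounded (α := {x : Config 3 // x ∈ Q ∧ Extends α x})
    (r := fun a b => Extends a.1 b.1) ?_ (fun h h' => extends_trans h h')
  · obtain ⟨m, hm⟩ := this
    refine ⟨m.1, m.2.1, m.2.2, ?_⟩
    intro γ hγ hext
    exact extends_antisymm (hm ⟨γ, hγ, extends_trans m.2.2 hext⟩ hext) hext
  · intro c hc
    by_cases hcne : c.Nonempty
    · let γ : Config 3 := fun p => if h : ∃ x ∈ c, x.1 p ≠ none then h.choose.1 p else none
      have key : ∀ p t, γ p = some t ↔ ∃ x ∈ c, x.1 p = some t := by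
        intro p t
        have agree : ∀ x ∈ c, ∀ y ∈ c, ∀ t, x.1 p = some t → y.1 p ≠ none → y.1 p = some t := by
          intro x hx y hy t hxp hyp
          obtain ⟨s, hs⟩ := Option.ne_none_iff_exists'.1 hyp
          have htot : Extends x.1 y.1 ∨ Extends y.1 x.1 := by
            by_cases hxy : x = y
            · subst hxy; exact Or.inl (extends_refl _)
            · exact hc hx hy hxy
          rcases htot with h | h
          · exact h _ _ hxp
          · have := h _ _ hs
            rw [hxp] at this
            rw [hs, this]
        constructor
        · intro h
          by_cases hex : ∃ x ∈ c, x.1 p ≠ none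
          · simp only [γ, dif_pos hex] at h
            exact ⟨hex.choose, hex.choose_spec.1, h⟩
          · simp only [γ, dif_neg hex] at h
            cases h
        · rintro ⟨x, hx, hxp⟩
          have hex : ∃ x ∈ c, x.1 p ≠ none := ⟨x, hx, by rw [hxp]; simp⟩
          simp only [γ, dif_pos hex]
          exact agree x hx _ hex.choose_spec.1 t hxp hex.choose_spec.2
      have hub : ∀ x ∈ c, Extends x.1 γ := fun x hx p t h => (key p t).2 ⟨x, hx, h⟩
      obtain ⟨x0, hx0⟩ := hcne
      have hγ : γ ∈ Q := by
        refine hclosed (Set.image Subtype.val c) γ ?_ ⟨x0.1, x0, hx0, rfl⟩ ?_ ?_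
        · rintro _ ⟨x, -, rfl⟩; exact x.2.1
        · intro p t
          rw [key]
          constructor
          · rintro ⟨x, hx, h⟩; exact ⟨x.1, ⟨x, hx, rfl⟩, h⟩
          · rintro ⟨_, ⟨x, hx, rfl⟩, h⟩; exact ⟨x, hx, h⟩
        · refine pble_iff.2 ⟨extends_trans (hQ _ x0.2.1).ext (hub x0 hx0), ?_, ?_⟩
          · intro p t hp
            obtain ⟨x, _, h⟩ := (key p t).1 hp
            exact (hQ _ x.2.1).tiles p t h
          · intro p hp
            obtain ⟨t, ht⟩ := mem_dom_iff.1 hp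
            obtain ⟨x, hx, h⟩ := (key p t).1 ht
            exact reach_mono_right (hub x hx) ((hQ _ x.2.1).reach p (mem_dom_iff.2 ⟨t, h⟩))
      exact ⟨⟨γ, hγ, extends_trans x0.2.2 (hub x0 hx0)⟩, hub⟩
    · rw [Set.not_nonempty_iff_eq_empty] at hcne
      exact ⟨⟨α, hα, extends_refl _⟩, by simp [hcne]⟩

lemma Pble.exists_terminal (hα : Pble T α) :
    ∃ β, Pble T β ∧ Extends α β ∧ Terminal (Attach T) β := by
  obtain ⟨β, hβ, hE, hm⟩ := exists_maximal (T := T) {α | Pble T α} (fun _ h => h)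
    (fun _ _ _ _ _ h => h) hα
  refine ⟨β, hβ, hE, ?_⟩
  rw [terminal_iff (Pble.nonempty hβ) (Pble.stable hβ)]
  intro p t hp ht
  by_contra hw
  have := hm _ (Pble.update hβ hp ht (not_lt.1 hw)) (extends_update hp t)
  have h2 := congrFun this p
  simp [hp] at h2

end prod

/-- A connected configuration all of whose adjacent pairs bond with strength `≥ τ` is stable. -/
lemma stable_of_connected {τ : ℕ} {α : Config 3} (G : Pt 3 → Pt 3 → Prop)
    (hG : ∀ p q, G p q → τ ≤ bondAt α p q)
    (hconn : ∀ p ∈ dom α, ∀ q ∈ dom α,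
      Relation.ReflTransGen (fun a b => G a b ∧ a ∈ dom α ∧ b ∈ dom α) p q) :
    Stable τ α := by
  intro A B ⟨a, ha⟩ ⟨b, hb⟩ hdis hAB
  have hpath := hconn a (hAB ▸ Or.inl ha) b (hAB ▸ Or.inr hb)
  have : ∃ x ∈ A, ∃ y ∈ B, G x y := by
    induction hpath with
    | refl => exact absurd hb (Set.disjoint_left.1 hdis ha)
    | tail _ hstep ih =>
      rename_i y z _
      have : y ∈ A ∪ B := hAB ▸ hstep.2.1
      rcases this with hy | hy
      · exact ⟨y, hy, z, hb, hstep.1⟩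
      · exact ih hy
  obtain ⟨x, hx, y, hy, hxy⟩ := this
  exact ⟨{(x, y)}, by simp [hx, hy], by simpa using hG _ _ hxy⟩

lemma adj_iff {p q : Pt 3} : adj p q ↔ ∃ d, q = stp d p := by
  unfold adj
  rw [Fin.sum_univ_three]
  constructor
  · intro h
    have key : ∀ (i : Fin 3) (b : Bool), q i = p i + sg (i, b) → (∀ j, j ≠ i → q j = p j) →
        ∃ d, q = stp d p := by
      intro i b h1 h2
      refine ⟨(i, b), ?_⟩
      funext j
      by_cases hj : j = i
      · subst hj; rw [h1]; simp [stp]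
      · rw [h2 j hj, stp_ne _ _ hj]
    have e0 := abs_nonneg (p 0 - q 0)
    have e1 := abs_nonneg (p 1 - q 1)
    have e2 := abs_nonneg (p 2 - q 2)
    have : (|p 0 - q 0| = 1 ∧ p 1 - q 1 = 0 ∧ p 2 - q 2 = 0) ∨
        (p 0 - q 0 = 0 ∧ |p 1 - q 1| = 1 ∧ p 2 - q 2 = 0) ∨
        (p 0 - q 0 = 0 ∧ p 1 - q 1 = 0 ∧ |p 2 - q 2| = 1) := by
      simp only [← abs_eq_zero (a := p 0 - q 0), ← abs_eq_zero (a := p 1 - q 1),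
        ← abs_eq_zero (a := p 2 - q 2)]
      omega
    rcases this with ⟨h0, h1, h2⟩ | ⟨h0, h1, h2⟩ | ⟨h0, h1, h2⟩
    · rcases (abs_eq zero_le_one).1 h0 with h | h
      · refine key 0 false (by simp [sg]; omega) ?_
        intro j hj; fin_cases j <;> simp at hj ⊢ <;> omega
      · refine key 0 true (by simp [sg]; omega) ?_
        intro j hj; fin_cases j <;> simp at hj ⊢ <;> omega
    · rcases (abs_eq zero_le_one).1 h1 with h | h
      · refine key 1 false (by simp [sg]; omega) ?_
        intro j hj; fin_cases j <;> simp at hj ⊢ <;> omega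
      · refine key 1 true (by simp [sg]; omega) ?_
        intro j hj; fin_cases j <;> simp at hj ⊢ <;> omega
    · rcases (abs_eq zero_le_one).1 h2 with h | h
      · refine key 2 false (by simp [sg]; omega) ?_
        intro j hj; fin_cases j <;> simp at hj ⊢ <;> omega
      · refine key 2 true (by simp [sg]; omega) ?_
        intro j hj; fin_cases j <;> simp at hj ⊢ <;> omega
  · rintro ⟨⟨i, b⟩, rfl⟩
    fin_cases i <;> cases b <;> simp [stp_apply, sg]

end IU

namespace IU

/-! ## Part B: directed systems -/

/-- A directed tile system together with its terminal assembly. -/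
structure Ctx where
  T : TAS 3
  top : Config 3
  htop : Pble T top
  hterm : Terminal (Attach T) top
  huniq : ∀ α, Pble T α → Extends α top

lemma exists_ctx (T : TAS 3) (h : DirectedSys (Attach T) T.seed) : ∃ C : Ctx, C.T = T := by
  obtain ⟨top, ⟨h1, h2⟩, h3⟩ := h
  refine ⟨⟨T, top, h1, h2, ?_⟩, rfl⟩
  intro α hα
  obtain ⟨β, hβ, hE, hT⟩ := hα.exists_terminal
  rw [← h3 β ⟨hβ, hT⟩]
  exact hE

namespace Ctx
variable (C : Ctx)

/-- Restriction of the terminal assembly. -/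
def rst (A : Set (Pt 3)) : Config 3 := fun x => if x ∈ A then C.top x else none

/-- The set `A` is (the domain of) a producible assembly. -/
def PA (A : Set (Pt 3)) : Prop := A ⊆ dom C.top ∧ Pble C.T (C.rst A)

variable {C}

lemma rst_dom {α : Config 3} (h : Pble C.T α) : C.rst (dom α) = α := by
  funext x
  unfold rst
  split_ifs with hx
  · obtain ⟨t, ht⟩ := mem_dom_iff.1 hx
    rw [ht, C.huniq α h x t ht]
  · by_contra h'
    exact hx (Ne.symm h')

lemma PA_dom {α : Config 3} (h : Pble C.T α) : C.PA (dom α) :=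
  ⟨dom_mono (C.huniq α h), by rw [rst_dom h]; exact h⟩

lemma dom_rst {A : Set (Pt 3)} (h : A ⊆ dom C.top) : dom (C.rst A) = A := by
  ext x
  rw [mem_dom]
  unfold rst
  by_cases hx : x ∈ A
  · simp only [hx, if_true, iff_true]; exact h hx
  · simp [hx]

lemma rst_mono {A B : Set (Pt 3)} (h : A ⊆ B) : Extends (C.rst A) (C.rst B) := by
  intro x t hx
  unfold rst at *
  split_ifs at hx with hA
  rw [if_pos (h hA)]; exact hx

lemma rst_seed : C.rst (dom C.T.seed) = C.T.seed := rst_dom pble_seed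

lemma PA_seed : C.PA (dom C.T.seed) := PA_dom pble_seed

lemma PA.seed_sub {A : Set (Pt 3)} (h : C.PA A) : dom C.T.seed ⊆ A := by
  have := dom_mono h.2.ext
  rwa [dom_rst h.1] at this

lemma rst_insert {A : Set (Pt 3)} {x : Pt 3} {t : TileType 3}
    (ht : C.top x = some t) : C.rst (insert x A) = Function.update (C.rst A) x (some t) := by
  funext y
  by_cases hy : y = x
  · subst hy; simp [rst, ht]
  · simp [rst, hy]

lemma PA.attach {A : Set (Pt 3)} (h : C.PA A) {x : Pt 3} (hx : x ∉ A) {t : TileType 3}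
    (ht : t ∈ C.T.tileset) (hw : C.T.temp ≤ wsum (C.rst A) x t) :
    C.top x = some t ∧ C.PA (insert x A) := by
  have hp := h.2.update (p := x) (by simp [rst, hx]) ht hw
  have h1 : C.top x = some t := C.huniq _ hp x t (by simp)
  refine ⟨h1, ?_, ?_⟩
  · exact Set.insert_subset (mem_dom_iff.2 ⟨t, h1⟩) h.1
  · rw [rst_insert h1]; exact hp

lemma PA.limit {A : ℕ → Set (Pt 3)} (h : ∀ n, C.PA (A n)) : C.PA (⋃ n, A n) := by
  have hsub : (⋃ n, A n) ⊆ dom C.top := Set.iUnion_subset fun n => (h n).1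
  have hE : ∀ n, Extends (C.rst (A n)) (C.rst (⋃ n, A n)) :=
    fun n => rst_mono (Set.subset_iUnion A n)
  refine ⟨hsub, pble_iff.2 ⟨extends_trans (h 0).2.ext (hE 0), ?_, ?_⟩⟩
  · intro p t hp
    unfold rst at hp
    split_ifs at hp
    exact C.htop.tiles p t hp
  · intro p hp
    rw [dom_rst hsub] at hp
    obtain ⟨n, hn⟩ := Set.mem_iUnion.1 hp
    exact reach_mono_right (hE n) ((h n).2.reach p (by rw [dom_rst (h n).1]; exact hn))

variable (C)

def N : ℕ := C.T.tileset.card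
/-- Side of a block, measured in big cells. -/
def n : ℤ := (C.N : ℤ) + 2

/-- Index of a tile. -/
def ix (t : TileType 3) : ℤ :=
  if h : t ∈ C.T.tileset then ((C.T.tileset.equivFin ⟨t, h⟩ : Fin _) : ℕ) else 0

/-- `u` is the index of the tile `t`. -/
def IsIx (u : ℤ) (t : TileType 3) : Prop := t ∈ C.T.tileset ∧ u = C.ix t

variable {C}
lemma n_pos : 0 < C.n := by unfold n; positivity

lemma ix_nonneg (t : TileType 3) : 0 ≤ C.ix t := by
  unfold ix; split_ifs <;> omega

lemma ix_lt' {t : TileType 3} (h : t ∈ C.T.tileset) : C.ix t < C.N := by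
  unfold ix N; rw [dif_pos h]; exact_mod_cast (C.T.tileset.equivFin ⟨t, h⟩).2

lemma ix_lt {t : TileType 3} (h : t ∈ C.T.tileset) : C.ix t < C.n := by
  have := ix_lt' h
  unfold n
  omega

lemma ix_inj {t t' : TileType 3} (h : t ∈ C.T.tileset) (h' : t' ∈ C.T.tileset)
    (e : C.ix t = C.ix t') : t = t' := by
  unfold ix at e
  rw [dif_pos h, dif_pos h'] at e
  have : C.T.tileset.equivFin ⟨t, h⟩ = C.T.tileset.equivFin ⟨t', h'⟩ := Fin.ext (by exact_mod_cast e)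
  have := C.T.tileset.equivFin.injective this
  exact congrArg Subtype.val this

lemma IsIx.uniq {u : ℤ} {t t' : TileType 3} (h : C.IsIx u t) (h' : C.IsIx u t') : t = t' :=
  ix_inj h.1 h'.1 (h.2.symm.trans h'.2)

lemma isIx_ix {t : TileType 3} (h : t ∈ C.T.tileset) : C.IsIx (C.ix t) t := ⟨h, rfl⟩

lemma top_mem {x : Pt 3} {t : TileType 3} (h : C.top x = some t) : t ∈ C.T.tileset :=
  C.htop.tiles x t h

end Ctx
end IU

namespace IU

/-! ## Part C: the big-cell Horn system -/

inductive PQ where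
  | fst | lst | nf | nl
  | suf (S : Finset Dir) | know (δ : Option Dir) | acc (S : Finset Dir) | fi
  deriving DecidableEq, Fintype

inductive BQ where
  | eq | suc | M (d : Dir)
  deriving DecidableEq, Fintype

inductive Atom where
  | pl (a : Fin 3) (q : PQ)
  | bi (a b : Fin 3) (s : BQ)
  | rs | op (d : Dir) | ln | fw | cl | oF | ow | dn | dp | rz | rho
  deriving DecidableEq, Fintype

/-- Properties that do not depend on the state. -/
def PQ.static : PQ → Prop
  | .fst | .lst | .nf | .nl | .suf _ => True
  | _ => False

open Atom in
/-- The rules of the Horn system. -/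
inductive Rl : Atom → Atom → Option Dir → Atom → Prop
  | plUp (a b : Fin 3) (q : PQ) : b ≠ a → Rl (pl a q) (pl b .nl) (some (b, true)) (pl a q)
  | plDn (a b : Fin 3) (q : PQ) : b ≠ a → Rl (pl a q) (pl b .nf) (some (b, false)) (pl a q)
  | plEq (a b : Fin 3) (q : PQ) : Rl (pl a q) (bi a b .eq) none (pl b q)
  | biUp (a b c : Fin 3) (s : BQ) : c ≠ a → c ≠ b →
      Rl (bi a b s) (pl c .nl) (some (c, true)) (bi a b s)
  | biDn (a b c : Fin 3) (s : BQ) : c ≠ a → c ≠ b →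
      Rl (bi a b s) (pl c .nf) (some (c, false)) (bi a b s)
  | biR (a b c : Fin 3) (s : BQ) : Rl (bi a b s) (bi b c .eq) none (bi a c s)
  | biL (a b c : Fin 3) (s : BQ) : Rl (bi a b s) (bi a c .eq) none (bi c b s)
  | eqSymm (a b : Fin 3) : Rl (bi a b .eq) (bi a b .eq) none (bi b a .eq)
  | sucUp (a b : Fin 3) : a ≠ b → Rl (bi a b .suc) (bi a b .suc) (some (b, true)) (bi a b .eq)
  | sucDn (a b : Fin 3) : a ≠ b → Rl (bi a b .suc) (bi a b .suc) (some (a, false)) (bi a b .eq)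
  | eqFst (a b : Fin 3) : Rl (pl a .fst) (pl b .fst) none (bi a b .eq)
  | eqLst (a b : Fin 3) : Rl (pl a .lst) (pl b .lst) none (bi a b .eq)
  | opUp (c : Fin 3) : Rl rs (pl c .lst) none (op (c, true))
  | opDn (c : Fin 3) : Rl rs (pl c .fst) none (op (c, false))
  | opPl (d : Dir) (a : Fin 3) (q : PQ) : a ≠ d.1 → q.static →
      Rl (op d) (pl a q) (some d) (pl a q)
  | opBi (d : Dir) (a b : Fin 3) (s : BQ) : a ≠ d.1 → b ≠ d.1 →
      Rl (op d) (bi a b s) (some d) (bi a b s)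
  | opFst (c : Fin 3) : Rl (op (c, true)) (op (c, true)) (some (c, true)) (pl c .fst)
  | opLst (c : Fin 3) : Rl (op (c, false)) (op (c, false)) (some (c, false)) (pl c .lst)
  | opKnow (d : Dir) (a : Fin 3) : a ≠ d.1 →
      Rl (op d) (pl a (.know none)) (some d) (pl a (.know (some (opp d))))
  | accI (d : Dir) : Rl (pl 1 (.know (some d))) (bi 0 1 (.M d)) none (pl 0 (.acc {d}))
  | accU (D D' : Finset Dir) : Rl (pl 0 (.acc D)) (pl 0 (.acc D')) none (pl 0 (.acc (D ∪ D')))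
  | accF (D : Finset Dir) : Rl (pl 0 (.acc D)) (pl 0 (.suf D)) none (pl 0 .fi)
  | lnI : Rl (pl 1 .fst) (pl 2 .fst) none ln
  | fwI : Rl (pl 0 .fi) ln none fw
  | clI : Rl ow ow none cl
  | clUp : Rl cl (pl 0 .nl) (some (0, true)) cl
  | clDn : Rl cl (pl 0 .nf) (some (0, false)) cl
  | dnI : Rl oF (pl 0 .fst) none dn
  | dpI : Rl dn (pl 0 .nl) (some (0, true)) dp
  | dnS : Rl dp oF none dn
  | rzI : Rl dn (pl 0 .lst) none rz
  | rhoI : Rl rz rz none rho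
  | rsI : Rl rho rho none rs
  | rsUp (b : Fin 3) : Rl rs (pl b .nl) (some (b, true)) rs
  | rsDn (b : Fin 3) : Rl rs (pl b .nf) (some (b, false)) rs
  | knI : Rl ow rs none (pl 0 (.know none))

namespace Ctx
variable (C : Ctx)

/-- The big cell with block `x` and local coordinates `u`. -/
def mc (x u : Pt 3) : Pt 3 := fun i => C.n * x i + u i

def blk (P : Pt 3) : Pt 3 := fun i => P i / C.n
def loc (P : Pt 3) : Pt 3 := fun i => P i % C.n

def InBox (u : Pt 3) : Prop := ∀ i, 0 ≤ u i ∧ u i < C.n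

/-- Line cell number `i` of block `x`. -/
def line (x : Pt 3) (i : ℤ) : Pt 3 := C.mc x ![i, 0, 0]

def Near (A : Set (Pt 3)) (x : Pt 3) : Prop := x ∈ A ∨ ∃ d, stp d x ∈ A

def MT (d : Dir) (u v : ℤ) : Prop :=
  ∃ t t', C.IsIx u t ∧ C.IsIx v t' ∧ face t d = face t' (opp d) ∧ 0 < (face t d).2

def Known (A : Set (Pt 3)) (y : Pt 3) (v : ℤ) : Prop := y ∈ A ∧ ∃ t, C.top y = some t ∧ v = C.ix t

def AccT (A : Set (Pt 3)) (x : Pt 3) (D : Finset Dir) (u : ℤ) : Prop :=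
  ∀ d ∈ D, ∃ v, C.Known A (stp d x) v ∧ C.MT d u v

def SufT (D : Finset Dir) (u : ℤ) : Prop :=
  ∃ t, C.IsIx u t ∧ C.T.temp ≤ ∑ d ∈ D, (face t d).2

def PlT (A : Set (Pt 3)) (x : Pt 3) (u : ℤ) : PQ → Prop
  | .fst => u = 0
  | .lst => u = C.n - 1
  | .nf => u ≠ 0
  | .nl => u ≠ C.n - 1
  | .suf S => C.SufT S u
  | .know none => C.Known A x u
  | .know (some d) => C.Known A (stp d x) u
  | .acc D => C.AccT A x D u
  | .fi => ∃ D, C.SufT D u ∧ C.AccT A x D u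

def BiT (u v : ℤ) : BQ → Prop
  | .eq => u = v
  | .suc => u = v + 1
  | .M d => C.MT d u v

/-- `x` is resolved or ready to be resolved, with tile `t`. -/
def Ok (A : Set (Pt 3)) (x : Pt 3) (t : TileType 3) : Prop :=
  C.top x = some t ∧ (x ∈ A ∨ C.T.temp ≤ wsum (C.rst A) x t)

/-- Truth of an atom at the cell with block `x`, local coordinates `u`. -/
def TrL (A F : Set (Pt 3)) (x u : Pt 3) : Atom → Prop
  | .pl a q => C.PlT A x (u a) q
  | .bi a b s => C.BiT (u a) (u b) s
  | .rs => x ∈ A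
  | .op d => x ∈ A ∧ u d.1 = if d.2 then C.n - 1 else 0
  | .ln => u 1 = 0 ∧ u 2 = 0
  | .fw => (u 1 = 0 ∧ u 2 = 0) ∧ C.PlT A x (u 0) .fi
  | .cl => (u 1 = 0 ∧ u 2 = 0) ∧ ∃ t, C.Ok A x t ∧ C.line x (C.ix t) ∈ F
  | .oF => (u 1 = 0 ∧ u 2 = 0) ∧ ∃ t, C.Ok A x t ∧ C.line x (u 0) ∈ F
  | .ow => (u 1 = 0 ∧ u 2 = 0) ∧ ∃ t, C.Ok A x t ∧ C.line x (u 0) ∈ F ∧ u 0 = C.ix t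
  | .dn => (u 1 = 0 ∧ u 2 = 0) ∧ ∃ t, C.Ok A x t ∧ ∀ i, 0 ≤ i → i ≤ u 0 → C.line x i ∈ F
  | .dp => (u 1 = 0 ∧ u 2 = 0) ∧ ∃ t, C.Ok A x t ∧ ∀ i, 0 ≤ i → i < u 0 → C.line x i ∈ F
  | .rz => (u 1 = 0 ∧ u 2 = 0) ∧ u 0 = C.n - 1 ∧
      ∃ t, C.Ok A x t ∧ ∀ i, 0 ≤ i → i < C.n → C.line x i ∈ F
  | .rho => (u 1 = 0 ∧ u 2 = 0) ∧ u 0 = C.n - 1 ∧ x ∈ A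

def Tr (A F : Set (Pt 3)) (P : Pt 3) (e : Atom) : Prop :=
  Near A (C.blk P) ∧ C.TrL A F (C.blk P) (C.loc P) e

variable {C}

lemma mk_blk_loc (P : Pt 3) : C.mc (C.blk P) (C.loc P) = P := by
  funext i; unfold mc blk loc; exact Int.mul_ediv_add_emod (P i) C.n

lemma loc_inBox (P : Pt 3) : C.InBox (C.loc P) :=
  fun i => ⟨Int.emod_nonneg _ n_pos.ne', Int.emod_lt_of_pos _ n_pos⟩

lemma blk_mk {x u : Pt 3} (h : C.InBox u) : C.blk (C.mc x u) = x := by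
  funext i; unfold blk mc
  rw [Int.mul_add_ediv_left _ _ n_pos.ne', Int.ediv_eq_zero_of_lt (h i).1 (h i).2, add_zero]

lemma loc_mk {x u : Pt 3} (h : C.InBox u) : C.loc (C.mc x u) = u := by
  funext i; unfold loc mc
  rw [Int.mul_add_emod_self_left, Int.emod_eq_of_lt (h i).1 (h i).2]

lemma tr_mk {A F : Set (Pt 3)} {x u : Pt 3} (h : C.InBox u) (e : Atom) :
    C.Tr A F (C.mc x u) e ↔ Near A x ∧ C.TrL A F x u e := by
  unfold Tr; rw [blk_mk h, loc_mk h]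

lemma exists_mk (P : Pt 3) : ∃ x u, C.InBox u ∧ P = C.mc x u :=
  ⟨C.blk P, C.loc P, loc_inBox P, (mk_blk_loc P).symm⟩

lemma stp_mk (d : Dir) (x u : Pt 3) : stp d (C.mc x u) = C.mc x (stp d u) := by
  funext i
  simp only [stp_apply, mc]; ring

lemma stp_mk_cross (d : Dir) (x u : Pt 3) :
    stp d (C.mc x u) = C.mc (stp d x) (Function.update u d.1 (u d.1 + sg d - C.n * sg d)) := by
  funext i
  by_cases h : i = d.1
  · subst h; simp [stp_apply, mc]; ring
  · simp [stp_apply, mc, h]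

lemma inBox_update {u : Pt 3} (h : C.InBox u) {a : Fin 3} {v : ℤ} (h0 : 0 ≤ v) (h1 : v < C.n) :
    C.InBox (Function.update u a v) := by
  intro i
  by_cases hi : i = a
  · subst hi; simp [h0, h1]
  · simp [hi, h i]

lemma inBox_stp_up {u : Pt 3} (h : C.InBox u) {b : Fin 3} (hb : u b ≠ C.n - 1) :
    C.InBox (stp (b, true) u) := by
  apply inBox_update h
  · have := (h b).1; simp [sg]; omega
  · have := (h b).2; simp [sg]; omega

lemma inBox_stp_dn {u : Pt 3} (h : C.InBox u) {b : Fin 3} (hb : u b ≠ 0) :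
    C.InBox (stp (b, false) u) := by
  apply inBox_update h
  · have := (h b).1; simp [sg]; omega
  · have := (h b).2; simp [sg]; omega

lemma n_ge : 2 ≤ C.n := by unfold n; omega

lemma line_inBox {i : ℤ} (h0 : 0 ≤ i) (h1 : i < C.n) : C.InBox ![i, 0, 0] := by
  have := C.n_pos
  intro j; fin_cases j <;> simp <;> omega

lemma Ok.uniq {A : Set (Pt 3)} {x : Pt 3} {t t' : TileType 3} (h : C.Ok A x t) (h' : C.Ok A x t') :
    t = t' := by
  have := h.1.symm.trans h'.1
  cases this; rfl

lemma Near.mono {A A' : Set (Pt 3)} {x : Pt 3} (h : Near A x) (hA : A ⊆ A') : Near A' x := by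
  rcases h with h | ⟨d, h⟩
  · exact Or.inl (hA h)
  · exact Or.inr ⟨d, hA h⟩

lemma Ok.mono {A A' : Set (Pt 3)} {x : Pt 3} {t : TileType 3} (h : C.Ok A x t) (hA : A ⊆ A') :
    C.Ok A' x t :=
  ⟨h.1, h.2.imp (fun h => hA h) (fun h => h.trans (wsum_mono (rst_mono hA) _ _))⟩

lemma Known.mono {A A' : Set (Pt 3)} {x : Pt 3} {v : ℤ} (h : C.Known A x v) (hA : A ⊆ A') :
    C.Known A' x v := ⟨hA h.1, h.2⟩

lemma AccT.mono {A A' : Set (Pt 3)} {x : Pt 3} {D : Finset Dir} {v : ℤ} (h : C.AccT A x D v)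
    (hA : A ⊆ A') : C.AccT A' x D v := fun d hd => by
  obtain ⟨w, h1, h2⟩ := h d hd
  exact ⟨w, h1.mono hA, h2⟩

lemma PlT.mono {A A' : Set (Pt 3)} {x : Pt 3} {v : ℤ} {q : PQ} (h : C.PlT A x v q)
    (hA : A ⊆ A') : C.PlT A' x v q := by
  cases q with
  | know δ => cases δ <;> exact Known.mono h hA
  | acc D => exact AccT.mono h hA
  | fi => obtain ⟨D, h1, h2⟩ := h; exact ⟨D, h1, h2.mono hA⟩
  | _ => exact h

lemma Tr.mono {A A' F F' : Set (Pt 3)} {P : Pt 3} {e : Atom} (h : C.Tr A F P e)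
    (hA : A ⊆ A') (hF : F ⊆ F') : C.Tr A' F' P e := by
  refine ⟨h.1.mono hA, ?_⟩
  have h2 := h.2
  cases e with
  | pl a q => exact PlT.mono h2 hA
  | bi a b s => exact h2
  | rs => exact hA h2
  | op d => exact ⟨hA h2.1, h2.2⟩
  | ln => exact h2
  | fw => exact ⟨h2.1, PlT.mono h2.2 hA⟩
  | cl => obtain ⟨h0, t, h3, h4⟩ := h2; exact ⟨h0, t, h3.mono hA, hF h4⟩
  | oF => obtain ⟨h0, t, h3, h4⟩ := h2; exact ⟨h0, t, h3.mono hA, hF h4⟩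
  | ow => obtain ⟨h0, t, h3, h4, h5⟩ := h2; exact ⟨h0, t, h3.mono hA, hF h4, h5⟩
  | dn => obtain ⟨h0, t, h3, h4⟩ := h2
          exact ⟨h0, t, h3.mono hA, fun i a b => hF (h4 i a b)⟩
  | dp => obtain ⟨h0, t, h3, h4⟩ := h2
          exact ⟨h0, t, h3.mono hA, fun i a b => hF (h4 i a b)⟩
  | rz => obtain ⟨h0, h1, t, h3, h4⟩ := h2
          exact ⟨h0, h1, t, h3.mono hA, fun i a b => hF (h4 i a b)⟩
  | rho => exact ⟨h2.1, h2.2.1, hA h2.2.2⟩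

/-- Target cell of a rule. -/
def tgt (o : Option Dir) (P : Pt 3) : Pt 3 := match o with
  | none => P
  | some d => stp d P

lemma near_stp {A : Set (Pt 3)} {x : Pt 3} (h : x ∈ A) (d : Dir) : Near A (stp d x) :=
  Or.inr ⟨opp d, by simpa using h⟩

lemma cross_inBox {u : Pt 3} (hu : C.InBox u) {d : Dir}
    (h : u d.1 = if d.2 then C.n - 1 else 0) :
    C.InBox (Function.update u d.1 (u d.1 + sg d - C.n * sg d)) := by
  have := C.n_pos
  rcases d with ⟨i, b⟩
  simp only at h ⊢
  cases b
  · apply inBox_update hu <;> simp [h, sg] <;> omega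
  · apply inBox_update hu <;> simp [h, sg] <;> omega

/-- Soundness of the rules (other than the resolution rule). -/
lemma rl_sound {A F : Set (Pt 3)} {a b e : Atom} {o : Option Dir} (hr : Rl a b o e)
    (he : ¬ (a = .rz ∧ e = .rho)) {P : Pt 3}
    (ha : C.Tr A F P a) (hb : C.Tr A F P b) : C.Tr A F (tgt o P) e := by
  obtain ⟨x, u, hu, rfl⟩ := exists_mk (C := C) P
  rw [tr_mk hu] at ha hb
  obtain ⟨hN, ha⟩ := ha
  replace hb := hb.2
  have up : ∀ (b : Fin 3) (e : Atom), u b ≠ C.n - 1 → C.TrL A F x (stp (b, true) u) e →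
      C.Tr A F (tgt (some (b, true)) (C.mc x u)) e := by
    intro b e h1 h2
    change C.Tr A F (stp _ _) _
    rw [stp_mk, tr_mk (inBox_stp_up hu h1)]
    exact ⟨hN, h2⟩
  have down : ∀ (b : Fin 3) (e : Atom), u b ≠ 0 → C.TrL A F x (stp (b, false) u) e →
      C.Tr A F (tgt (some (b, false)) (C.mc x u)) e := by
    intro b e h1 h2
    change C.Tr A F (stp _ _) _
    rw [stp_mk, tr_mk (inBox_stp_dn hu h1)]
    exact ⟨hN, h2⟩
  have stay : ∀ (e : Atom), C.TrL A F x u e → C.Tr A F (tgt none (C.mc x u)) e := by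
    intro e h2
    change C.Tr A F (C.mc x u) _
    rw [tr_mk hu]
    exact ⟨hN, h2⟩
  have cross : ∀ (d : Dir) (e : Atom), (x ∈ A ∧ u d.1 = if d.2 then C.n - 1 else 0) →
      C.TrL A F (stp d x) (Function.update u d.1 (u d.1 + sg d - C.n * sg d)) e →
      C.Tr A F (tgt (some d) (C.mc x u)) e := by
    intro d e h1 h2
    change C.Tr A F (stp _ _) _
    rw [stp_mk_cross, tr_mk (cross_inBox hu h1.2)]
    exact ⟨near_stp h1.1 d, h2⟩
  cases hr with
  | plUp a b q hne => exact up _ _ hb (by simpa [TrL, stp_ne' _ hne.symm] using ha)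
  | plDn a b q hne => exact down _ _ hb (by simpa [TrL, stp_ne' _ hne.symm] using ha)
  | plEq a b q => exact stay _ (by simp only [TrL, BiT] at hb ha ⊢; rwa [← hb])
  | biUp a b c s h1 h2 =>
    exact up _ _ hb (by simpa [TrL, stp_ne' _ h1.symm, stp_ne' _ h2.symm] using ha)
  | biDn a b c s h1 h2 =>
    exact down _ _ hb (by simpa [TrL, stp_ne' _ h1.symm, stp_ne' _ h2.symm] using ha)
  | biR a b c s => exact stay _ (by simp only [TrL] at ha hb ⊢; rwa [← (show u b = u c from hb)])
  | biL a b c s => exact stay _ (by simp only [TrL] at ha hb ⊢; rwa [← (show u a = u c from hb)])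
  | eqSymm a b => exact stay _ (Eq.symm (show u a = u b from ha))
  | sucUp a b h =>
    have ha : u a = u b + 1 := ha
    have h1 := (hu a).2
    refine up _ _ (by omega) ?_
    change stp _ u a = stp _ u b
    rw [stp_ne' _ h, stp_same]; simpa [sg] using ha
  | sucDn a b h =>
    have ha : u a = u b + 1 := ha
    have h1 := (hu b).1
    refine down _ _ (by omega) ?_
    change stp _ u a = stp _ u b
    rw [stp_ne' _ h.symm, stp_same]; simp [sg]; omega
  | eqFst a b => exact stay _ ((show u a = 0 from ha).trans (show u b = 0 from hb).symm)
  | eqLst a b =>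
    exact stay _ ((show u a = C.n - 1 from ha).trans (show u b = C.n - 1 from hb).symm)
  | opUp c => exact stay _ ⟨ha, by simp; exact hb⟩
  | opDn c => exact stay _ ⟨ha, by simp; exact hb⟩
  | opPl d a q h hs =>
    refine cross _ _ ha ?_
    simp only [TrL, Function.update_of_ne h] at hb ⊢
    cases q <;> first | exact hb | exact hs.elim
  | opBi d a b s h h' =>
    refine cross _ _ ha ?_
    simpa [TrL, Function.update_of_ne h, Function.update_of_ne h'] using hb
  | opFst c =>
    refine cross _ _ ha ?_
    have := ha.2
    simp [TrL, PlT, sg] at this ⊢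
    omega
  | opLst c =>
    refine cross _ _ ha ?_
    have := ha.2
    simp [TrL, PlT, sg] at this ⊢
    omega
  | opKnow d a h =>
    refine cross _ _ ha ?_
    simp only [TrL, Function.update_of_ne h, PlT] at hb ⊢
    simpa using hb
  | accI d =>
    refine stay _ ?_
    intro d' hd'
    rw [Finset.mem_singleton] at hd'
    subst hd'
    exact ⟨u 1, ha, hb⟩
  | accU D D' =>
    refine stay _ ?_
    intro d hd
    rcases Finset.mem_union.1 hd with h | h
    · exact ha d h
    · exact hb d h
  | accF D => exact stay _ ⟨D, hb, ha⟩
  | lnI => exact stay _ ⟨ha, hb⟩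
  | fwI => exact stay _ ⟨hb, ha⟩
  | clI =>
    obtain ⟨h0, t, h1, h2, h3⟩ := ha
    exact stay _ ⟨h0, t, h1, h3 ▸ h2⟩
  | clUp =>
    refine up _ _ hb ?_
    simp only [TrL] at ha ⊢
    rwa [stp_ne' _ (by decide), stp_ne' _ (by decide)]
  | clDn =>
    refine down _ _ hb ?_
    simp only [TrL] at ha ⊢
    rwa [stp_ne' _ (by decide), stp_ne' _ (by decide)]
  | dnI =>
    obtain ⟨h0, t, h1, h2⟩ := ha
    refine stay _ ⟨h0, t, h1, ?_⟩
    intro i hi hi'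
    have hb : u 0 = 0 := hb
    have : i = u 0 := by omega
    rw [this]; exact h2
  | dpI =>
    refine up _ _ hb ?_
    obtain ⟨h0, t, h1, h2⟩ := ha
    refine ⟨?_, t, h1, ?_⟩
    · rwa [stp_ne' _ (by decide), stp_ne' _ (by decide)]
    · intro i hi hi'
      have e : stp (0, true) u 0 = u 0 + 1 := by simp [stp, sg]
      rw [e] at hi'
      exact h2 i hi (by omega)
  | dnS =>
    obtain ⟨h0, t, h1, h2⟩ := ha
    obtain ⟨-, t', -, h3⟩ := hb
    refine stay _ ⟨h0, t, h1, ?_⟩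
    intro i hi hi'
    rcases hi'.lt_or_eq with h | h
    · exact h2 i hi h
    · rw [h]; exact h3
  | rzI =>
    obtain ⟨h0, t, h1, h2⟩ := ha
    have hb : u 0 = C.n - 1 := hb
    exact stay _ ⟨h0, hb, t, h1, fun i hi hi' => h2 i hi (by omega)⟩
  | rhoI => exact absurd ⟨rfl, rfl⟩ he
  | rsI => exact stay _ ha.2.2
  | rsUp b => exact up _ _ hb ha
  | rsDn b => exact down _ _ hb ha
  | knI =>
    obtain ⟨h0, t, h1, h2, h3⟩ := ha
    exact stay _ ⟨hb, t, h1.1, h3⟩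

end Ctx
end IU

namespace IU
namespace Ctx

/-! ## Completeness of the Horn system -/

/-- A state of the Horn system closed under all rules, except that only blocks in `B`
may be resolved. -/
structure Closed (C : Ctx) (A B F : Set (Pt 3)) (H : Pt 3 → Atom → Prop) : Prop where
  rule : ∀ {a b o e P}, Rl a b o e → e ≠ .rho → H P a → H P b → H (tgt o P) e
  lockF : ∀ {P}, H P .fw ∨ H P .cl → P ∈ F
  lockO : ∀ {P}, P ∈ F → C.blk P ∉ dom C.T.seed → H P .oF
  lockW : ∀ {P t}, P ∈ F → C.blk P ∉ dom C.T.seed → C.top (C.blk P) = some t →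
    C.loc P 0 = C.ix t → H P .ow
  res : ∀ {x}, H (C.line x (C.n - 1)) .rz → x ∈ B → x ∈ A
  rho : ∀ {x}, x ∈ A → x ∉ dom C.T.seed → H (C.line x (C.n - 1)) .rho
  boot : ∀ {P e}, C.blk P ∈ dom C.T.seed → C.Tr (dom C.T.seed) ∅ P e → e ≠ .rho → H P e

variable {C : Ctx}

lemma box_fill (Q : Pt 3 → Prop) (b : Fin 3)
    (hup : ∀ u, C.InBox u → Q u → u b ≠ C.n - 1 → Q (stp (b, true) u))
    (hdn : ∀ u, C.InBox u → Q u → u b ≠ 0 → Q (stp (b, false) u))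
    {u : Pt 3} (hu : C.InBox u) (hQ : Q u) {v : ℤ} (h0 : 0 ≤ v) (h1 : v < C.n) :
    Q (Function.update u b v) := by
  have e1 := (hu b).1
  have e2 := (hu b).2
  have key1 : ∀ k : ℕ, u b + k < C.n → Q (Function.update u b (u b + k)) := by
    intro k
    induction k with
    | zero => intro _; simpa using hQ
    | succ k ih =>
      intro hk
      push_cast at hk ⊢
      have := hup _ (inBox_update hu (by omega) (by omega)) (ih (by omega)) (by simp; omega)
      convert this using 1
      simp [stp, sg, add_assoc]
  have key2 : ∀ k : ℕ, 0 ≤ u b - k → Q (Function.update u b (u b - k)) := by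
    intro k
    induction k with
    | zero => intro _; simpa using hQ
    | succ k ih =>
      intro hk
      push_cast at hk ⊢
      have := hdn _ (inBox_update hu (by omega) (by omega)) (ih (by omega)) (by simp; omega)
      convert this using 1
      simp [stp, sg]
      congr 1; ring
  rcases le_total (u b) v with h | h
  · have := key1 (v - u b).toNat (by omega)
    rwa [show u b + ((v - u b).toNat : ℤ) = v by omega] at this
  · have := key2 (u b - v).toNat (by omega)
    rwa [show u b - ((u b - v).toNat : ℤ) = v by omega] at this

/-- As `box_fill`, with endpoint given as a point agreeing off axis `b`. -/
lemma box_fill' (Q : Pt 3 → Prop) (b : Fin 3)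
    (hup : ∀ u, C.InBox u → Q u → u b ≠ C.n - 1 → Q (stp (b, true) u))
    (hdn : ∀ u, C.InBox u → Q u → u b ≠ 0 → Q (stp (b, false) u))
    {u w : Pt 3} (hw : C.InBox w) (v : ℤ) (h0 : 0 ≤ v) (h1 : v < C.n) (hu : u = Function.update w b v)
    (hQ : Q u) : Q w := by
  subst hu
  have := box_fill Q b hup hdn (inBox_update hw h0 h1) hQ (hw b).1 (hw b).2
  simpa using this

/-- Static truths. -/
def StT (C : Ctx) (v : ℤ) (q : PQ) : Prop := q.static ∧ C.PlT ∅ 0 v q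

lemma third (a c : Fin 3) : ∃ b : Fin 3, b ≠ a ∧ b ≠ c := by
  revert a c; decide

lemma third_eq {a c b i : Fin 3} (h : a ≠ c) (h1 : b ≠ a) (h2 : b ≠ c) :
    i = a ∨ i = b ∨ i = c := by
  revert a c b i; decide

section closed
variable {A B F : Set (Pt 3)} {H : Pt 3 → Atom → Prop}

/-- All static facts are present at the cell `u` of block `x`. -/
def StatAt (C : Ctx) (H : Pt 3 → Atom → Prop) (x u : Pt 3) : Prop :=
  (∀ a q, C.StT (u a) q → H (C.mc x u) (.pl a q)) ∧
  (∀ a b s, a ≠ b → C.BiT (u a) (u b) s → H (C.mc x u) (.bi a b s))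

def Stat (C : Ctx) (H : Pt 3 → Atom → Prop) (x : Pt 3) : Prop :=
  ∀ u, C.InBox u → StatAt C H x u

lemma Closed.stay (h : C.Closed A B F H) {P : Pt 3} {a b e : Atom} (hr : Rl a b none e)
    (he : e ≠ .rho) (h1 : H P a) (h2 : H P b) : H P e := h.rule hr he h1 h2

lemma Closed.move (h : C.Closed A B F H) {x u : Pt 3} {a b e : Atom} {d : Dir}
    (hr : Rl a b (some d) e)
    (he : e ≠ .rho) (h1 : H (C.mc x u) a) (h2 : H (C.mc x u) b) : H (C.mc x (stp d u)) e := by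
  rw [← stp_mk]; exact h.rule hr he h1 h2

lemma stT_nl {v : ℤ} (h : v ≠ C.n - 1) : C.StT v .nl := ⟨trivial, h⟩
lemma stT_nf {v : ℤ} (h : v ≠ 0) : C.StT v .nf := ⟨trivial, h⟩

/-- The entry conditions on the plane `u c = v`. -/
def PlaneIn (C : Ctx) (H : Pt 3 → Atom → Prop) (x : Pt 3) (c : Fin 3) (v : ℤ) : Prop :=
  ∀ u, C.InBox u → u c = v →
    (∀ a q, a ≠ c → C.StT (u a) q → H (C.mc x u) (.pl a q)) ∧
    (∀ a b s, a ≠ b → a ≠ c → b ≠ c → C.BiT (u a) (u b) s → H (C.mc x u) (.bi a b s)) ∧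
    (∀ a, a ≠ c → u a = v → H (C.mc x u) (.bi a c .eq))

lemma Closed.plane (h : C.Closed A B F H) {x : Pt 3} {c : Fin 3} {v : ℤ}
    (hin : PlaneIn C H x c v) : ∀ u, C.InBox u → u c = v → StatAt C H x u := by
  have fill : ∀ (b : Fin 3) (e : Atom), b ≠ c → e ≠ .rho →
      (∀ s, Rl e (.pl b (if s then .nl else .nf)) (some (b, s)) e) →
      ∀ u, C.InBox u → u c = v → H (C.mc x (Function.update u b v)) e → H (C.mc x u) e := by
    intro b e hb he hr u hu hc hH
    refine box_fill' (fun w => w c = v → H (C.mc x w) e) b ?_ ?_ hu v (hc ▸ (hu c).1)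
      (hc ▸ (hu c).2) rfl (fun _ => hH) hc
    · intro w hw hQ hwb hwc
      rw [stp_ne' _ hb.symm] at hwc
      exact h.move (hr true) he (hQ hwc) ((hin w hw hwc).1 b _ hb (stT_nl hwb))
    · intro w hw hQ hwb hwc
      rw [stp_ne' _ hb.symm] at hwc
      exact h.move (hr false) he (hQ hwc) ((hin w hw hwc).1 b _ hb (stT_nf hwb))
  intro u hu hc
  have hv0 : 0 ≤ v := hc ▸ (hu c).1
  have hv1 : v < C.n := hc ▸ (hu c).2
  have hub : ∀ b : Fin 3, C.InBox (Function.update u b v) := fun b => inBox_update hu hv0 hv1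
  have hubc : ∀ b : Fin 3, b ≠ c → Function.update u b v c = v := fun b hb => by
    rw [Function.update_of_ne hb.symm, hc]
  constructor
  · intro a q hq
    by_cases hac : a = c
    · subst hac
      obtain ⟨b, hb, -⟩ := third a a
      apply fill b _ hb (by simp) ?_ u hu hc
      · obtain ⟨h1, -, h3⟩ := hin _ (hub b) (hubc b hb)
        refine h.stay (Rl.plEq b a q) (by simp) (h1 b q hb ?_) (h3 b hb (by simp))
        simpa [hc] using hq
      · intro s
        cases s
        · exact Rl.plDn a b q hb
        · exact Rl.plUp a b q hb
    · exact (hin u hu hc).1 a q hac hq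
  · intro a b s hab hs
    have biFill : ∀ (a b k : Fin 3), k ≠ a → k ≠ b → ∀ s', Rl (.bi a b s)
        (.pl k (if s' then .nl else .nf)) (some (k, s')) (.bi a b s) := by
      intro a b k h1 h2 s'
      cases s'
      · exact Rl.biDn a b k s h1 h2
      · exact Rl.biUp a b k s h1 h2
    by_cases hbc : b = c
    · subst hbc
      obtain ⟨k, hka, hkb⟩ := third a b
      apply fill k _ hkb (by simp) (biFill a b k hka hkb) u hu hc
      obtain ⟨h1, h2, h3⟩ := hin _ (hub k) (hubc k hkb)
      refine h.stay (Rl.biR a k b s) (by simp) (h2 a k s hka.symm hab hkb ?_) (h3 k hkb (by simp))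
      simpa [Function.update_of_ne hka.symm, ← hc] using hs
    · by_cases hac : a = c
      · subst hac
        obtain ⟨k, hka, hkb⟩ := third a b
        apply fill k _ hka (by simp) (biFill a b k hka hkb) u hu hc
        obtain ⟨h1, h2, h3⟩ := hin _ (hub k) (hubc k hka)
        refine h.stay (Rl.biL k b a s) (by simp) (h2 k b s hkb hka hab.symm ?_)
          (h3 k hka (by simp))
        simpa [Function.update_of_ne hkb.symm, ← hc] using hs
      · exact (hin u hu hc).2.1 a b s hab hac hbc hs

lemma Closed.plane_up (h : C.Closed A B F H) {x : Pt 3} {c : Fin 3} {v : ℤ} (hv : v ≠ C.n - 1)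
    (hv0 : 0 ≤ v) (hst : ∀ u, C.InBox u → u c = v → StatAt C H x u) :
    PlaneIn C H x c (v + 1) := by
  intro u hu hc
  have hw : C.InBox (stp (c, false) u) := inBox_stp_dn hu (by omega)
  have hwc : stp (c, false) u c = v := by simp [stp, sg, hc]
  obtain ⟨s1, s2⟩ := hst _ hw hwc
  have hnl := s1 c .nl (stT_nl (by rw [hwc]; exact hv))
  have hup : stp (c, true) (stp (c, false) u) = u := stp_stp_opp (c, true) u
  refine ⟨?_, ?_, ?_⟩
  · intro a q ha hq
    have := h.move (Rl.plUp a c q ha.symm) (by simp)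
      (s1 a q (by rw [stp_ne' _ ha]; exact hq)) hnl
    rwa [hup] at this
  · intro a b s hab ha hb hs
    have := h.move (Rl.biUp a b c s ha.symm hb.symm) (by simp)
      (s2 a b s hab (by rw [stp_ne' _ ha, stp_ne' _ hb]; exact hs)) hnl
    rwa [hup] at this
  · intro a ha hav
    have h1 := s2 a c .suc ha (by rw [stp_ne' _ ha, hwc]; exact hav)
    have := h.move (Rl.sucUp a c ha) (by simp) h1 h1
    rwa [hup] at this

lemma Closed.plane_dn (h : C.Closed A B F H) {x : Pt 3} {c : Fin 3} {v : ℤ} (hv : v ≠ 0)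
    (hv1 : v < C.n) (hst : ∀ u, C.InBox u → u c = v → StatAt C H x u) :
    PlaneIn C H x c (v - 1) := by
  intro u hu hc
  have hw : C.InBox (stp (c, true) u) := inBox_stp_up hu (by omega)
  have hwc : stp (c, true) u c = v := by simp [stp, sg, hc]
  obtain ⟨s1, s2⟩ := hst _ hw hwc
  have hnl := s1 c .nf (stT_nf (by rw [hwc]; exact hv))
  have hup : stp (c, false) (stp (c, true) u) = u := stp_stp_opp (c, false) u
  refine ⟨?_, ?_, ?_⟩
  · intro a q ha hq
    have := h.move (Rl.plDn a c q ha.symm) (by simp)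
      (s1 a q (by rw [stp_ne' _ ha]; exact hq)) hnl
    rwa [hup] at this
  · intro a b s hab ha hb hs
    have := h.move (Rl.biDn a b c s ha.symm hb.symm) (by simp)
      (s2 a b s hab (by rw [stp_ne' _ ha, stp_ne' _ hb]; exact hs)) hnl
    rwa [hup] at this
  · intro a ha hav
    have h1 := s2 c a .suc ha.symm (by rw [stp_ne' _ ha, hwc]; change v = u a + 1; omega)
    have := h.move (Rl.sucDn c a ha.symm) (by simp) h1 h1
    rw [hup] at this
    exact h.stay (Rl.eqSymm c a) (by simp) this this

/-- From one plane of static facts, all static facts of the block. -/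
lemma Closed.stat_of_plane (h : C.Closed A B F H) {x : Pt 3} {c : Fin 3} {v : ℤ}
    (hv0 : 0 ≤ v) (hv1 : v < C.n) (hin : PlaneIn C H x c v) : Stat C H x := by
  intro u hu
  have := box_fill (C := C)
    (fun w => ∀ u, C.InBox u → u c = w c → StatAt C H x u) c ?_ ?_
    (u := fun _ => v) (fun _ => ⟨hv0, hv1⟩) (h.plane hin) (hu c).1 (hu c).2
  · exact this u hu (by simp)
  · intro w hw hQ hwc
    have := h.plane (h.plane_up hwc (hw c).1 hQ)
    simpa [stp, sg] using this
  · intro w hw hQ hwc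
    have := h.plane (h.plane_dn hwc (hw c).2 hQ)
    simpa [stp, sg, sub_eq_add_neg] using this

/-- Spreading of a unary fact over the block. -/
lemma Closed.spread (h : C.Closed A B F H) {x : Pt 3} (hst : Stat C H x) {a : Fin 3} {q : PQ}
    {u : Pt 3} (hu : C.InBox u) (hq : H (C.mc x u) (.pl a q)) {a' : Fin 3} {w : Pt 3}
    (hw : C.InBox w) (e : w a' = u a) : H (C.mc x w) (.pl a' q) := by
  have same : ∀ (a : Fin 3) (u w : Pt 3), C.InBox u → C.InBox w → w a = u a →
      H (C.mc x u) (.pl a q) → H (C.mc x w) (.pl a q) := by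
    intro a u w hu hw he hq
    obtain ⟨b, hb, -⟩ := third a a
    obtain ⟨k, hka, hkb⟩ := third a b
    have one : ∀ b ≠ a, ∀ u, C.InBox u → H (C.mc x u) (.pl a q) → ∀ v, 0 ≤ v → v < C.n →
        H (C.mc x (Function.update u b v)) (.pl a q) := by
      intro b hb u hu hq v h0 h1
      refine box_fill (fun w => H (C.mc x w) (.pl a q)) b ?_ ?_ hu hq h0 h1
      · intro w hw hQ hwb
        exact h.move (Rl.plUp a b q hb) (by simp) hQ ((hst w hw).1 b _ (stT_nl hwb))
      · intro w hw hQ hwb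
        exact h.move (Rl.plDn a b q hb) (by simp) hQ ((hst w hw).1 b _ (stT_nf hwb))
    have h1 := one b hb u hu hq (w b) (hw b).1 (hw b).2
    have h2 := one k hka _ (inBox_update hu (hw b).1 (hw b).2) h1 (w k) (hw k).1 (hw k).2
    convert h2 using 2
    funext i
    rcases third_eq (a := a) (c := b) (b := k) (i := i) hb.symm hka hkb with rfl | rfl | rfl
    · rw [Function.update_of_ne hka.symm, Function.update_of_ne hb.symm, he]
    · simp
    · rw [Function.update_of_ne hkb.symm]; simp
  by_cases haa : a' = a
  · subst haa; exact same a' u w hu hw e hq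
  · have hu' : C.InBox (Function.update u a' (u a)) := inBox_update hu (hu a).1 (hu a).2
    have h1 := same a u _ hu hu' (by rw [Function.update_of_ne (Ne.symm haa)]) hq
    have h2 := (hst _ hu').2 a a' .eq (Ne.symm haa)
      (by change _ = _; rw [Function.update_of_ne (Ne.symm haa)]; simp)
    exact same a' _ w hu' hw (by simpa using e) (h.stay (Rl.plEq a a' q) (by simp) h1 h2)

lemma Closed.rs_fill (h : C.Closed A B F H) {x : Pt 3} (hst : Stat C H x)
    {u : Pt 3} (hu : C.InBox u) (hq : H (C.mc x u) .rs) {w : Pt 3}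
    (hw : C.InBox w) : H (C.mc x w) .rs := by
  have one : ∀ b, ∀ u, C.InBox u → H (C.mc x u) .rs → ∀ v, 0 ≤ v → v < C.n →
      H (C.mc x (Function.update u b v)) .rs := by
    intro b u hu hq v h0 h1
    refine box_fill (fun w => H (C.mc x w) .rs) b ?_ ?_ hu hq h0 h1
    · intro w hw hQ hwb
      exact h.move (Rl.rsUp b) (by simp) hQ ((hst w hw).1 b _ (stT_nl hwb))
    · intro w hw hQ hwb
      exact h.move (Rl.rsDn b) (by simp) hQ ((hst w hw).1 b _ (stT_nf hwb))
  have h0 := one 0 u hu hq (w 0) (hw 0).1 (hw 0).2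
  have i0 := inBox_update (a := 0) hu (hw 0).1 (hw 0).2
  have h1 := one 1 _ i0 h0 (w 1) (hw 1).1 (hw 1).2
  have i1 := inBox_update (a := 1) i0 (hw 1).1 (hw 1).2
  have h2 := one 2 _ i1 h1 (w 2) (hw 2).1 (hw 2).2
  convert h2 using 2
  funext i
  fin_cases i <;> simp

/-- Everything a resolved block offers to its neighbours. -/
structure Full (C : Ctx) (H : Pt 3 → Atom → Prop) (x : Pt 3) : Prop where
  stat : Stat C H x
  rs : ∀ u, C.InBox u → H (C.mc x u) .rs
  know : ∀ u, C.InBox u → ∀ t, C.top x = some t → ∀ a, u a = C.ix t →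
    H (C.mc x u) (.pl a (.know none))

lemma stT_any {A : Set (Pt 3)} {x : Pt 3} {v : ℤ} {q : PQ} (h : C.StT v q) : C.PlT A x v q := by
  obtain ⟨h1, h2⟩ := h
  cases q <;> first | exact h2 | exact h1.elim

lemma Closed.full_seed (h : C.Closed A B F H) {x : Pt 3} (hx : x ∈ dom C.T.seed) : Full C H x := by
  have key : ∀ u, C.InBox u → ∀ e, e ≠ .rho → C.TrL (dom C.T.seed) ∅ x u e → H (C.mc x u) e := by
    intro u hu e he ht
    exact h.boot (by rwa [blk_mk hu]) ((tr_mk hu e).2 ⟨Or.inl hx, ht⟩) he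
  refine ⟨?_, ?_, ?_⟩
  · intro u hu
    exact ⟨fun a q hq => key u hu _ (by simp) (stT_any hq),
      fun a b s _ hs => key u hu _ (by simp) hs⟩
  · intro u hu; exact key u hu _ (by simp) hx
  · intro u hu t ht a ha
    exact key u hu _ (by simp) ⟨hx, t, ht, ha⟩

/-- The `op` signal on the face of a full block. -/
lemma Closed.op_face (h : C.Closed A B F H) {y : Pt 3} (hf : Full C H y) {d : Dir} {u : Pt 3}
    (hu : C.InBox u) (hd : u d.1 = if d.2 then C.n - 1 else 0) : H (C.mc y u) (.op d) := by
  rcases d with ⟨c, b⟩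
  cases b
  · exact h.stay (Rl.opDn c) (by simp) (hf.rs u hu) ((hf.stat u hu).1 c .fst ⟨trivial, by simpa [PlT] using hd⟩)
  · exact h.stay (Rl.opUp c) (by simp) (hf.rs u hu) ((hf.stat u hu).1 c .lst ⟨trivial, by simpa [PlT] using hd⟩)

/-- crossing a face: cell `u` of `stp d y` on the entry face. -/
lemma Closed.cross (h : C.Closed A B F H) {y : Pt 3} (hf : Full C H y) {d : Dir} {u : Pt 3}
    (hu : C.InBox u) (hd : u d.1 = if d.2 then 0 else C.n - 1) :
    ∃ w, C.InBox w ∧ (∀ i, i ≠ d.1 → w i = u i) ∧ H (C.mc y w) (.op d) ∧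
      (∀ a e, Rl (.op d) a (some d) e → e ≠ .rho → H (C.mc y w) a → H (C.mc (stp d y) u) e) := by
  have hn := C.n_pos
  set w := Function.update u d.1 (if d.2 then C.n - 1 else 0) with hw
  have hwB : C.InBox w := by
    apply inBox_update hu <;> split_ifs <;> omega
  have hop := h.op_face (d := d) hf hwB (by simp [hw])
  refine ⟨w, hwB, fun i hi => by simp [hw, hi], hop, ?_⟩
  intro a e hr he ha
  have := h.rule hr he hop ha
  change H (stp d (C.mc y w)) e at this
  rw [stp_mk_cross] at this
  convert this using 2
  funext i
  by_cases hi : i = d.1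
  · subst hi
    simp only [Function.update_self, hw, hd]
    unfold sg
    cases d.2 <;> simp <;> ring
  · simp [hi, hw]

lemma Closed.stat_of_nbr (h : C.Closed A B F H) {y : Pt 3} (hf : Full C H y) (d : Dir) :
    Stat C H (stp d y) := by
  have hn := C.n_pos
  have hv0 : 0 ≤ (if d.2 then 0 else C.n - 1) := by split_ifs <;> omega
  have hv1 : (if d.2 then 0 else C.n - 1) < C.n := by split_ifs <;> omega
  refine h.stat_of_plane (c := d.1) hv0 hv1 ?_
  intro u hu hc
  obtain ⟨w, hw, hwu, hop, hcr⟩ := h.cross hf hu hc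
  have hpl : ∀ a q, a ≠ d.1 → C.StT (u a) q → H (C.mc (stp d y) u) (.pl a q) := by
    intro a q ha hq
    exact hcr _ _ (Rl.opPl d a q ha hq.1) (by simp) ((hf.stat w hw).1 a q (by rwa [hwu a ha]))
  refine ⟨hpl, ?_, ?_⟩
  · intro a b s hab ha hb hs
    exact hcr _ _ (Rl.opBi d a b s ha hb) (by simp)
      ((hf.stat w hw).2 a b s hab (by rwa [hwu a ha, hwu b hb]))
  · intro a ha hua
    rcases d with ⟨c, b⟩
    cases b
    · exact h.stay (Rl.eqLst a c) (by simp) (hpl a .lst ha ⟨trivial, by simpa [PlT] using hua⟩)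
        (hcr _ _ (Rl.opLst c) (by simp) hop)
    · exact h.stay (Rl.eqFst a c) (by simp) (hpl a .fst ha ⟨trivial, by simpa [PlT] using hua⟩)
        (hcr _ _ (Rl.opFst c) (by simp) hop)

/-- Knowledge of a full neighbour's tile. -/
lemma Closed.know_nbr (h : C.Closed A B F H) {x : Pt 3} {d : Dir} (hf : Full C H (stp d x))
    (hst : Stat C H x) {t : TileType 3} (ht : C.top (stp d x) = some t) {w : Pt 3}
    (hw : C.InBox w) (h1 : w 1 = C.ix t) : H (C.mc x w) (.pl 1 (.know (some d))) := by
  have hn := C.n_pos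
  obtain ⟨a, ha, -⟩ := third d.1 d.1
  have i0 := ix_nonneg (C := C) t
  have i1 := ix_lt (top_mem ht)
  let u : Pt 3 := Function.update (fun _ => C.ix t) d.1 (if (opp d).2 then 0 else C.n - 1)
  have hu : C.InBox u := by
    apply inBox_update (fun _ => ⟨i0, i1⟩) <;> split_ifs <;> omega
  have hua : u a = C.ix t := by simp [u, ha]
  obtain ⟨w', hw', hwu, hop, hcr⟩ := h.cross (d := opp d) hf hu (by simp [u, opp])
  have h2 := hcr _ _ (Rl.opKnow (opp d) a ha) (by simp)
    (hf.know w' hw' t ht a (by rw [hwu a ha, hua]))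
  rw [stp_opp_stp, opp_opp] at h2
  exact h.spread hst hu h2 hw (by rw [h1, hua])

/-- the key step: an attachable block gets resolved. -/
lemma Closed.resolve (h : C.Closed A B F H) {x : Pt 3} (hxB : x ∈ B) (hxs : x ∉ dom C.T.seed)
    {t : TileType 3} (htop : C.top x = some t) (D : Finset Dir)
    (hD : ∀ d ∈ D, Full C H (stp d x)) (hDA : ∀ d ∈ D, stp d x ∈ B)
    (hw : C.T.temp ≤ ∑ d ∈ D, nb (C.rst B) t x d) : x ∈ A ∧ Full C H x := by
  have hn := C.n_pos
  have htm := top_mem htop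
  have i0 := ix_nonneg (C := C) t
  have i1 := ix_lt htm
  have hpos := C.T.temp_pos
  -- statics
  have hst : Stat C H x := by
    have : D.Nonempty := by
      rw [Finset.nonempty_iff_ne_empty]
      rintro rfl
      simp at hw; omega
    obtain ⟨d, hd⟩ := this
    have := h.stat_of_nbr (hD d hd) (opp d)
    simpa using this
  -- the effective set of directions
  set E := D.filter (fun d => nb (C.rst B) t x d ≠ 0) with hE
  have hEs : C.T.temp ≤ ∑ d ∈ E, nb (C.rst B) t x d := by
    rw [hE, Finset.sum_filter_ne_zero]; exact hw
  have hEnb : ∀ d ∈ E, ∃ t', C.top (stp d x) = some t' ∧ face t d = face t' (opp d) ∧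
      0 < (face t d).2 ∧ nb (C.rst B) t x d = (face t d).2 := by
    intro d hd
    obtain ⟨hd1, hd2⟩ := Finset.mem_filter.1 hd
    unfold nb at hd2 ⊢
    rw [rst, if_pos (hDA d hd1)] at hd2 ⊢
    cases e : C.top (stp d x) with
    | none => rw [e] at hd2; simp at hd2
    | some t' =>
      rw [e] at hd2
      simp only [bondD] at hd2 ⊢
      split_ifs at hd2 ⊢ with hc
      · exact ⟨t', rfl, hc.1, hc.2, rfl⟩
      · exact absurd rfl hd2
  have hsuf : C.SufT E (C.ix t) := by
    refine ⟨t, isIx_ix htm, hEs.trans (le_of_eq (Finset.sum_congr rfl ?_))⟩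
    intro d hd
    obtain ⟨_, _, _, _, h4⟩ := hEnb d hd
    exact h4
  let L : ℤ → Pt 3 := fun i => ![i, 0, 0]
  have hL : ∀ i, 0 ≤ i → i < C.n → C.InBox (L i) := fun i a b => line_inBox a b
  have hacc1 : ∀ d ∈ E, H (C.mc x (L (C.ix t))) (.pl 0 (.acc {d})) := by
    intro d hd
    obtain ⟨t', h1, h2, h3, _⟩ := hEnb d hd
    let w : Pt 3 := ![C.ix t, C.ix t', 0]
    have hwB : C.InBox w := by
      have := ix_nonneg (C := C) t'
      have := ix_lt (top_mem h1)
      intro i; fin_cases i <;> simp [w] <;> omega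
    have hk := h.know_nbr (hD d (Finset.mem_filter.1 hd).1) hst h1 hwB (by simp [w])
    have hm := (hst w hwB).2 0 1 (.M d) (by decide)
      ⟨t, t', isIx_ix htm, isIx_ix (top_mem h1), h2, h3⟩
    exact h.spread hst hwB (h.stay (Rl.accI d) (by simp) hk hm) (hL _ i0 i1) (by simp [w, L])
  have hacc : ∀ D' : Finset Dir, D'.Nonempty → D' ⊆ E →
      H (C.mc x (L (C.ix t))) (.pl 0 (.acc D')) := by
    intro D' hne
    induction hne using Finset.Nonempty.cons_induction with
    | singleton d => intro hs; exact hacc1 d (hs (by simp))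
    | cons d s hds hs ih =>
      intro hsub
      have h1 := hacc1 d (hsub (by simp))
      have h2 := ih (fun e he => hsub (by simp [he]))
      have := h.stay (Rl.accU {d} s) (by simp) h1 h2
      rwa [← Finset.insert_eq, ← Finset.cons_eq_insert _ _ hds] at this
  have hEne : E.Nonempty := by
    rw [Finset.nonempty_iff_ne_empty]
    intro he
    rw [he] at hEs
    simp at hEs; omega
  have hfi := h.stay (Rl.accF E) (by simp) (hacc E hEne (Finset.Subset.refl _))
    ((hst _ (hL _ i0 i1)).1 0 (.suf E) ⟨trivial, by simpa [L, PlT] using hsuf⟩)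
  have hln : ∀ i, 0 ≤ i → i < C.n → H (C.mc x (L i)) .ln := by
    intro i a b
    exact h.stay Rl.lnI (by simp) ((hst _ (hL i a b)).1 1 .fst ⟨trivial, by simp [L, PlT]⟩)
      ((hst _ (hL i a b)).1 2 .fst ⟨trivial, by simp [L, PlT]⟩)
  have hfw := h.stay Rl.fwI (by simp) hfi (hln _ i0 i1)
  have hF0 := h.lockF (Or.inl hfw)
  have hblk : ∀ i, 0 ≤ i → i < C.n → C.blk (C.mc x (L i)) = x := fun i a b => blk_mk (hL i a b)
  have how := h.lockW (t := t) hF0 (by rwa [hblk _ i0 i1]) (by rwa [hblk _ i0 i1])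
    (by rw [loc_mk (hL _ i0 i1)]; simp [L])
  have hcl0 := h.stay Rl.clI (by simp) how how
  have hLu : ∀ i j, Function.update (L i) 0 j = L j := by
    intro i j; funext k; fin_cases k <;> simp [L]
  have hcl : ∀ i, 0 ≤ i → i < C.n → H (C.mc x (L i)) .cl := by
    intro i a b
    have := box_fill (C := C) (fun w => H (C.mc x w) .cl) 0 ?_ ?_ (hL _ i0 i1) hcl0 a b
    · rwa [hLu] at this
    · intro w hw hQ hwb
      exact h.move Rl.clUp (by simp) hQ ((hst w hw).1 0 _ (stT_nl hwb))
    · intro w hw hQ hwb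
      exact h.move Rl.clDn (by simp) hQ ((hst w hw).1 0 _ (stT_nf hwb))
  have hoF : ∀ i, 0 ≤ i → i < C.n → H (C.mc x (L i)) .oF := by
    intro i a b
    exact h.lockO (h.lockF (Or.inr (hcl i a b))) (by rwa [hblk i a b])
  have hLs : ∀ i, stp (0, true) (L i) = L (i + 1) := by
    intro i; funext k; fin_cases k <;> simp [L, stp, sg]
  have hdn : ∀ k : ℕ, (k : ℤ) < C.n → H (C.mc x (L k)) .dn := by
    intro k
    induction k with
    | zero =>
      intro _
      exact h.stay Rl.dnI (by simp) (hoF 0 le_rfl hn)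
        ((hst _ (hL 0 le_rfl hn)).1 0 .fst ⟨trivial, by simp [L, PlT]⟩)
    | succ k ih =>
      intro hk
      push_cast at hk ⊢
      have hkB := hL k (by omega) (by omega)
      have h1 := h.move Rl.dpI (by simp) (ih (by omega))
        ((hst _ hkB).1 0 .nl (stT_nl (by simp [L]; omega)))
      rw [hLs] at h1
      exact h.stay Rl.dnS (by simp) h1 (hoF _ (by omega) hk)
  have hlast : H (C.mc x (L (C.n - 1))) .rz := by
    have h1 := hdn (C.n - 1).toNat (by omega)
    rw [show (((C.n - 1).toNat : ℕ) : ℤ) = C.n - 1 by omega] at h1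
    exact h.stay Rl.rzI (by simp) h1
      ((hst _ (hL _ (by omega) (by omega))).1 0 .lst ⟨trivial, by simp [L, PlT]⟩)
  have hxA : x ∈ A := h.res hlast hxB
  have hrho := h.rho hxA hxs
  have hrs0 := h.stay Rl.rsI (by simp) hrho hrho
  have hrs : ∀ u, C.InBox u → H (C.mc x u) .rs := fun u hu =>
    h.rs_fill hst (hL (C.n - 1) (by omega) (by omega)) hrs0 hu
  refine ⟨hxA, hst, hrs, ?_⟩
  intro u hu t' ht' a hua
  rw [htop] at ht'
  cases ht'
  exact h.spread hst (hL _ i0 i1) (h.stay Rl.knI (by simp) how (hrs _ (hL _ i0 i1))) hu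
    (by rw [hua]; simp [L])

theorem Closed.complete (h : C.Closed A B F H) (hB : C.PA B) (hsA : dom C.T.seed ⊆ A) :
    B ⊆ A := by
  have key : ∀ x, Reach C.T.temp C.T.seed (C.rst B) x → x ∈ B → x ∈ A ∧ Full C H x := by
    intro x hx
    induction hx with
    | base x hx => exact fun _ => ⟨hsA hx, h.full_seed hx⟩
    | step x t S hxt hS hw ih =>
      intro hxB
      by_cases hxs : x ∈ dom C.T.seed
      · exact ⟨hsA hxs, h.full_seed hxs⟩
      · have htop : C.top x = some t := by
          unfold rst at hxt; rwa [if_pos hxB] at hxt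
        refine h.resolve hxB hxs htop (S.filter fun d => stp d x ∈ B) ?_ ?_ ?_
        · intro d hd
          obtain ⟨h1, h2⟩ := Finset.mem_filter.1 hd
          exact (ih d h1 h2).2
        · intro d hd
          exact (Finset.mem_filter.1 hd).2
        · rw [Finset.sum_filter_of_ne]
          · exact hw
          · intro d _ hd
            by_contra hc
            apply hd
            simp [nb, rst, hc]
  intro x hx
  exact (key x (hB.2.reach x (by rw [dom_rst hB.1]; exact hx)) hx).1

end closed
end Ctx
end IU

namespace IU

/-! ## Part E: layout of a big cell -/

section index
variable {α : Type} [Fintype α] [Nonempty α]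

/-- Integer index of an element of a finite type. -/
def ixo (a : α) : ℤ := ((Fintype.equivFin α a : Fin _) : ℕ)

def nth (α : Type) [Fintype α] [Nonempty α] (k : ℤ) : α :=
  if h : 0 ≤ k ∧ k < Fintype.card α then
    (Fintype.equivFin α).symm ⟨k.toNat, by omega⟩ else Classical.arbitrary α

lemma ixo_nonneg (a : α) : 0 ≤ ixo a := by unfold ixo; omega
lemma ixo_lt (a : α) : ixo a < Fintype.card α := by
  unfold ixo; exact_mod_cast (Fintype.equivFin α a).2

lemma nth_ixo (a : α) : nth α (ixo a) = a := by
  unfold nth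
  rw [dif_pos ⟨ixo_nonneg a, ixo_lt a⟩, Equiv.symm_apply_eq]
  apply Fin.ext
  simp [ixo]

lemma ixo_nth {k : ℤ} (h0 : 0 ≤ k) (h1 : k < Fintype.card α) : ixo (nth α k) = k := by
  unfold nth ixo
  rw [dif_pos ⟨h0, h1⟩]
  simp [h0]

end index

/-- Wires: one for every direction and atom. -/
abbrev Wire : Type := Dir × Atom

/-- Nets of a big cell. -/
inductive Net where
  | sa (e : Atom) | wA (w : Wire) | wB (w : Wire) | boot (e : Atom)
  deriving DecidableEq, Fintype

def snd (d : Dir) (e : Atom) : Net := if d.2 then .wA (d, e) else .wB (d, e)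
def rcv (d : Dir) (e : Atom) : Net := if d.2 then .wB (d, e) else .wA (d, e)

inductive GateOk : Net → Net → Net → Prop
  | stay {a b e : Atom} : Rl a b none e → GateOk (.sa a) (.sa b) (.sa e)
  | send {a b e : Atom} {d : Dir} : Rl a b (some d) e → GateOk (.sa a) (.sa b) (snd d e)
  | recv (d : Dir) (e : Atom) : e ≠ .rho → e ≠ .oF → GateOk (rcv d e) (rcv d e) (.sa e)
  | boot (e : Atom) : e ≠ .rho → e ≠ .oF → GateOk (.boot e) (.boot e) (.sa e)

/-- Gates. -/
abbrev Gate : Type := {g : Net × Net × Net // GateOk g.1 g.2.1 g.2.2}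

/-- Stations: the lock (`none`) or a gate. -/
abbrev Stn : Type := Option Gate

def sL : Stn → Net
  | none => .sa .fw
  | some g => g.1.1
def sR : Stn → Net
  | none => .sa .cl
  | some g => g.1.2.1
def sC : Stn → Net
  | none => .sa .ow
  | some g => g.1.2.2

lemma rl_ne_oF {a b e : Atom} {o : Option Dir} (h : Rl a b o e) : e ≠ .oF := by
  cases h <;> simp

lemma sC_ne (s : Stn) : sC s ≠ .sa .oF ∧ ∀ e, sC s ≠ .boot e := by
  rcases s with _ | ⟨⟨L, R, Cn⟩, h⟩
  · simp [sC]
  · change Cn ≠ _ ∧ ∀ e, Cn ≠ _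
    change GateOk L R Cn at h
    cases h with
    | stay h => exact ⟨by have := rl_ne_oF h; simpa using this, by simp⟩
    | send h => unfold snd; split_ifs <;> simp
    | recv d e h1 h2 => exact ⟨by simpa using h2, by simp⟩
    | boot e h1 h2 => exact ⟨by simpa using h2, by simp⟩

instance : Nonempty Atom := ⟨.rs⟩

/-- Cardinality as an integer (sealed, so that it is never evaluated). -/
def scard (α : Type) [Fintype α] : ℤ :=
  Classical.choose (⟨_, rfl⟩ : ∃ j : ℤ, j = Fintype.card α)
lemma scard_eq (α : Type) [Fintype α] : scard α = Fintype.card α :=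
  Classical.choose_spec (⟨_, rfl⟩ : ∃ j : ℤ, j = Fintype.card α)

def J : ℤ := scard Wire
def Na : ℤ := scard Atom
def Sn : ℤ := scard Stn
/-- Height of the gate row. -/
def K : ℤ := 2 * J + Na - 1
/-- Side of a big cell. -/
def mside : ℤ := J + 4 * Sn + K + 20

def aswap : Equiv.Perm Atom := Equiv.swap .oF (nth Atom (Na - 1))
def ai (e : Atom) : ℤ := ixo (aswap e)
def nthA (k : ℤ) : Atom := aswap (nth Atom k)
def nthW (k : ℤ) : Wire := nth Wire k
def nthS (k : ℤ) : Stn := nth Stn k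
def wi (w : Wire) : ℤ := ixo w
def si (s : Stn) : ℤ := ixo s

lemma ai_nonneg (e : Atom) : 0 ≤ ai e := ixo_nonneg _
lemma ai_lt (e : Atom) : ai e < Na := (ixo_lt _).trans_eq (scard_eq _).symm
lemma wi_nonneg (e : Wire) : 0 ≤ wi e := ixo_nonneg _
lemma wi_lt (e : Wire) : wi e < J := (ixo_lt _).trans_eq (scard_eq _).symm
lemma si_nonneg (e : Stn) : 0 ≤ si e := ixo_nonneg _
lemma si_lt (e : Stn) : si e < Sn := (ixo_lt _).trans_eq (scard_eq _).symm
lemma aswap_aswap (e : Atom) : aswap (aswap e) = e := by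
  unfold aswap; exact Equiv.swap_apply_self _ _ _
lemma nthA_ai (e : Atom) : nthA (ai e) = e := by
  unfold nthA ai; rw [nth_ixo, aswap_aswap]
lemma ai_nthA {k : ℤ} (h0 : 0 ≤ k) (h1 : k < Na) : ai (nthA k) = k := by
  unfold nthA ai; rw [aswap_aswap, ixo_nth h0 (h1.trans_eq (scard_eq _))]
lemma nthW_wi (w : Wire) : nthW (wi w) = w := nth_ixo w
lemma wi_nthW {k : ℤ} (h0 : 0 ≤ k) (h1 : k < J) : wi (nthW k) = k := ixo_nth h0 (h1.trans_eq (scard_eq _))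
lemma nthS_si (s : Stn) : nthS (si s) = s := nth_ixo s
lemma si_nthS {k : ℤ} (h0 : 0 ≤ k) (h1 : k < Sn) : si (nthS k) = k := ixo_nth h0 (h1.trans_eq (scard_eq _))
lemma Na_pos : 0 < Na := lt_of_le_of_lt (ai_nonneg .rs) (ai_lt .rs)
lemma Sn_pos : 0 < Sn := lt_of_le_of_lt (si_nonneg none) (si_lt none)
lemma J_pos : 0 < J := lt_of_le_of_lt (wi_nonneg ((0, true), .rs)) (wi_lt _)
lemma ai_oF : ai .oF = Na - 1 := by
  have h := Na_pos
  unfold ai aswap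
  rw [Equiv.swap_apply_left, ixo_nth (by omega) (by rw [← scard_eq]; change Na - 1 < Na; omega)]
lemma ai_inj {e e' : Atom} (h : ai e = ai e') : e = e' := by
  rw [← nthA_ai e, h, nthA_ai]

lemma K_pos : 0 < K := by have := J_pos; have := Na_pos; unfold K; omega
lemma mside_pos : 0 < mside := by
  have := J_pos; have := Sn_pos; have := K_pos; unfold mside; omega

def rowN : Net → ℤ
  | .sa e => 2 * J + ai e
  | .wA w => 2 * wi w + 1
  | .wB w => 2 * wi w
  | .boot _ => K

lemma rowN_nonneg (k : Net) : 0 ≤ rowN k := by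
  have := K_pos; have := J_pos
  cases k with
  | sa e => have := ai_nonneg e; simp only [rowN]; omega
  | wA e => have := wi_nonneg e; simp only [rowN]; omega
  | wB e => have := wi_nonneg e; simp only [rowN]; omega
  | boot e => simp only [rowN]; omega

lemma rowN_le (k : Net) : rowN k ≤ K := by
  have := Na_pos
  cases k with
  | sa e => have := ai_lt e; simp only [rowN, K]; omega
  | wA e => have := wi_lt e; simp only [rowN, K]; omega
  | wB e => have := wi_lt e; simp only [rowN, K]; omega
  | boot e => simp only [rowN]; omega

lemma rowN_sC (s : Stn) : rowN (sC s) < K := by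
  obtain ⟨h1, h2⟩ := sC_ne s
  have := Na_pos
  cases h : sC s with
  | sa e =>
    have h3 := ai_lt e
    have h4 : ai e ≠ Na - 1 := by
      rw [← ai_oF]; intro h'
      exact h1 (by rw [h, ai_inj h'])
    simp only [rowN, K]; omega
  | wA e => have := wi_lt e; simp only [rowN, K]; omega
  | wB e => have := wi_lt e; simp only [rowN, K]; omega
  | boot e => exact absurd h (h2 e)

inductive Own where
  | no | net (k : Net) | st (s : Stn)
  deriving DecidableEq

/-- The trunk layer. -/
def trunk (x y : ℤ) : Own :=
  if 0 ≤ y ∧ y < 2 * J then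
    (if y % 2 = 0 ∨ (x = 0 ∧ (nthW (y / 2)).1.1 = 0) then .net (.wB (nthW (y / 2)))
     else .net (.wA (nthW (y / 2))))
  else if 2 * J ≤ y ∧ y ≤ K then .net (.sa (nthA (y - 2 * J))) else .no

/-- Wire slots. -/
def wslot (k y z : ℤ) : Own :=
  if (nthW k).1.1 = 1 ∧ z = 1 then
    (if y ≤ 2 * k then .net (.wB (nthW k)) else .net (.wA (nthW k)))
  else if (nthW k).1.1 = 2 ∧ (y = 2 * k ∨ (y = 2 * k + 1 ∧ z = 1)) then .net (.wA (nthW k))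
  else .no

/-- Stations. -/
def sslot (s : Stn) (r y : ℤ) : Own :=
  if r = 0 then (if rowN (sL s) ≤ y ∧ y ≤ K then .net (sL s) else .no)
  else if r = 2 then (if rowN (sR s) ≤ y ∧ y ≤ K then .net (sR s) else .no)
  else if r = 1 then
    (if y = K then .st s else if rowN (sC s) ≤ y ∧ y < K then .net (sC s) else .no)
  else .no

/-- The owner of a position of a big cell. -/
def own0 (u : Pt 3) : Own :=
  if u 2 = 0 then trunk (u 0) (u 1)
  else if 1 ≤ u 0 ∧ u 0 ≤ J then wslot (u 0 - 1) (u 1) (u 2)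
  else if J + 2 ≤ u 0 ∧ u 0 < J + 2 + 4 * Sn ∧ u 2 = 1 then
    sslot (nthS ((u 0 - J - 2) / 4)) ((u 0 - J - 2) % 4) (u 1)
  else .no

def spos (s : Stn) : Pt 3 := ![J + 3 + 4 * si s, K, 1]

def Box (u : Pt 3) : Prop := ∀ i, 0 ≤ u i ∧ u i < mside

lemma own0_stn {u : Pt 3} {s : Stn} {r : ℤ} (h0 : u 0 = J + 2 + 4 * si s + r) (hr : 0 ≤ r)
    (hr' : r < 4) (h2 : u 2 = 1) : own0 u = sslot s r (u 1) := by
  have h3 := si_nonneg s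
  have h4 := si_lt s
  unfold own0
  rw [if_neg (by omega), if_neg (by omega), if_pos ⟨by omega, by omega, h2⟩,
    show (u 0 - J - 2) / 4 = si s by omega, show (u 0 - J - 2) % 4 = r by omega, nthS_si]

lemma own0_spos (s : Stn) : own0 (spos s) = .st s := by
  rw [own0_stn (s := s) (r := 1) (by simp [spos]; ring) (by norm_num) (by norm_num) (by simp [spos])]
  simp [sslot, spos]

lemma own0_L (s : Stn) : own0 (stp (0, false) (spos s)) = .net (sL s) := by
  have := rowN_le (sL s)
  rw [own0_stn (s := s) (r := 0) (by simp [spos, stp_apply, sg]; ring) (by norm_num) (by norm_num)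
    (by simp [spos, stp_apply])]
  simp [sslot, spos, stp_apply, this]

lemma own0_R (s : Stn) : own0 (stp (0, true) (spos s)) = .net (sR s) := by
  have := rowN_le (sR s)
  rw [own0_stn (s := s) (r := 2) (by simp [spos, stp_apply, sg]; ring) (by norm_num) (by norm_num)
    (by simp [spos, stp_apply])]
  simp [sslot, spos, stp_apply, this]

lemma own0_C (s : Stn) : own0 (stp (1, false) (spos s)) = .net (sC s) := by
  have := rowN_sC s
  rw [own0_stn (s := s) (r := 1) (by simp [spos, stp_apply, sg]; ring) (by norm_num) (by norm_num)
    (by simp [spos, stp_apply])]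
  simp [sslot, spos, stp_apply, sg]
  omega

lemma own0_D (s : Stn) : own0 (stp (2, false) (spos s)) = .net (.sa .oF) := by
  have := K_pos; have := J_pos; have := Na_pos
  unfold own0
  rw [if_pos (by simp [spos, stp_apply, sg])]
  unfold trunk
  rw [if_neg (by simp [spos, stp_apply, K]; omega), if_pos (by simp [spos, stp_apply, K]; omega)]
  congr 2
  simp only [spos, stp_apply]
  rw [← nthA_ai .oF, ai_oF]
  congr 1
  simp [K]; ring

lemma spos_box (s : Stn) : Box (spos s) := by
  have := K_pos; have := J_pos; have := si_nonneg s; have := si_lt s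
  intro i; fin_cases i <;> simp [spos, mside] <;> omega

lemma spos_in (s : Stn) {d : Dir} (hd : d = (0, false) ∨ d = (0, true) ∨ d = (1, false) ∨
    d = (1, true) ∨ d = (2, false) ∨ d = (2, true)) : Box (stp d (spos s)) := by
  have := K_pos; have := J_pos; have := si_nonneg s; have := si_lt s
  have hm : mside = J + 4 * Sn + K + 20 := rfl
  rcases hd with rfl | rfl | rfl | rfl | rfl | rfl <;>
  · intro i; fin_cases i <;> simp [spos, stp_apply, sg] <;> omega

lemma sslot_st {s s' : Stn} {r y : ℤ} (h : sslot s r y = .st s') : s' = s ∧ r = 1 ∧ y = K := by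
  unfold sslot at h
  split_ifs at h <;> simp_all

lemma own0_st {u : Pt 3} {s : Stn} (h : own0 u = .st s) : u = spos s := by
  unfold own0 at h
  split_ifs at h with h1 h2 h3
  · unfold trunk at h; split_ifs at h
  · unfold wslot at h; split_ifs at h
  · obtain ⟨rfl, h5, h6⟩ := sslot_st h
    have h7 : si (nthS ((u 0 - J - 2) / 4)) = (u 0 - J - 2) / 4 := si_nthS (by omega) (by omega)
    funext i
    fin_cases i
    · simp [spos, h7]; omega
    · simp [spos, h6]
    · simp [spos, h3]

/-- No cell lies between two stations. -/
lemma no_between {u v : Pt 3} {s s' : Stn} (h : own0 u = .st s) (h' : own0 v = .st s')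
    (e : v 0 = u 0 + 2) : False := by
  rw [own0_st h, own0_st h'] at e
  simp [spos] at e
  omega

/-! Connectivity of the nets -/

def NStep (k : Net) (u v : Pt 3) : Prop :=
  (∃ d, v = stp d u) ∧ (Box u ∧ own0 u = .net k) ∧ (Box v ∧ own0 v = .net k)

lemma NStep.symm {k : Net} {u v : Pt 3} (h : NStep k u v) : NStep k v u := by
  obtain ⟨⟨d, rfl⟩, h1, h2⟩ := h
  exact ⟨⟨opp d, by simp⟩, h2, h1⟩

abbrev NConn (k : Net) := Relation.ReflTransGen (NStep k)

lemma NConn.symm {k : Net} {u v : Pt 3} (h : NConn k u v) : NConn k v u :=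
  by
  induction h with
  | refl => exact .refl
  | tail _ h ih => exact Relation.ReflTransGen.head h.symm ih

lemma nconn_seg {k : Net} {u : Pt 3} (i : Fin 3) {v : ℤ} (hv : u i ≤ v)
    (h : ∀ w, u i ≤ w → w ≤ v → Box (Function.update u i w) ∧ own0 (Function.update u i w) = .net k) :
    NConn k u (Function.update u i v) := by
  have key : ∀ m : ℕ, u i + m ≤ v → NConn k u (Function.update u i (u i + m)) := by
    intro m
    induction m with
    | zero => intro _; simp; exact Relation.ReflTransGen.refl
    | succ m ih =>
      intro hm
      push_cast at hm ⊢
      refine (ih (by omega)).tail ⟨⟨(i, true), ?_⟩, h _ (by omega) (by omega), h _ (by omega) (by omega)⟩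
      simp [stp, sg, add_assoc]
  have := key (v - u i).toNat (by omega)
  rwa [show u i + ((v - u i).toNat : ℤ) = v by omega] at this

/-- Root of a net. -/
def root (k : Net) : Pt 3 := ![mside - 1, rowN k, 0]

lemma trunk_row {k : Net} (hk : ∀ e, k ≠ .boot e) {x : ℤ} (hx : 0 < x) : trunk x (rowN k) = .net k := by
  have := J_pos; have := Na_pos
  cases k with
  | sa e =>
    have h1 := ai_nonneg e; have h2 := ai_lt e
    simp only [rowN]
    unfold trunk
    rw [if_neg (by omega), if_pos (by unfold K; omega), add_sub_cancel_left, nthA_ai]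
  | wA w =>
    have h1 := wi_nonneg w; have h2 := wi_lt w
    simp only [rowN]
    unfold trunk
    rw [if_pos (by omega), if_neg (by omega), show (2 * wi w + 1) / 2 = wi w by omega, nthW_wi]
  | wB w =>
    have h1 := wi_nonneg w; have h2 := wi_lt w
    simp only [rowN]
    unfold trunk
    rw [if_pos (by omega), if_pos (by omega), show (2 * wi w) / 2 = wi w by omega, nthW_wi]
  | boot e => exact absurd rfl (hk e)

lemma box_upd {u : Pt 3} (h : Box u) {i : Fin 3} {v : ℤ} (h0 : 0 ≤ v) (h1 : v < mside) :
    Box (Function.update u i v) := by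
  intro j
  by_cases hj : j = i
  · subst hj; simp [h0, h1]
  · simp [hj, h j]

lemma K_lt : K + 10 < mside := by
  have := J_pos; have := Sn_pos; unfold mside; omega

/-- A trunk cell is connected to the root. -/
lemma nconn_trunk {k : Net} (hk : ∀ e, k ≠ .boot e) {u : Pt 3} (hb : Box u) (h2 : u 2 = 0)
    (h1 : u 1 = rowN k) (ho : own0 u = .net k) : NConn k u (root k) := by
  have h0 := (hb 0)
  have := nconn_seg (k := k) (u := u) 0 (v := mside - 1) (by omega) (by
    intro w hw1 hw2
    refine ⟨box_upd hb (by omega) (by omega), ?_⟩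
    by_cases hw : w = u 0
    · rw [hw, Function.update_eq_self]; exact ho
    · unfold own0
      rw [if_pos (by simpa using h2)]
      simp only [Function.update_self]
      rw [show Function.update u 0 w 1 = rowN k by simpa using h1]
      exact trunk_row hk (by omega))
  convert this using 1
  funext i
  fin_cases i <;> simp [root, h1, h2]

/-- A tooth. -/
lemma nconn_tooth {k : Net} (hk : ∀ e, k ≠ .boot e) {u : Pt 3} (hb : Box u) (h0 : 0 < u 0) (h2 : u 2 = 1)
    (hy : rowN k ≤ u 1)
    (ho : ∀ w, rowN k ≤ w → w ≤ u 1 → own0 (Function.update u 1 w) = .net k) :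
    NConn k u (root k) := by
  have hr := rowN_nonneg k
  have h1 := hb 1
  have hm := mside_pos
  set v := Function.update u 1 (rowN k) with hv
  have hvb : Box v := box_upd hb (by omega) (by omega)
  have s1 : NConn k v u := by
    have := nconn_seg (k := k) (u := v) 1 (v := u 1) (by simp [hv, hy]) (by
      intro w hw1 hw2
      simp only [hv, Function.update_self, Function.update_idem] at hw1 ⊢
      exact ⟨box_upd hb (by omega) (by omega), ho w hw1 hw2⟩)
    simpa [hv] using this
  set v' := Function.update v 2 0 with hv'
  have hv'b : Box v' := box_upd hvb (by omega) (by omega)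
  have hv'o : own0 v' = .net k := by
    unfold own0
    rw [if_pos (by simp [hv'])]
    have e1 : v' 1 = rowN k := by simp [hv', hv]
    have e0 : v' 0 = u 0 := by simp [hv', hv]
    rw [e1, e0]
    exact trunk_row hk h0
  have s2 : NStep k v v' := by
    refine ⟨⟨(2, false), ?_⟩, ⟨hvb, ho _ le_rfl hy⟩, hv'b, hv'o⟩
    simp [stp, hv', sg, hv, h2]
  refine (NConn.symm s1).trans (Relation.ReflTransGen.head s2 ?_)
  exact nconn_trunk hk hv'b (by simp [hv']) (by simp [hv', hv]) hv'o

lemma sslot_net {s : Stn} {r y : ℤ} {k : Net} (h : sslot s r y = .net k) :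
    rowN k ≤ y ∧ y ≤ K ∧ ∀ w, rowN k ≤ w → w ≤ y → sslot s r w = .net k := by
  unfold sslot at h ⊢
  split_ifs at h with h1 h2 h3 h4 h5 h6 h7
  · cases h; refine ⟨h2.1, h2.2, fun w a b => ?_⟩
    rw [if_pos h1, if_pos ⟨a, by omega⟩]
  · cases h; refine ⟨h4.1, h4.2, fun w a b => ?_⟩
    rw [if_neg h1, if_pos h3, if_pos ⟨a, by omega⟩]
  · cases h; refine ⟨h7.1, by omega, fun w a b => ?_⟩
    rw [if_neg h1, if_neg h3, if_pos h5, if_neg (by omega), if_pos ⟨a, by omega⟩]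

lemma net_root {k : Net} (hk : ∀ e, k ≠ .boot e) {u : Pt 3} (hb : Box u) (h : own0 u = .net k) :
    NConn k u (root k) := by
  have hm := mside_pos
  have h' := h
  unfold own0 at h
  split_ifs at h with h1 h2 h3
  · unfold trunk at h
    split_ifs at h with h3 h4 h5
    · have hj : wi (nthW (u 1 / 2)) = u 1 / 2 := wi_nthW (by omega) (by omega)
      by_cases h5 : u 1 % 2 = 0
      · refine nconn_trunk hk hb h1 ?_ h'
        cases h; simp only [rowN]; rw [hj]; omega
      · have h6 := h4.resolve_left h5
        set v := Function.update u 1 (u 1 - 1) with hv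
        have hvb : Box v := box_upd hb (by omega) (by have := (hb 1).2; omega)
        have hvo : own0 v = .net k := by
          unfold own0
          rw [if_pos (by simpa [hv] using h1)]
          unfold trunk
          have e1 : v 1 = u 1 - 1 := by simp [hv]
          rw [e1, if_pos (by omega), if_pos (Or.inl (by omega)), ← h,
            show (u 1 - 1) / 2 = u 1 / 2 by omega]
        refine Relation.ReflTransGen.head ⟨⟨(1, false), ?_⟩, ⟨hb, h'⟩, hvb, hvo⟩ ?_
        · simp [stp, sg, hv]; rfl
        · refine nconn_trunk hk hvb (by simpa [hv] using h1) ?_ hvo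
          cases h; simp only [rowN]; rw [hj]; simp [hv]; omega
    · have hj : wi (nthW (u 1 / 2)) = u 1 / 2 := wi_nthW (by omega) (by omega)
      refine nconn_trunk hk hb h1 ?_ h'
      cases h; simp only [rowN]; rw [hj]; omega
    · have hj : ai (nthA (u 1 - 2 * J)) = u 1 - 2 * J := ai_nthA (by omega) (by unfold K at h5; omega)
      refine nconn_trunk hk hb h1 ?_ h'
      cases h; simp only [rowN]; rw [hj]; omega
  · have hj : wi (nthW (u 0 - 1)) = u 0 - 1 := wi_nthW (by omega) (by omega)
    have b1 := hb 1
    have b2 := hb 2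
    have b0 := hb 0
    have hK : K = 2 * J + Na - 1 := rfl
    have hNa := Na_pos
    have hKl := K_lt
    have slot : ∀ y z : ℤ, z ≠ 0 → own0 (Function.update (Function.update u 1 y) 2 z) =
        wslot (u 0 - 1) y z := by
      intro y z hz
      unfold own0
      rw [if_neg (by simpa using hz), if_pos (by simpa using h2)]
      simp
    have toTrunk : ∀ v : Pt 3, Box v → v 0 = u 0 → v 1 = rowN k → v 2 = 1 → own0 v = .net k →
        NConn k v (root k) := by
      intro v hvb e0 e1 e2 hvo
      refine nconn_tooth hk hvb (by omega) e2 e1.ge ?_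
      intro w hw1 hw2
      have : w = v 1 := by omega
      rw [this, Function.update_eq_self]; exact hvo
    unfold wslot at h
    split_ifs at h with h3 h4 h5
    · -- axis 1, lower part
      cases h
      have e1 : Function.update u 1 (2 * (u 0 - 1)) =
          Function.update (Function.update u 1 (2 * (u 0 - 1))) 2 1 := by
        funext i; fin_cases i <;> simp [h3.2]
      have hend : own0 (Function.update u 1 (2 * (u 0 - 1))) = .net (.wB (nthW (u 0 - 1))) := by
        rw [e1, slot _ _ one_ne_zero]; unfold wslot; rw [if_pos ⟨h3.1, rfl⟩, if_pos le_rfl]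
      have hbb : Box (Function.update u 1 (2 * (u 0 - 1))) := box_upd hb (by omega) (by omega)
      refine (nconn_seg (k := .wB (nthW (u 0 - 1))) (u := u) 1 (v := 2 * (u 0 - 1)) h4 ?_).trans ?_
      · intro w hw1 hw2
        refine ⟨box_upd hb (by omega) (by omega), ?_⟩
        have : Function.update u 1 w = Function.update (Function.update u 1 w) 2 1 := by
          funext i; fin_cases i <;> simp [h3.2]
        rw [this, slot _ _ one_ne_zero]; unfold wslot; rw [if_pos ⟨h3.1, rfl⟩, if_pos hw2]
      · exact toTrunk _ hbb (by simp) (by simp [rowN, hj]) (by simp [h3.2]) hend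
    · cases h
      refine nconn_tooth hk hb (by omega) h3.2 (by simp only [rowN]; omega) ?_
      intro w hw1 hw2
      simp only [rowN] at hw1
      have : Function.update u 1 w = Function.update (Function.update u 1 w) 2 1 := by
        funext i; fin_cases i <;> simp [h3.2]
      rw [this, slot _ _ one_ne_zero]; unfold wslot; rw [if_pos ⟨h3.1, rfl⟩, if_neg (by omega)]
    · cases h
      set k : Net := .wA (nthW (u 0 - 1)) with hkd
      have hne : ¬ ((nthW (u 0 - 1)).1.1 = 1) := by rw [h5.1]; decide
      have sA : own0 (Function.update (Function.update u 1 (2 * (u 0 - 1) + 1)) 2 1) = .net k := by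
        rw [slot _ _ one_ne_zero]; unfold wslot
        rw [if_neg (fun h => hne h.1), if_pos ⟨h5.1, Or.inr ⟨rfl, rfl⟩⟩]
      have sAb : Box (Function.update (Function.update u 1 (2 * (u 0 - 1) + 1)) 2 1) :=
        box_upd (box_upd hb (by omega) (by omega)) (by omega) (by omega)
      have cA := toTrunk _ sAb (by simp) (by simp [rowN, hj, hkd]) (by simp) sA
      rcases h5.2 with h6 | ⟨h6, h7⟩
      · have sB : ∀ z, z ≠ 0 → own0 (Function.update u 2 z) = .net k := by
          intro z hz
          have : Function.update u 2 z = Function.update (Function.update u 1 (u 1)) 2 z := by simp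
          rw [this, slot _ _ hz]; unfold wslot
          rw [if_neg (fun h => hne h.1), if_pos ⟨h5.1, Or.inl h6⟩]
        have hz1 : 1 ≤ u 2 := by omega
        have c1 : NConn k (Function.update u 2 1) u := by
          have := nconn_seg (k := k) (u := Function.update u 2 1) 2 (v := u 2) (by simpa using hz1) (by
            intro w hw1 hw2
            simp only [Function.update_self, Function.update_idem] at hw1 ⊢
            exact ⟨box_upd hb (by omega) (by omega), sB w (by omega)⟩)
          simpa using this
        refine (NConn.symm c1).trans (Relation.ReflTransGen.head ⟨⟨(1, true), ?_⟩,
          ⟨box_upd hb (by omega) (by omega), sB 1 one_ne_zero⟩, sAb, sA⟩ cA)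
        funext i
        fin_cases i <;> simp [stp_apply, sg, h6]
      · have : u = Function.update (Function.update u 1 (2 * (u 0 - 1) + 1)) 2 1 := by
          funext i; fin_cases i <;> simp [h6, h7]
        rw [this]; exact cA
  · obtain ⟨e1, e2, e3⟩ := sslot_net h
    refine nconn_tooth hk hb (by have := J_pos; omega) h3.2.2 e1 ?_
    intro w hw1 hw2
    unfold own0
    rw [if_neg (by simpa using h1), if_neg (by simpa using h2), if_pos (by simpa using h3)]
    simp only [Function.update_self]
    exact e3 w hw1 hw2

lemma net_conn {k : Net} (hk : ∀ e, k ≠ .boot e) {u v : Pt 3} (hb : Box u) (h : own0 u = .net k)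
    (hb' : Box v) (h' : own0 v = .net k) : NConn k u v :=
  (net_root hk hb h).trans (NConn.symm (net_root hk hb' h'))

/-- Crossing point of a wire. -/
lemma wire_cross (w : Wire) : ∃ u, Box u ∧ u w.1.1 = mside - 1 ∧ own0 u = .net (.wA w) ∧
    own0 (Function.update u w.1.1 0) = .net (.wB w) := by
  have h1 := wi_nonneg w; have h2 := wi_lt w
  have hm := mside_pos; have hK := K_lt; have hJ := J_pos; have hN := Na_pos; have hS := Sn_pos
  have hKd : K = 2 * J + Na - 1 := rfl
  have hmd : mside = J + 4 * Sn + K + 20 := rfl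
  have h012 : w.1.1 = 0 ∨ w.1.1 = 1 ∨ w.1.1 = 2 := by
    have : ∀ a : Fin 3, a = 0 ∨ a = 1 ∨ a = 2 := by decide
    exact this _
  rcases h012 with h | h | h
  · refine ⟨![mside - 1, 2 * wi w + 1, 0], ?_, by rw [h]; simp, ?_, ?_⟩
    · intro i; fin_cases i <;> simp <;> omega
    · unfold own0; rw [if_pos (by simp)]
      exact trunk_row (k := .wA w) (by simp) (by simp; omega)
    · rw [h]; unfold own0; rw [if_pos (by simp)]
      unfold trunk
      simp
      have e : (2 * wi w + 1) / 2 = wi w := by omega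
      rw [if_pos (by omega), e, nthW_wi, if_pos h]
  · refine ⟨![wi w + 1, mside - 1, 1], ?_, by rw [h]; simp, ?_, ?_⟩
    · intro i; fin_cases i <;> simp <;> omega
    · unfold own0; rw [if_neg (by simp), if_pos (by simp; omega)]
      unfold wslot
      simp [nthW_wi, h]
      omega
    · rw [h]; unfold own0; rw [if_neg (by simp), if_pos (by simp; omega)]
      unfold wslot
      simp [nthW_wi, h]
      omega
  · refine ⟨![wi w + 1, 2 * wi w, mside - 1], ?_, by rw [h]; simp, ?_, ?_⟩
    · intro i; fin_cases i <;> simp <;> omega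
    · unfold own0; rw [if_neg (by simp; omega), if_pos (by simp; omega)]
      unfold wslot
      simp [nthW_wi, h]
    · rw [h]; unfold own0; rw [if_pos (by simp)]
      exact trunk_row (k := .wB w) (by simp) (by simp; omega)

end IU

namespace IU

/-! ## Part F: tiles of the simulator -/

/-- Big cell of a position. -/
def mac (p : Pt 3) : Pt 3 := fun i => p i / mside
/-- Position inside the big cell. -/
def lo (p : Pt 3) : Pt 3 := fun i => p i % mside
def gp (P u : Pt 3) : Pt 3 := fun i => mside * P i + u i

lemma gp_mac_lo (p : Pt 3) : gp (mac p) (lo p) = p := by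
  funext i; change mside * (p i / mside) + p i % mside = p i; exact Int.mul_ediv_add_emod (p i) mside

lemma lo_box (p : Pt 3) : Box (lo p) :=
  fun i => ⟨Int.emod_nonneg _ mside_pos.ne', Int.emod_lt_of_pos _ mside_pos⟩

lemma mac_gp (P : Pt 3) {u : Pt 3} (h : Box u) : mac (gp P u) = P := by
  funext i; unfold mac gp
  rw [Int.mul_add_ediv_left _ _ mside_pos.ne', Int.ediv_eq_zero_of_lt (h i).1 (h i).2, add_zero]

lemma lo_gp (P : Pt 3) {u : Pt 3} (h : Box u) : lo (gp P u) = u := by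
  funext i; unfold lo gp
  rw [Int.mul_add_emod_self_left, Int.emod_eq_of_lt (h i).1 (h i).2]

lemma mac_of_box {u : Pt 3} (h : Box u) : mac u = 0 := by
  funext i; exact Int.ediv_eq_zero_of_lt (h i).1 (h i).2

lemma lo_of_box {u : Pt 3} (h : Box u) : lo u = u := by
  funext i; exact Int.emod_eq_of_lt (h i).1 (h i).2

lemma lo_lo (p : Pt 3) : lo (lo p) = lo p := lo_of_box (lo_box p)

lemma stp_gp (d : Dir) (P u : Pt 3) : stp d (gp P u) = gp P (stp d u) := by
  funext i; simp only [stp_apply, gp]; ring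

lemma lo_stp_lo (d : Dir) (p : Pt 3) : lo (stp d (lo p)) = lo (stp d p) := by
  funext i
  simp only [lo, stp_apply]
  rw [Int.emod_add_emod]

lemma mac_stp_lo (d : Dir) (p : Pt 3) (i : Fin 3) :
    mac (stp d p) i = mac p i + mac (stp d (lo p)) i := by
  conv_lhs => rw [← gp_mac_lo p, stp_gp]
  unfold mac gp
  rw [Int.mul_add_ediv_left _ _ mside_pos.ne']

/-- Whether the edge in direction `d` leaves the big cell. -/
def cr (p : Pt 3) (d : Dir) : Bool := decide (mac (stp d p) ≠ mac p)

lemma cr_lo (p : Pt 3) (d : Dir) : cr (lo p) d = cr p d := by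
  unfold cr
  congr 1
  rw [mac_of_box (lo_box p), eq_iff_iff, not_iff_not, funext_iff, funext_iff]
  refine forall_congr' fun i => ?_
  rw [mac_stp_lo d p i]
  constructor
  · intro h; rw [h]; simp
  · intro h; simpa using h

lemma cr_opp (p : Pt 3) (d : Dir) : cr (stp d p) (opp d) = cr p d := by
  unfold cr
  rw [stp_opp_stp]
  congr 1
  rw [eq_iff_iff]
  exact ne_comm

lemma cr_false {p : Pt 3} {d : Dir} (h : cr p d = false) :
    mac (stp d p) = mac p ∧ lo (stp d p) = stp d (lo p) := by
  have h1 : mac (stp d p) = mac p := by simpa [cr] using h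
  refine ⟨h1, ?_⟩
  have e1 := gp_mac_lo (stp d p)
  have e2 : stp d p = gp (mac p) (stp d (lo p)) := by rw [← stp_gp, gp_mac_lo]
  rw [h1] at e1
  funext i
  have h3 := congrFun (e1.trans e2) i
  change mside * mac p i + lo (stp d p) i = mside * mac p i + stp d (lo p) i at h3
  linarith

lemma cr_gp {P u : Pt 3} {d : Dir} (h : Box u) (h' : Box (stp d u)) : cr (gp P u) d = false := by
  unfold cr
  rw [stp_gp, mac_gp P h, mac_gp P h']
  simp

lemma cr_true {p : Pt 3} {d : Dir} (h : cr p d = true) :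
    mac (stp d p) = stp d (mac p) := by
  have h1 : mac (stp d p) ≠ mac p := by simpa [cr] using h
  have hm := mside_pos
  have hne : ∀ i, i ≠ d.1 → mac (stp d p) i = mac p i := fun i hi => by
    simp [mac, stp_apply, hi]
  have h2 : mac (stp d p) d.1 ≠ mac p d.1 := by
    intro h2; apply h1; funext i
    by_cases hi : i = d.1
    · subst hi; exact h2
    · exact hne i hi
  funext i
  by_cases hi : i = d.1
  · subst hi
    rw [stp_same]
    have hb := lo_box p d.1
    rw [mac_stp_lo] at h2 ⊢
    have h3 : mac (stp d (lo p)) d.1 ≠ 0 := by intro h; rw [h] at h2; simp at h2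
    congr 1
    have h4 : mac (stp d (lo p)) d.1 = (lo p d.1 + sg d) / mside := by simp [mac, stp_apply]
    rw [h4] at h3 ⊢
    rcases d with ⟨j, b⟩
    cases b
    · simp only [sg] at h3 ⊢
      simp only [Bool.false_eq_true, if_false] at h3 ⊢
      by_cases h0 : lo p j = 0
      · have hb2 := mside_pos
        simp only at hb
        rw [h0]
        have := K_lt; have := K_pos
        rw [Int.ediv_eq_iff_of_pos hm]
        constructor <;> nlinarith
      · exact absurd (Int.ediv_eq_zero_of_lt (by simp only at hb; omega)
          (by simp only at hb; omega)) h3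
    · simp only [sg] at h3 ⊢
      simp only [if_true] at h3 ⊢
      simp only at hb
      by_cases h0 : lo p j = mside - 1
      · rw [h0]; rw [show mside - 1 + 1 = mside by ring]; exact Int.ediv_self hm.ne'
      · exact absurd (Int.ediv_eq_zero_of_lt (by omega) (by omega)) h3
  · rw [hne i hi, stp_ne d _ hi]

def own (p : Pt 3) : Own := own0 (lo p)

lemma own_gp (P : Pt 3) {u : Pt 3} (h : Box u) : own (gp P u) = own0 u := by
  unfold own; rw [lo_gp P h]

/-- Edges carrying glue (crossing flag, direction, owners, strength). -/
inductive EC : Bool → Dir → Own → Own → ℕ → Prop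
  | net (d : Dir) (k : Net) : (∀ e, k ≠ .boot e) → EC false d (.net k) (.net k) 2
  | gL (g : Gate) : EC false (0, false) (.st (some g)) (.net (sL (some g))) 1
  | gL' (g : Gate) : EC false (0, true) (.net (sL (some g))) (.st (some g)) 1
  | gR (g : Gate) : EC false (0, true) (.st (some g)) (.net (sR (some g))) 1
  | gR' (g : Gate) : EC false (0, false) (.net (sR (some g))) (.st (some g)) 1
  | gC (g : Gate) : EC false (1, false) (.st (some g)) (.net (sC (some g))) 2
  | gC' (g : Gate) : EC false (1, true) (.net (sC (some g))) (.st (some g)) 2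
  | lF : EC false (0, false) (.st none) (.net (.sa .fw)) 2
  | lF' : EC false (0, true) (.net (.sa .fw)) (.st none) 2
  | lC : EC false (0, true) (.st none) (.net (.sa .cl)) 2
  | lC' : EC false (0, false) (.net (.sa .cl)) (.st none) 2
  | lW : EC false (1, false) (.st none) (.net (.sa .ow)) 2
  | lW' : EC false (1, true) (.net (.sa .ow)) (.st none) 2
  | lO : EC false (2, false) (.st none) (.net (.sa .oF)) 2
  | lO' : EC false (2, true) (.net (.sa .oF)) (.st none) 2
  | wU (w : Wire) : EC true (w.1.1, true) (.net (.wA w)) (.net (.wB w)) 2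
  | wD (w : Wire) : EC true (w.1.1, false) (.net (.wB w)) (.net (.wA w)) 2

lemma EC.symm {c : Bool} {d : Dir} {a b : Own} {w : ℕ} (h : EC c d a b w) : EC c (opp d) b a w := by
  cases h with
  | net d k h => exact .net _ k h
  | gL g => exact .gL' g
  | gL' g => exact .gL g
  | gR g => exact .gR' g
  | gR' g => exact .gR g
  | gC g => exact .gC' g
  | gC' g => exact .gC g
  | lF => exact .lF'
  | lF' => exact .lF
  | lC => exact .lC'
  | lC' => exact .lC
  | lW => exact .lW'
  | lW' => exact .lW
  | lO => exact .lO'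
  | lO' => exact .lO
  | wU w => exact .wD w
  | wD w => exact .wU w

lemma EC.symm_iff {c : Bool} {d : Dir} {a b : Own} {w : ℕ} : EC c (opp d) b a w ↔ EC c d a b w :=
  ⟨fun h => by have := h.symm; rwa [opp_opp] at this, EC.symm⟩

/-- Strength of the normal glue of an edge. -/
def Ew (p : Pt 3) (d : Dir) : ℕ :=
  if EC (cr p d) d (own p) (own (stp d p)) 2 then 2
  else if EC (cr p d) d (own p) (own (stp d p)) 1 then 1 else 0

lemma Ew_opp (p : Pt 3) (d : Dir) : Ew (stp d p) (opp d) = Ew p d := by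
  unfold Ew
  rw [cr_opp, stp_opp_stp]
  simp only [EC.symm_iff]

lemma Ew_lo (p : Pt 3) (d : Dir) : Ew (lo p) d = Ew p d := by
  unfold Ew own
  rw [cr_lo, lo_stp_lo, lo_lo]

lemma Ew_spec {p : Pt 3} {d : Dir} (h : 0 < Ew p d) :
    EC (cr p d) d (own p) (own (stp d p)) (Ew p d) := by
  unfold Ew at *
  split_ifs at * with h1 h2
  · exact h1
  · exact h2
  · omega

lemma EC.one_or_two {c : Bool} {d : Dir} {a b : Own} {w : ℕ} (h : EC c d a b w) :
    w = 1 ∨ w = 2 := by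
  cases h <;> simp

lemma le_Ew {p : Pt 3} {d : Dir} {w : ℕ} (h : EC (cr p d) d (own p) (own (stp d p)) w) :
    w ≤ Ew p d := by
  have hw := h.one_or_two
  unfold Ew
  rcases hw with rfl | rfl
  · split_ifs <;> omega
  · rw [if_pos h]

lemma Ew_le (p : Pt 3) (d : Dir) : Ew p d ≤ 2 := by
  unfold Ew; split_ifs <;> omega

abbrev LabT : Type := Fin 3 ⊕ (Fin 3 × Pt 3)

lemma exists_lab : ∃ f : LabT → String, Function.Injective f := by
  obtain ⟨g, hg⟩ := exists_injective_nat LabT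
  refine ⟨fun a => String.ofList (List.replicate (g a) default), fun a b h => hg ?_⟩
  have h1 := congrArg String.toList h
  simp only [String.toList_ofList] at h1
  have := congrArg List.length h1
  simpa using this

def lab : LabT → String := Classical.choose exists_lab
lemma lab_inj : Function.Injective lab := Classical.choose_spec exists_lab

/-- Kinds of faces. -/
inductive Fk where
  | nul0 | nul1 | nrm | str
  deriving DecidableEq

def Fk.code : Fk → Fin 4
  | .nul0 => 0
  | .nul1 => 1
  | .nrm => 2
  | .str => 3

instance : Finite Fk := Finite.of_injective Fk.code fun a b h => by
  cases a <;> cases b <;> first | rfl | (simp [Fk.code] at h)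

/-- Lower end of an edge. -/
def lw (p : Pt 3) (d : Dir) : Pt 3 := if d.2 then p else stp d p

def gl (p : Pt 3) (d : Dir) : Fk → Glue
  | .nul0 => (lab (.inl 0), 0)
  | .nul1 => (lab (.inl 1), 0)
  | .nrm => (lab (.inr (d.1, lo (lw p d))), Ew p d)
  | .str => (lab (.inl 2), 2)

def tl (p : Pt 3) (φ : Dir → Fk) : TileType 3 :=
  fun i => (gl p (i, true) (φ (i, true)), gl p (i, false) (φ (i, false)))

lemma face_tl (p : Pt 3) (φ : Dir → Fk) (d : Dir) : face (tl p φ) d = gl p d (φ d) := by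
  rcases d with ⟨i, b⟩; cases b <;> rfl

lemma lo_lw_lo (p : Pt 3) (d : Dir) : lo (lw (lo p) d) = lo (lw p d) := by
  unfold lw; split_ifs
  · exact lo_lo p
  · exact lo_stp_lo d p

lemma gl_lo (p : Pt 3) (d : Dir) (k : Fk) : gl (lo p) d k = gl p d k := by
  cases k <;> simp only [gl, lo_lw_lo, Ew_lo]

lemma tl_lo (p : Pt 3) (φ : Dir → Fk) : tl (lo p) φ = tl p φ := by
  funext i; simp only [tl, gl_lo]

lemma lw_opp (p : Pt 3) (d : Dir) : lw (stp d p) (opp d) = lw p d := by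
  rcases d with ⟨i, b⟩; cases b
  · rfl
  · have := stp_opp_stp (i, true) p
    simpa [lw, opp] using this

lemma gl_nrm_opp (p : Pt 3) (d : Dir) : gl (stp d p) (opp d) .nrm = gl p d .nrm := by
  simp only [gl, lw_opp, Ew_opp]; rfl

lemma lo_lw_inj {p q : Pt 3} {d : Dir} (h : lo (lw p d) = lo (lw q d)) : lo p = lo q := by
  unfold lw at h
  split_ifs at h
  · exact h
  · have e : ∀ r : Pt 3, lo (stp (opp d) (lo (stp d r))) = lo r := fun r => by
      rw [lo_stp_lo, stp_opp_stp]
    rw [← e p, h, e]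

lemma bond_pos {p q : Pt 3} {d : Dir} {φ ψ : Dir → Fk}
    (h : 0 < bondD (tl p φ) (tl (stp d q) ψ) d) :
    (φ d = .str ∧ ψ (opp d) = .str) ∨
    (φ d = .nrm ∧ ψ (opp d) = .nrm ∧ lo p = lo q ∧ bondD (tl p φ) (tl (stp d q) ψ) d = Ew q d) := by
  unfold bondD at *
  rw [face_tl, face_tl] at *
  split_ifs at h with h1
  swap
  · omega
  rw [if_pos h1]
  obtain ⟨h1, h2⟩ := h1
  cases e : φ d with
  | nul0 => rw [e] at h2; simp [gl] at h2
  | nul1 => rw [e] at h2; simp [gl] at h2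
  | nrm =>
    rw [e] at h1 h2
    cases e' : ψ (opp d) with
    | nul0 => rw [e'] at h1; rw [h1] at h2; simp [gl] at h2
    | nul1 => rw [e'] at h1; rw [h1] at h2; simp [gl] at h2
    | str =>
      rw [e'] at h1
      have := lab_inj (congrArg Prod.fst h1)
      simp at this
    | nrm =>
      rw [e', gl_nrm_opp] at h1
      refine Or.inr ⟨rfl, rfl, ?_, ?_⟩
      · have := lab_inj (congrArg Prod.fst h1)
        simp only [Sum.inr.injEq, Prod.mk.injEq, true_and] at this
        exact lo_lw_inj this
      · rw [h1]; rfl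
  | str =>
    rw [e] at h1 h2
    cases e' : ψ (opp d) with
    | nul0 => rw [e'] at h1; rw [h1] at h2; simp [gl] at h2
    | nul1 => rw [e'] at h1; rw [h1] at h2; simp [gl] at h2
    | nrm =>
      rw [e'] at h1
      have := lab_inj (congrArg Prod.fst h1)
      simp at this
    | str => exact Or.inl ⟨rfl, rfl⟩

lemma bond_nrm {p : Pt 3} {d : Dir} {φ ψ : Dir → Fk} (h : φ d = .nrm) (h' : ψ (opp d) = .nrm) :
    bondD (tl p φ) (tl (stp d p) ψ) d = Ew p d := by
  unfold bondD
  rw [face_tl, face_tl, h, h', gl_nrm_opp]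
  by_cases h0 : 0 < Ew p d
  · rw [if_pos ⟨rfl, h0⟩]; rfl
  · rw [if_neg (fun h => h0 h.2)]; omega

lemma bond_str {p q : Pt 3} {d : Dir} {φ ψ : Dir → Fk} (h : φ d = .str) (h' : ψ (opp d) = .str) :
    bondD (tl p φ) (tl q ψ) d = 2 := by
  unfold bondD
  rw [face_tl, face_tl, h, h']
  simp [gl]

def maskW (d : Dir) : Fk :=
  if d = (0, false) ∨ d = (1, false) ∨ d = (2, false) then .nrm
  else if d = (0, true) then .nul1 else .nul0
def maskL (d : Dir) : Fk :=
  if d = (0, true) ∨ d = (2, false) then .nrm else .nul0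

/-- Tiles allowed in the universal tile set. -/
def ValidU (u : Pt 3) (φ : Dir → Fk) : Prop :=
  (own0 u ≠ .st none ∧ ∀ d, φ d = .nrm) ∨ (own0 u = .st none ∧ (φ = maskW ∨ φ = maskL)) ∨
  (∀ d, φ d ≠ .nrm) ∨ (∃ e, own0 u = .net (.boot e))

lemma box_finite : {u : Pt 3 | Box u}.Finite := by
  apply (Set.finite_Icc (0 : Pt 3) (fun _ => mside - 1)).subset
  intro u hu
  refine ⟨fun i => (hu i).1, fun i => ?_⟩
  have := (hu i).2
  change u i ≤ mside - 1
  omega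

lemma utiles_finite : {t : TileType 3 | ∃ u φ, Box u ∧ ValidU u φ ∧ t = tl u φ}.Finite := by
  apply ((box_finite.prod (Set.finite_univ (α := Dir → Fk))).image (fun x => tl x.1 x.2)).subset
  rintro t ⟨u, φ, h1, h2, rfl⟩
  exact ⟨(u, φ), ⟨h1, trivial⟩, rfl⟩

/-- The universal tile set. -/
def U : Finset (TileType 3) := utiles_finite.toFinset

lemma mem_U {t : TileType 3} : t ∈ U ↔ ∃ u φ, Box u ∧ ValidU u φ ∧ t = tl u φ := by
  unfold U; simp

end IU

namespace IU

/-! ## Part G: the seed region and the intended assembly -/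

/-- Hub of a big cell. -/
def hub : Pt 3 := ![0, K + 1, 2]

/-- Columns of the seed. -/
def TX (x : ℤ) : Prop := (∃ e, own0 ![x, K, 1] = .net (.boot e)) ∨ own0 ![x, K, 1] = .st none

/-- Seed region of a big cell. -/
def Z0 (u : Pt 3) : Prop := Box u ∧ ((∃ i, ∀ j, j ≠ i → u j = hub j) ∨
  (u 2 = 1 ∧ (u 1 = K ∨ u 1 = K + 1) ∧ TX (u 0)))

lemma hub_box : Box hub := by
  have := K_pos; have := K_lt
  intro i; fin_cases i <;> simp [hub] <;> omega

lemma own0_line {u : Pt 3} (h : ∃ i, ∀ j, j ≠ i → u j = hub j) : own0 u = .no := by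
  have hK : K = 2 * J + Na - 1 := rfl
  have hN := Na_pos
  have hJ := J_pos
  obtain ⟨i, h⟩ := h
  have hh0 : hub 0 = 0 := rfl
  have hh1 : hub 1 = K + 1 := rfl
  have hh2 : hub 2 = 2 := rfl
  unfold own0 trunk wslot
  have : i = 0 ∨ i = 1 ∨ i = 2 := by fin_cases i <;> simp
  rcases this with rfl | rfl | rfl
  · have h1 := h 1 (by decide)
    have h2 := h 2 (by decide)
    rw [hh1] at h1; rw [hh2] at h2
    rw [if_neg (by omega)]
    split_ifs <;> first | rfl | omega
  · have h1 := h 0 (by decide)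
    have h2 := h 2 (by decide)
    rw [hh0] at h1; rw [hh2] at h2
    rw [if_neg (by omega), if_neg (by omega), if_neg (by omega)]
  · have h1 := h 0 (by decide)
    have h2 := h 1 (by decide)
    rw [hh0] at h1; rw [hh1] at h2
    split_ifs <;> first | rfl | omega

lemma pt_eta (u : Pt 3) {a b c : ℤ} (h0 : u 0 = a) (h1 : u 1 = b) (h2 : u 2 = c) : u = ![a, b, c] := by
  funext i; fin_cases i <;> simp [h0, h1, h2]

lemma own0_out {u : Pt 3} (h2 : u 2 = 1) (hr : ¬ (J + 2 ≤ u 0 ∧ u 0 < J + 2 + 4 * Sn)) :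
    own0 u = .no ∨ ∃ w, own0 u = .net (.wA w) ∨ own0 u = .net (.wB w) := by
  unfold own0 wslot
  rw [if_neg (by omega), if_neg (by omega : ¬ (J + 2 ≤ u 0 ∧ u 0 < J + 2 + 4 * Sn ∧ u 2 = 1))]
  split_ifs <;> simp

lemma own0_Z0 {u : Pt 3} (h : Z0 u) : own0 u = .no ∨ (∃ e, own0 u = .net (.boot e)) ∨
    own0 u = .st none := by
  obtain ⟨hb, h | ⟨h2, h1, h⟩⟩ := h
  · exact Or.inl (own0_line h)
  · rcases h1 with h1 | h1
    · right; rw [pt_eta u rfl h1 h2]; exact h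
    · left
      have hr : J + 2 ≤ u 0 ∧ u 0 < J + 2 + 4 * Sn := by
        by_contra hr
        have h3 := own0_out (u := ![u 0, K, 1]) rfl hr
        unfold TX at h
        rcases h with ⟨e, h⟩ | h <;> rw [h] at h3 <;> simp at h3
      unfold own0 sslot
      rw [if_neg (by omega), if_neg (by omega), if_pos ⟨hr.1, hr.2, h2⟩, h1]
      rw [if_neg (by omega : ¬ K + 1 = K)]
      split_ifs <;> first | rfl | omega

lemma Z0_lock : Z0 (spos none) := by
  refine ⟨spos_box _, Or.inr ⟨rfl, Or.inl rfl, Or.inr ?_⟩⟩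
  have := own0_spos none
  exact this

lemma Z0_tip {u : Pt 3} {e : Atom} (hb : Box u) (h : own0 u = .net (.boot e)) (h1 : u 1 = K)
    (h2 : u 2 = 1) : Z0 u := by
  refine ⟨hb, Or.inr ⟨h2, Or.inl h1, Or.inl ⟨e, ?_⟩⟩⟩
  rw [pt_eta u rfl h1 h2] at h
  exact h

namespace Ctx
variable (C : Ctx)

/-- The seed positions. -/
def Z : Set (Pt 3) := {p | C.blk (mac p) ∈ dom C.T.seed ∧ Z0 (lo p)}

def Win (P : Pt 3) : Prop := ∃ t, C.top (C.blk P) = some t ∧ C.loc P 0 = C.ix t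

/-- Glue kinds of the tile at a position. -/
def phi (p : Pt 3) (d : Dir) : Fk :=
  if p ∈ C.Z then
    if stp d p ∈ C.Z then .str
    else if ∃ e, own p = .net (.boot e) ∧ C.Tr (dom C.T.seed) ∅ (mac p) e then .nrm
    else if own p = .st none ∧ d = (0, true) ∧ C.Win (mac p) then .nul1 else .nul0
  else if own p = .st none then (if C.Win (mac p) then maskW d else maskL d)
  else .nrm

/-- The region that may be filled. -/
def Reg (p : Pt 3) : Prop := p ∈ C.Z ∨ (∃ k, own p = .net k ∧ ∀ e, k ≠ .boot e) ∨ ∃ s, own p = .st s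

/-- The intended assembly. -/
def Om : Config 3 := fun p => if C.Reg p then some (tl p (C.phi p)) else none

variable {C}

lemma Om_eq {p : Pt 3} (h : C.Reg p) : C.Om p = some (tl p (C.phi p)) := if_pos h
lemma Om_some {p : Pt 3} {t : TileType 3} (h : C.Om p = some t) : C.Reg p ∧ t = tl p (C.phi p) := by
  unfold Om at h; split_ifs at h with h1
  simp at h; exact ⟨h1, h.symm⟩

lemma own_Z {p : Pt 3} (h : p ∈ C.Z) : own p = .no ∨ (∃ e, own p = .net (.boot e)) ∨
    own p = .st none := own0_Z0 h.2

lemma notZ_net {p : Pt 3} {k : Net} (h : own p = .net k) (hk : ∀ e, k ≠ .boot e) : p ∉ C.Z := by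
  intro hz
  rcases own_Z hz with h' | ⟨e, h'⟩ | h' <;> rw [h] at h'
  · simp at h'
  · exact hk e (by simpa using h')
  · simp at h'

lemma notZ_gate {p : Pt 3} {g : Gate} (h : own p = .st (some g)) : p ∉ C.Z := by
  intro hz
  rcases own_Z hz with h' | ⟨e, h'⟩ | h' <;> rw [h] at h' <;> simp at h'

lemma phi_net {p : Pt 3} {k : Net} (h : own p = .net k) (hk : ∀ e, k ≠ .boot e) (d : Dir) :
    C.phi p d = .nrm := by
  unfold phi; rw [if_neg (notZ_net h hk), if_neg (by simp [h])]
lemma phi_gate {p : Pt 3} {g : Gate} (h : own p = .st (some g)) (d : Dir) : C.phi p d = .nrm := by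
  unfold phi; rw [if_neg (notZ_gate h), if_neg (by simp [h])]
lemma phi_lock {p : Pt 3} (h : own p = .st none) (hz : p ∉ C.Z) :
    C.phi p = if C.Win (mac p) then maskW else maskL := by
  funext d; unfold phi; rw [if_neg hz, if_pos h]; split_ifs <;> rfl

lemma phi_str {p : Pt 3} {d : Dir} (h : C.phi p d = .str) : p ∈ C.Z ∧ stp d p ∈ C.Z := by
  unfold phi at h
  unfold maskW maskL at h
  split_ifs at h with h1 h2
  exact ⟨h1, h2⟩

lemma phi_Z_nrm {p : Pt 3} {d : Dir} (hz : p ∈ C.Z) (h : C.phi p d = .nrm) :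
    ∃ e, own p = .net (.boot e) ∧ C.Tr (dom C.T.seed) ∅ (mac p) e := by
  unfold phi at h
  rw [if_pos hz] at h
  split_ifs at h with h1 h2
  exact h2

lemma Om_mem_U {p : Pt 3} {t : TileType 3} (h : C.Om p = some t) : t ∈ U := by
  obtain ⟨h1, rfl⟩ := Om_some h
  refine mem_U.2 ⟨lo p, C.phi p, lo_box p, ?_, (tl_lo _ _).symm⟩
  by_cases hz : p ∈ C.Z
  · rcases own_Z hz with h' | ⟨e, h'⟩ | h'
    · refine Or.inr (Or.inr (Or.inl fun d hd => ?_))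
      obtain ⟨e, he, _⟩ := phi_Z_nrm hz hd
      rw [h'] at he; simp at he
    · exact Or.inr (Or.inr (Or.inr ⟨e, h'⟩))
    · refine Or.inr (Or.inr (Or.inl fun d hd => ?_))
      obtain ⟨e, he, _⟩ := phi_Z_nrm hz hd
      rw [h'] at he; simp at he
  · rcases h1 with h1 | ⟨k, h1, hk⟩ | ⟨s, h1⟩
    · exact absurd h1 hz
    · refine Or.inl ⟨?_, phi_net h1 hk⟩
      intro h; rw [← own, h1] at h; simp at h
    · cases s with
      | none =>
        refine Or.inr (Or.inl ⟨h1, ?_⟩)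
        rw [phi_lock h1 hz]; split_ifs <;> simp
      | some g =>
        refine Or.inl ⟨?_, phi_gate h1⟩
        intro h; rw [← own, h1] at h; simp at h

/-! Truth of the nets -/

variable (C) in
def WT (A F : Set (Pt 3)) (w : Wire) (P : Pt 3) : Prop :=
  Near A (C.blk (if w.1.2 then P else stp (w.1.1, true) P)) ∧
    C.Tr A F (stp w.1 (if w.1.2 then P else stp (w.1.1, true) P)) w.2

variable (C) in
def NT (A F : Set (Pt 3)) (P : Pt 3) : Net → Prop
  | .sa e => C.Tr A F P e
  | .wA w => C.WT A F w P
  | .wB w => C.WT A F w (stp (w.1.1, false) P)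
  | .boot e => C.blk P ∈ dom C.T.seed ∧ C.Tr (dom C.T.seed) ∅ P e

variable (C) in
def CT (A F : Set (Pt 3)) (P : Pt 3) : Own → Prop
  | .no => False
  | .net k => C.NT A F P k
  | .st none => if C.Win P then C.Tr A F P .fw else C.Tr A F P .cl
  | .st (some g) => (C.NT A F P (sL (some g)) ∧ C.NT A F P (sR (some g))) ∨ C.NT A F P (sC (some g))

lemma WT.mono {A A' F F' : Set (Pt 3)} {P : Pt 3} {w : Wire} (h : C.WT A F w P)
    (hA : A ⊆ A') (hF : F ⊆ F') : C.WT A' F' w P := ⟨h.1.mono hA, h.2.mono hA hF⟩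

lemma NT.mono {A A' F F' : Set (Pt 3)} {P : Pt 3} {k : Net} (h : C.NT A F P k)
    (hA : A ⊆ A') (hF : F ⊆ F') : C.NT A' F' P k := by
  cases k with
  | sa e => exact Tr.mono h hA hF
  | wA w => exact WT.mono h hA hF
  | wB w => exact WT.mono h hA hF
  | boot e => exact h

lemma CT.mono {A A' F F' : Set (Pt 3)} {P : Pt 3} {o : Own} (h : C.CT A F P o)
    (hA : A ⊆ A') (hF : F ⊆ F') : C.CT A' F' P o := by
  cases o with
  | no => exact h
  | net k => exact NT.mono h hA hF
  | st s =>
    cases s with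
    | none =>
      simp only [CT] at h ⊢
      split_ifs at h ⊢ <;> exact h.mono hA hF
    | some g => exact h.imp (fun h => ⟨h.1.mono hA hF, h.2.mono hA hF⟩) (fun h => h.mono hA hF)

lemma WT.near {A F : Set (Pt 3)} {P : Pt 3} {w : Wire} (h : C.WT A F w P) :
    Near A (C.blk P) ∧ Near A (C.blk (stp (w.1.1, true) P)) := by
  obtain ⟨⟨i, b⟩, e⟩ := w
  obtain ⟨h1, h2⟩ := h
  cases b
  · simp only [Bool.false_eq_true, if_false] at h1 h2
    refine ⟨?_, h1⟩
    have := h2.1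
    have e : stp (i, false) (stp (i, true) P) = P := stp_opp_stp (i, true) P
    rwa [e] at this
  · simp only [if_true] at h1 h2
    exact ⟨h1, h2.1⟩

lemma NT.near {A F : Set (Pt 3)} {P : Pt 3} {k : Net} (h : C.NT A F P k) (hA : dom C.T.seed ⊆ A) :
    Near A (C.blk P) := by
  cases k with
  | sa e => exact h.1
  | wA w => exact (WT.near h).1
  | wB w =>
    have := (WT.near h).2
    have e : stp (w.1.1, true) (stp (w.1.1, false) P) = P := stp_opp_stp (w.1.1, false) P
    rwa [e] at this
  | boot e => exact Or.inl (hA h.1)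

lemma CT.near {A F : Set (Pt 3)} {P : Pt 3} {o : Own} (h : C.CT A F P o) (hA : dom C.T.seed ⊆ A) :
    Near A (C.blk P) := by
  cases o with
  | no => exact h.elim
  | net k => exact NT.near h hA
  | st s =>
    cases s with
    | none =>
      simp only [CT] at h
      split_ifs at h <;> exact h.1
    | some g =>
      rcases h with h | h
      · exact h.1.near hA
      · exact h.near hA

lemma NT_snd {A F : Set (Pt 3)} {P : Pt 3} {d : Dir} {e : Atom} :
    C.NT A F P (snd d e) ↔ Near A (C.blk P) ∧ C.Tr A F (stp d P) e := by
  obtain ⟨i, b⟩ := d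
  cases b
  · have e : stp (i, true) (stp (i, false) P) = P := stp_opp_stp (i, false) P
    simp only [snd, NT, WT, Bool.false_eq_true, if_false, e]
  · simp only [snd, NT, WT, if_true]

lemma NT_rcv {A F : Set (Pt 3)} {P : Pt 3} {d : Dir} {e : Atom}
    (h : C.NT A F P (rcv d e)) : C.Tr A F P e := by
  obtain ⟨i, b⟩ := d
  cases b
  · have e : stp (i, false) (stp (i, true) P) = P := stp_opp_stp (i, true) P
    simp only [rcv, NT, WT, Bool.false_eq_true, if_false, e] at h
    exact h.2
  · have e : stp (i, true) (stp (i, false) P) = P := stp_opp_stp (i, false) P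
    simp only [rcv, NT, WT, if_true, e] at h
    exact h.2

/-- Gates are sound, except the one that resolves a block. -/
lemma gate_sound {A F : Set (Pt 3)} {P : Pt 3} (g : Gate) (hA : dom C.T.seed ⊆ A)
    (hg : sC (some g) ≠ .sa .rho)
    (hL : C.NT A F P (sL (some g))) (hR : C.NT A F P (sR (some g))) : C.NT A F P (sC (some g)) := by
  obtain ⟨⟨L, R, Cn⟩, h⟩ := g
  change C.NT A F P L at hL
  change C.NT A F P R at hR
  change C.NT A F P Cn
  change Cn ≠ _ at hg
  change GateOk L R Cn at h
  cases h with
  | stay h => exact rl_sound h (fun h' => hg (by rw [h'.2])) hL hR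
  | send h =>
    rw [NT_snd]
    refine ⟨hL.1, rl_sound h ?_ hL hR⟩
    rintro ⟨rfl, rfl⟩
    cases h
  | recv d e h1 h2 => exact NT_rcv hL
  | boot e h1 h2 => exact hL.2.mono hA (Set.empty_subset _)

lemma gate_rho {g : Gate} (hg : sC (some g) = .sa .rho) : sL (some g) = .sa .rz ∧ sR (some g) = .sa .rz := by
  obtain ⟨⟨L, R, Cn⟩, h⟩ := g
  change Cn = _ at hg
  change L = _ ∧ R = _
  change GateOk L R Cn at h
  subst hg
  generalize hx : Net.sa .rho = x at h
  cases h with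
  | stay h =>
    simp at hx; subst hx; cases h; simp
  | send h => unfold snd at hx; split_ifs at hx
  | recv d e h1 h2 => simp at hx; exact absurd hx.symm h1
  | boot e h1 h2 => simp at hx; exact absurd hx.symm h1

def rhoG : Gate := ⟨(.sa .rz, .sa .rz, .sa .rho), .stay .rhoI⟩

lemma gate_rho' {g : Gate} (hg : sC (some g) = .sa .rho) : g = rhoG := by
  obtain ⟨h1, h2⟩ := gate_rho hg
  obtain ⟨⟨L, R, Cn⟩, h⟩ := g
  apply Subtype.ext
  change L = _ at h1
  change R = _ at h2
  change Cn = _ at hg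
  subst h1 h2 hg
  rfl

end Ctx
end IU

namespace IU

/-! ## Part H: soundness of the simulator -/

lemma EC.net_inv {c : Bool} {d : Dir} {b : Own} {w : ℕ} {k : Net} (h : EC c d (.net k) b w) :
    (c = false ∧ b = .net k ∧ w = 2 ∧ ∀ e, k ≠ .boot e) ∨
    (∃ g, c = false ∧ b = .st (some g) ∧ ((w = 1 ∧ d.1 = 0) ∨ (k = sC (some g) ∧ d = (1, true)))) ∨
    (c = false ∧ b = .st none ∧ ((k = .sa .fw ∧ d = (0, true)) ∨ (k = .sa .cl ∧ d = (0, false)) ∨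
      (k = .sa .ow ∧ d = (1, true)) ∨ (k = .sa .oF ∧ d = (2, true)))) ∨
    (∃ v : Wire, c = true ∧ d = (v.1.1, true) ∧ k = .wA v ∧ b = .net (.wB v)) ∨
    (∃ v : Wire, c = true ∧ d = (v.1.1, false) ∧ k = .wB v ∧ b = .net (.wA v)) := by
  cases h with
  | net _ _ h => exact Or.inl ⟨rfl, rfl, rfl, h⟩
  | gL' g => exact Or.inr (Or.inl ⟨g, rfl, rfl, Or.inl ⟨rfl, rfl⟩⟩)
  | gR' g => exact Or.inr (Or.inl ⟨g, rfl, rfl, Or.inl ⟨rfl, rfl⟩⟩)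
  | gC' g => exact Or.inr (Or.inl ⟨g, rfl, rfl, Or.inr ⟨rfl, rfl⟩⟩)
  | lF' => simp
  | lC' => simp
  | lW' => simp
  | lO' => simp
  | wU v => exact Or.inr (Or.inr (Or.inr (Or.inl ⟨v, rfl, rfl, rfl, rfl⟩)))
  | wD v => exact Or.inr (Or.inr (Or.inr (Or.inr ⟨v, rfl, rfl, rfl, rfl⟩)))

lemma EC.gate_inv {c : Bool} {d : Dir} {b : Own} {w : ℕ} {g : Gate} (h : EC c d (.st (some g)) b w) :
    c = false ∧ ((d = (0, false) ∧ b = .net (sL (some g)) ∧ w = 1) ∨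
      (d = (0, true) ∧ b = .net (sR (some g)) ∧ w = 1) ∨
      (d = (1, false) ∧ b = .net (sC (some g)))) := by
  cases h <;> simp

lemma EC.lock_inv {c : Bool} {d : Dir} {b : Own} {w : ℕ} (h : EC c d (.st none) b w) :
    c = false ∧ ((d = (0, false) ∧ b = .net (.sa .fw)) ∨ (d = (0, true) ∧ b = .net (.sa .cl)) ∨
      (d = (1, false) ∧ b = .net (.sa .ow)) ∨ (d = (2, false) ∧ b = .net (.sa .oF))) := by
  cases h <;> simp

lemma sum_two {f : Dir → ℕ} (h : 2 ≤ ∑ d, f d) :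
    (∃ d, 2 ≤ f d) ∨ ∃ d d', d ≠ d' ∧ 0 < f d ∧ 0 < f d' := by
  by_contra hc
  push Not at hc
  obtain ⟨h1, h2⟩ := hc
  by_cases h0 : ∃ d, 0 < f d
  · obtain ⟨d, hd⟩ := h0
    rw [Finset.sum_eq_single d] at h
    · have := h1 d; omega
    · intro d' _ hd'
      have := h2 d d' hd'.symm hd
      omega
    · simp
  · push Not at h0
    have : ∑ d, f d = 0 := Finset.sum_eq_zero fun d _ => by have := h0 d; omega
    omega

namespace Ctx
variable (C : Ctx)

/-- Local position of the resolution cell. -/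
def rhoLo : Pt 3 := stp (1, false) (spos (some rhoG))
lemma rhoLo_box : Box rhoLo := spos_in _ (by simp)
lemma rhoLo_own : own0 rhoLo = .net (.sa .rho) := own0_C (some rhoG)

/-- The resolution cell of a block. -/
def rho0 (x : Pt 3) : Pt 3 := gp (C.line x (C.n - 1)) rhoLo

def Aof (α : Config 3) : Set (Pt 3) := dom C.T.seed ∪ {x | α (C.rho0 x) ≠ none}
def Fof (_C : Ctx) (α : Config 3) : Set (Pt 3) := {P | α (gp P (spos none)) ≠ none}

variable {C}

lemma blk_line {x : Pt 3} {i : ℤ} (h0 : 0 ≤ i) (h1 : i < C.n) : C.blk (C.line x i) = x :=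
  blk_mk (line_inBox h0 h1)
lemma loc_line {x : Pt 3} {i : ℤ} (h0 : 0 ≤ i) (h1 : i < C.n) : C.loc (C.line x i) = ![i, 0, 0] :=
  loc_mk (line_inBox h0 h1)
lemma eq_line {P : Pt 3} (h : C.loc P 1 = 0 ∧ C.loc P 2 = 0) : P = C.line (C.blk P) (C.loc P 0) := by
  unfold line
  rw [← pt_eta (C.loc P) rfl h.1 h.2, mk_blk_loc]

lemma mac_rho0 (x : Pt 3) : mac (C.rho0 x) = C.line x (C.n - 1) := mac_gp _ rhoLo_box
lemma blk_rho0 (x : Pt 3) : C.blk (mac (C.rho0 x)) = x := by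
  have := C.n_ge
  rw [mac_rho0, blk_line (by omega) (by omega)]
lemma own_rho0 (x : Pt 3) : own (C.rho0 x) = .net (.sa .rho) := by
  unfold rho0; rw [own_gp _ rhoLo_box, rhoLo_own]
lemma rho0_inj {x y : Pt 3} (h : C.rho0 x = C.rho0 y) : x = y := by
  rw [← blk_rho0 (C := C) x, h, blk_rho0]

lemma fi_wsum {A : Set (Pt 3)} {x : Pt 3} {u : ℤ} (h : C.PlT A x u .fi) :
    ∃ t, C.IsIx u t ∧ C.T.temp ≤ wsum (C.rst A) x t := by
  obtain ⟨D, ⟨t, ht, hs⟩, ha⟩ := h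
  refine ⟨t, ht, hs.trans ?_⟩
  unfold wsum
  refine le_trans (Finset.sum_le_sum fun d hd => ?_)
    (Finset.sum_le_sum_of_subset (Finset.subset_univ D))
  obtain ⟨v, ⟨hA, t2, h2, rfl⟩, t1, t', h3, h4, h5, h6⟩ := ha d hd
  have e1 : t1 = t := h3.uniq ht
  have e2 : t' = t2 := h4.uniq (isIx_ix (top_mem h2))
  subst e1 e2
  unfold nb rst
  rw [if_pos hA, h2]
  simp only [bondD]
  rw [if_pos ⟨h5, h6⟩]

/-- Invariant of the producible assemblies of the simulator. -/
structure Inv (C : Ctx) (α : Config 3) : Prop where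
  ext : Extends α C.Om
  zed : ∀ p ∈ C.Z, α p ≠ none
  ct : ∀ p, α p ≠ none → p ∉ C.Z → C.CT (C.Aof α) (C.Fof α) (mac p) (own p)
  pa : C.PA (C.Aof α)
  fl : ∀ x ∈ C.Aof α, ∀ i, 0 ≤ i → i < C.n → C.line x i ∈ C.Fof α

section inv
variable {α : Config 3}

lemma Inv.seed_sub (_hI : C.Inv α) : dom C.T.seed ⊆ C.Aof α := Set.subset_union_left

lemma Inv.val (hI : C.Inv α) {p : Pt 3} (h : α p ≠ none) : α p = some (tl p (C.phi p)) := by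
  obtain ⟨t, ht⟩ := Option.ne_none_iff_exists'.1 h
  rw [ht, ← (Om_some (hI.ext _ _ ht)).2]

lemma Inv.supply_net (hI : C.Inv α) {q : Pt 3} {d : Dir} {k : Net} (hq : α q ≠ none) (h : C.phi q d = .nrm)
    (ho : own q = .net k) : C.NT (C.Aof α) (C.Fof α) (mac q) k := by
  by_cases hz : q ∈ C.Z
  · obtain ⟨e, h1, h2⟩ := phi_Z_nrm hz h
    rw [ho] at h1
    simp at h1; subst h1
    exact ⟨hz.1, h2⟩
  · have := hI.ct q hq hz
    rwa [ho] at this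

lemma Inv.supply_gate (hI : C.Inv α) {q : Pt 3} {g : Gate} (hq : α q ≠ none) 
    (ho : own q = .st (some g)) : C.CT (C.Aof α) (C.Fof α) (mac q) (.st (some g)) := by
  have := hI.ct q hq (notZ_gate ho)
  rwa [ho] at this

/-- An empty lock whose `fw` net is true is the winner. -/
lemma Inv.fw_win (hI : C.Inv α) {P : Pt 3} (h : C.Tr (C.Aof α) (C.Fof α) P .fw)
    (hF : P ∉ C.Fof α) : C.Win P := by
  obtain ⟨h1, h2, h3⟩ := h
  obtain ⟨t, ht, hw⟩ := fi_wsum h3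
  have hl := loc_inBox (C := C) P 0
  have hx : C.blk P ∉ C.Aof α := fun hx => hF (by
    rw [eq_line h2]; exact hI.fl _ hx _ hl.1 hl.2)
  exact ⟨t, (hI.pa.attach hx ht.1 hw).1, ht.2⟩

lemma Inv.cl_lose (hI : C.Inv α) {P : Pt 3} (h : C.Tr (C.Aof α) (C.Fof α) P .cl)
    (hF : P ∉ C.Fof α) : ¬ C.Win P := by
  obtain ⟨h1, h2, t, h3, h4⟩ := h
  rintro ⟨t', h5, h6⟩
  have e : t = t' := by have := h3.1.symm.trans h5; simpa using this
  subst e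
  apply hF
  rw [eq_line h2, h6]
  exact h4

/-- A filled winning lock. -/
lemma Inv.win_ok (hI : C.Inv α) {P : Pt 3} (h : C.Tr (C.Aof α) (C.Fof α) P .fw) (hw : C.Win P) :
    ∃ t, C.Ok (C.Aof α) (C.blk P) t ∧ C.loc P 0 = C.ix t := by
  obtain ⟨h1, h2, h3⟩ := h
  obtain ⟨t, ht, hs⟩ := fi_wsum h3
  obtain ⟨t', h5, h6⟩ := hw
  have e : t = t' := ix_inj ht.1 (top_mem h5) (ht.2.symm.trans h6)
  subst e
  exact ⟨t, ⟨h5, Or.inr hs⟩, h6⟩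

lemma Inv.bonds (hI : C.Inv α) {p : Pt 3} {t : TileType 3} (hp : α p = none) (ht : t ∈ U) (hw : 2 ≤ wsum α p t) :
    ∃ φ, t = tl p φ ∧ ValidU (lo p) φ ∧ ∀ d, 0 < nb α t p d → φ d = .nrm ∧ α (stp d p) ≠ none ∧
      C.phi (stp d p) (opp d) = .nrm ∧ EC (cr p d) d (own p) (own (stp d p)) (nb α t p d) := by
  obtain ⟨u, φ, hu, hv, rfl⟩ := mem_U.1 ht
  have key : ∀ d, 0 < nb α (tl u φ) p d → lo u = lo p ∧ φ d = .nrm ∧ α (stp d p) ≠ none ∧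
      C.phi (stp d p) (opp d) = .nrm ∧ EC (cr p d) d (own p) (own (stp d p)) (nb α (tl u φ) p d) := by
    intro d hd
    have hne : α (stp d p) ≠ none := by
      intro h0; unfold nb at hd; rw [h0] at hd; simp at hd
    have hv := hI.val hne
    have e : nb α (tl u φ) p d = bondD (tl u φ) (tl (stp d p) (C.phi (stp d p))) d := by
      unfold nb; rw [hv]
    rw [e] at hd
    rcases bond_pos hd with ⟨h1, h2⟩ | ⟨h1, h2, h3, h4⟩
    · exfalso
      have := (phi_str h2).2
      rw [stp_opp_stp] at this
      exact hI.zed p this hp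
    · refine ⟨h3, h1, hne, h2, ?_⟩
      rw [e, h4]
      exact Ew_spec (by rw [← h4]; exact hd)
  have hex : ∃ d, 0 < nb α (tl u φ) p d := by
    rcases sum_two hw with ⟨d, h⟩ | ⟨d, _, _, h, _⟩
    · exact ⟨d, by omega⟩
    · exact ⟨d, h⟩
  obtain ⟨d, hd⟩ := hex
  have hlo := (key d hd).1
  rw [lo_of_box hu] at hlo
  refine ⟨φ, by rw [hlo, tl_lo], by rw [← hlo]; exact hv, fun d hd => (key d hd).2⟩

lemma all_nrm {p : Pt 3} {φ : Dir → Fk} (hv : ValidU (lo p) φ) {d : Dir} (hd : φ d = .nrm)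
    (h1 : own p ≠ .st none) (h2 : ∀ e, own p ≠ .net (.boot e)) : φ = fun _ => .nrm := by
  rcases hv with h | h | h | h
  · funext d; exact h.2 d
  · exact absurd h.1 h1
  · exact absurd hd (h d)
  · obtain ⟨e, h⟩ := h; exact absurd h (h2 e)

/-- Analysis of a single attachment. -/
lemma Inv.step_cases (hI : C.Inv α) {p : Pt 3} {t : TileType 3} (hp : α p = none) (ht : t ∈ U)
    (hw : 2 ≤ wsum α p t) : C.Om p = some t ∧ (C.CT (C.Aof α) (C.Fof α) (mac p) (own p) ∨
      ∃ x, p = C.rho0 x ∧ x ∉ C.Aof α ∧ C.PA (insert x (C.Aof α)) ∧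
        ∀ i, 0 ≤ i → i < C.n → C.line x i ∈ C.Fof α) := by
  obtain ⟨φ, rfl, hv, hb⟩ := hI.bonds hp ht hw
  have hz : p ∉ C.Z := fun h => hI.zed p h hp
  have hsum := sum_two hw
  have hex : ∃ d, 0 < nb α (tl p φ) p d := by
    rcases hsum with ⟨d, h⟩ | ⟨d, _, _, h, _⟩
    · exact ⟨d, by omega⟩
    · exact ⟨d, h⟩
  cases ho : own p with
  | no =>
    obtain ⟨d, hd⟩ := hex
    have := (hb d hd).2.2.2
    rw [ho] at this
    generalize cr p d = c at this
    generalize own (stp d p) = b at this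
    cases this
  | net k =>
    -- a single bond of strength two
    have h2 : ∃ d, 2 ≤ nb α (tl p φ) p d := by
      rcases hsum with h | ⟨d, d', hdd, h1, h2⟩
      · exact h
      by_contra hc
      push Not at hc
      have hs : ∀ d, 0 < nb α (tl p φ) p d → d.1 = 0 ∧ ∃ s, own0 (stp d (lo p)) = .st s := by
        intro d hd
        have h3 := hc d
        obtain ⟨_, _, _, h4⟩ := hb d hd
        have e : nb α (tl p φ) p d = 1 := by omega
        rw [e, ho] at h4
        generalize hcr : cr p d = c at h4
        generalize hbo : own (stp d p) = b at h4
        have : c = false ∧ d.1 = 0 ∧ ∃ s, b = .st s := by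
          cases h4 <;> simp
        obtain ⟨rfl, h5, s, rfl⟩ := this
        refine ⟨h5, s, ?_⟩
        rw [← (cr_false hcr).2]; exact hbo
      obtain ⟨e1, s, hs1⟩ := hs d h1
      obtain ⟨e2, s', hs2⟩ := hs d' h2
      obtain ⟨i, b⟩ := d
      obtain ⟨i', b'⟩ := d'
      simp only at e1 e2
      subst e1 e2
      cases b <;> cases b'
      · exact hdd rfl
      · exact no_between hs1 hs2 (by simp [stp_apply, sg]; ring)
      · exact no_between hs2 hs1 (by simp [stp_apply, sg]; ring)
      · exact hdd rfl
    obtain ⟨d, hd⟩ := h2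
    obtain ⟨hφ, hq, hn, hE⟩ := hb d (by omega)
    rw [ho] at hE
    have hkb : ∀ e, k ≠ .boot e := by
      rcases hE.net_inv with ⟨_, _, _, h⟩ | ⟨g, _, _, ⟨h, _⟩ | ⟨h, _⟩⟩ | ⟨_, _, h⟩ | ⟨v, _, _, h, _⟩ |
        ⟨v, _, _, h, _⟩
      · exact h
      · omega
      · rw [h]; exact (sC_ne _).2
      · rcases h with h | h | h | h <;> rw [h.1] <;> simp
      · rw [h]; simp
      · rw [h]; simp
    have hφ' := all_nrm hv hφ (by rw [ho]; simp) (by rw [ho]; simpa using hkb)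
    have hOm : C.Om p = some (tl p φ) := by
      rw [Om_eq (Or.inr (Or.inl ⟨k, ho, hkb⟩))]
      congr 2
      rw [hφ']; funext d; exact phi_net ho hkb d
    refine ⟨hOm, ?_⟩
    change C.NT _ _ _ _ ∨ _
    rcases hE.net_inv with ⟨hc, h1, _, _⟩ | ⟨g, hc, h1, ⟨h, _⟩ | ⟨h, hdd⟩⟩ | ⟨hc, h1, h⟩ |
        ⟨v, hc, h1, h, h3⟩ | ⟨v, hc, h1, h, h3⟩
    · left
      have := hI.supply_net hq hn h1
      rwa [(cr_false hc).1] at this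
    · omega
    · have hg := hI.supply_gate hq h1
      rw [(cr_false hc).1] at hg
      rcases hg with ⟨hL, hR⟩ | hg
      swap
      · left; rw [h]; exact hg
      by_cases hr : sC (some g) = .sa .rho
      swap
      · left; rw [h]; exact gate_sound g hI.seed_sub hr hL hR
      rw [(gate_rho hr).1] at hL
      obtain ⟨hnear, hu, hu0, t, hok, hF⟩ := hL
      have hP : mac p = C.line (C.blk (mac p)) (C.n - 1) := by
        conv_lhs => rw [eq_line hu]
        rw [hu0]
      by_cases hx : C.blk (mac p) ∈ C.Aof α
      · left; rw [h, hr]; exact ⟨hnear, hu, hu0, hx⟩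
      · right
        refine ⟨C.blk (mac p), ?_, hx, ?_, hF⟩
        · have h5 : lo (stp d p) = spos (some g) := own0_st h1
          rw [(cr_false hc).2, hdd, gate_rho' hr] at h5
          unfold rho0
          rw [← hP]
          conv_lhs => rw [← gp_mac_lo p]
          congr 1
          unfold rhoLo
          rw [← h5]
          exact (stp_opp_stp (1, true) _).symm
        · exact (hI.pa.attach hx (top_mem hok.1) (hok.2.resolve_left hx)).2
    · left
      have hzq : stp d p ∉ C.Z := by
        intro hzq
        obtain ⟨e, he, _⟩ := phi_Z_nrm hzq hn
        rw [h1] at he; simp at he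
      have hct := hI.ct _ hq hzq
      have hph := phi_lock h1 hzq
      have hFq : mac p ∈ C.Fof α := by
        change α _ ≠ none
        have h5 : lo (stp d p) = spos none := own0_st h1
        rw [← h5, ← (cr_false hc).1, gp_mac_lo]; exact hq
      rw [h1, (cr_false hc).1] at hct
      rw [(cr_false hc).1] at hph
      rw [hph] at hn
      simp only [CT] at hct
      rcases h with ⟨rfl, rfl⟩ | ⟨rfl, rfl⟩ | ⟨rfl, rfl⟩ | ⟨rfl, rfl⟩
      · split_ifs at hct hn
        · exact hct
        · simp [maskL, opp] at hn
      · split_ifs at hct hn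
        · simp [maskW, opp] at hn
        · exact hct
      · split_ifs at hct hn with hwn
        · obtain ⟨t, h6, h7⟩ := hI.win_ok hct hwn
          refine ⟨hct.1, hct.2.1, t, h6, ?_, h7⟩
          rw [← eq_line hct.2.1]; exact hFq
        · simp [maskL, opp] at hn
      · split_ifs at hct with hwn
        · obtain ⟨t, h6, h7⟩ := hI.win_ok hct hwn
          refine ⟨hct.1, hct.2.1, t, h6, ?_⟩
          rw [← eq_line hct.2.1]; exact hFq
        · obtain ⟨h6, h7, t, h8, _⟩ := hct
          refine ⟨h6, h7, t, h8, ?_⟩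
          rw [← eq_line h7]; exact hFq
    · left
      have := hI.supply_net hq hn h3
      rw [cr_true hc, h1] at this
      rw [h]
      have e : stp (v.1.1, false) (stp (v.1.1, true) (mac p)) = mac p := stp_opp_stp (v.1.1, true) _
      simp only [NT, e] at this ⊢
      exact this
    · left
      have := hI.supply_net hq hn h3
      rw [cr_true hc, h1] at this
      rw [h]
      exact this
  | st s =>
    cases s with
    | none =>
      obtain ⟨d, hd⟩ := hex
      obtain ⟨hφ, hq, hn, hE⟩ := hb d hd
      rw [ho] at hE
      have hF : mac p ∉ C.Fof α := by
        intro h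
        apply h
        have h5 : lo p = spos none := own0_st ho
        rw [← h5, gp_mac_lo, hp]
      have hm : φ = maskW ∨ φ = maskL := by
        rcases hv with h | h | h | h
        · exact absurd ho h.1
        · exact h.2
        · exact absurd hφ (h d)
        · obtain ⟨e, h⟩ := h
          rw [← own, ho] at h; simp at h
      have hfin : ((φ = maskW ∧ C.Win (mac p)) ∨ (φ = maskL ∧ ¬ C.Win (mac p))) →
          C.Om p = some (tl p φ) := by
        intro h
        rw [Om_eq (Or.inr (Or.inr ⟨_, ho⟩)), phi_lock ho hz]
        rcases h with ⟨h1, h2⟩ | ⟨h1, h2⟩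
        · rw [if_pos h2, h1]
        · rw [if_neg h2, h1]
      obtain ⟨hc, h⟩ := hE.lock_inv
      have hsup : ∀ k, own (stp d p) = .net k → C.NT (C.Aof α) (C.Fof α) (mac p) k := fun k hk => by
        have := hI.supply_net hq hn hk
        rwa [(cr_false hc).1] at this
      rcases h with ⟨rfl, h⟩ | ⟨rfl, h⟩ | ⟨rfl, h⟩ | ⟨rfl, h⟩
      · have h3 := hsup _ h
        have hwin := hI.fw_win h3 hF
        have : φ = maskW := by
          rcases hm with h | h
          · exact h
          · rw [h] at hφ; simp [maskL] at hφ
        refine ⟨hfin (Or.inl ⟨this, hwin⟩), Or.inl ?_⟩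
        simp only [CT]; rw [if_pos hwin]; exact h3
      · have h3 := hsup _ h
        have hwin := hI.cl_lose h3 hF
        have : φ = maskL := by
          rcases hm with h | h
          · rw [h] at hφ; simp [maskW] at hφ
          · exact h
        refine ⟨hfin (Or.inr ⟨this, hwin⟩), Or.inl ?_⟩
        simp only [CT]; rw [if_neg hwin]; exact h3
      · obtain ⟨_, h4, t, h5, h6, h7⟩ := hsup _ h
        exact absurd (by rw [eq_line h4]; exact h6) hF
      · obtain ⟨_, h4, t, h5, h6⟩ := hsup _ h
        exact absurd (by rw [eq_line h4]; exact h6) hF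
    | some g =>
      obtain ⟨d, hd⟩ := hex
      have hφ' := all_nrm hv (hb d hd).1 (by rw [ho]; simp) (by rw [ho]; simp)
      have hOm : C.Om p = some (tl p φ) := by
        rw [Om_eq (Or.inr (Or.inr ⟨_, ho⟩))]
        congr 2
        rw [hφ']; funext d; exact phi_gate ho d
      refine ⟨hOm, Or.inl ?_⟩
      have hinfo : ∀ d, 0 < nb α (tl p φ) p d →
          (d = (0, false) ∧ C.NT (C.Aof α) (C.Fof α) (mac p) (sL (some g)) ∧ nb α (tl p φ) p d = 1) ∨
          (d = (0, true) ∧ C.NT (C.Aof α) (C.Fof α) (mac p) (sR (some g)) ∧ nb α (tl p φ) p d = 1) ∨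
          C.NT (C.Aof α) (C.Fof α) (mac p) (sC (some g)) := by
        intro d hd
        obtain ⟨hφ, hq, hn, hE⟩ := hb d hd
        rw [ho] at hE
        obtain ⟨hc, h⟩ := hE.gate_inv
        have hsup : ∀ k, own (stp d p) = .net k → C.NT (C.Aof α) (C.Fof α) (mac p) k := fun k hk => by
          have := hI.supply_net hq hn hk
          rwa [(cr_false hc).1] at this
        rcases h with ⟨h1, h2, h3⟩ | ⟨h1, h2, h3⟩ | ⟨h1, h2⟩
        · exact Or.inl ⟨h1, hsup _ h2, h3⟩
        · exact Or.inr (Or.inl ⟨h1, hsup _ h2, h3⟩)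
        · exact Or.inr (Or.inr (hsup _ h2))
      rcases hsum with ⟨d, h⟩ | ⟨d, d', hdd, h1, h2⟩
      · rcases hinfo d (by omega) with h' | h' | h'
        · have := h'.2.2; omega
        · have := h'.2.2; omega
        · exact Or.inr h'
      · rcases hinfo d h1 with h' | h' | h'
        · rcases hinfo d' h2 with h'' | h'' | h''
          · exact absurd (h'.1.trans h''.1.symm) hdd
          · exact Or.inl ⟨h'.2.1, h''.2.1⟩
          · exact Or.inr h''
        · rcases hinfo d' h2 with h'' | h'' | h''
          · exact Or.inl ⟨h''.2.1, h'.2.1⟩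
          · exact absurd (h'.1.trans h''.1.symm) hdd
          · exact Or.inr h''
        · exact Or.inr h'

lemma Aof_mono {β : Config 3} (h : Extends α β) : C.Aof α ⊆ C.Aof β :=
  Set.union_subset_union_right _ fun _ hx => dom_mono h hx
lemma Fof_mono {β : Config 3} (h : Extends α β) : C.Fof α ⊆ C.Fof β :=
  fun _ hx => dom_mono h hx

lemma Inv.step (hI : C.Inv α) {p : Pt 3} {t : TileType 3} (hp : α p = none) (ht : t ∈ U)
    (hw : 2 ≤ wsum α p t) : C.Inv (Function.update α p (some t)) := by
  obtain ⟨hOm, hcase⟩ := hI.step_cases hp ht hw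
  have hE := extends_update hp t
  have hA := Aof_mono (C := C) hE
  have hF := Fof_mono (C := C) hE
  have hAsub : ∀ x ∈ C.Aof (Function.update α p (some t)), x ∈ C.Aof α ∨ p = C.rho0 x := by
    intro x hx
    rcases hx with hx | hx
    · exact Or.inl (Or.inl hx)
    · by_cases h : C.rho0 x = p
      · exact Or.inr h.symm
      · left; right
        change Function.update α p (some t) (C.rho0 x) ≠ none at hx
        rwa [Function.update_of_ne h] at hx
  have hext : Extends (Function.update α p (some t)) C.Om := by
    intro q s hq
    by_cases h : q = p
    · subst h; simp at hq; rw [← hq]; exact hOm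
    · rw [Function.update_of_ne h] at hq; exact hI.ext q s hq
  have hzed : ∀ q ∈ C.Z, Function.update α p (some t) q ≠ none :=
    fun q hq => dom_mono hE (hI.zed q hq)
  have hct : C.CT (C.Aof (Function.update α p (some t))) (C.Fof (Function.update α p (some t)))
      (mac p) (own p) →
      ∀ q, Function.update α p (some t) q ≠ none → q ∉ C.Z →
      C.CT (C.Aof (Function.update α p (some t))) (C.Fof (Function.update α p (some t)))
      (mac q) (own q) := by
    intro h0 q hq hz
    by_cases h : q = p
    · subst h; exact h0
    · rw [Function.update_of_ne h] at hq
      exact (hI.ct q hq hz).mono hA hF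
  rcases hcase with hc | ⟨x, rfl, hx, hpa, hfl⟩
  · have hAA : C.Aof (Function.update α p (some t)) = C.Aof α := by
      apply Set.Subset.antisymm _ hA
      intro x hx
      rcases hAsub x hx with h | rfl
      · exact h
      · rw [own_rho0] at hc
        have h3 := hc.2.2.2
        rwa [blk_rho0] at h3
    refine ⟨hext, hzed, hct (hc.mono hA hF), by rw [hAA]; exact hI.pa, fun x hx i h0 h1 => hF ?_⟩
    rw [hAA] at hx
    exact hI.fl x hx i h0 h1
  · have hAA : C.Aof (Function.update α (C.rho0 x) (some t)) = insert x (C.Aof α) := by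
      apply Set.Subset.antisymm
      · intro y hy
        rcases hAsub y hy with h | h
        · exact Or.inr h
        · exact Or.inl (rho0_inj h).symm
      · intro y hy
        rcases hy with rfl | hy
        · right; change Function.update α _ (some t) _ ≠ none; simp
        · exact hA hy
    have hn := C.n_ge
    have hxA : x ∈ C.Aof (Function.update α (C.rho0 x) (some t)) := by rw [hAA]; exact Or.inl rfl
    refine ⟨hext, hzed, hct ?_, by rw [hAA]; exact hpa, fun y hy i h0 h1 => hF ?_⟩
    · rw [own_rho0, mac_rho0]
      refine ⟨Or.inl ?_, ?_⟩
      · rw [blk_line (by omega) (by omega)]; exact hxA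
      · rw [blk_line (by omega) (by omega), loc_line (by omega) (by omega)]
        exact ⟨⟨rfl, rfl⟩, rfl, hxA⟩
    · rw [hAA] at hy
      rcases hy with rfl | hy
      · exact hfl i h0 h1
      · exact hI.fl y hy i h0 h1

end inv

lemma Inv.limit {f : ℕ → Config 3} {β : Config 3} (hf : ∀ n, Extends (f n) (f (n+1)))
    (hI : ∀ n, C.Inv (f n)) (hl : Limit f β) : C.Inv β := by
  have hE := fun n => limit_extends hl n
  have hne : ∀ q, β q ≠ none → ∃ n, f n q ≠ none := by
    intro q hq
    obtain ⟨t, ht⟩ := Option.ne_none_iff_exists'.1 hq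
    obtain ⟨n, hn⟩ := (hl q t).1 ht
    exact ⟨n, by rw [hn]; simp⟩
  have hA : C.Aof β = ⋃ n, C.Aof (f n) := by
    apply Set.Subset.antisymm
    · intro x hx
      rw [Set.mem_iUnion]
      rcases hx with hx | hx
      · exact ⟨0, Or.inl hx⟩
      · obtain ⟨n, hn⟩ := hne _ hx; exact ⟨n, Or.inr hn⟩
    · exact Set.iUnion_subset fun n => Aof_mono (hE n)
  refine ⟨?_, fun p hp => dom_mono (hE 0) ((hI 0).zed p hp), ?_, ?_, ?_⟩
  · intro p t hp
    obtain ⟨n, hn⟩ := (hl p t).1 hp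
    exact (hI n).ext p t hn
  · intro p hp hz
    obtain ⟨n, hn⟩ := hne p hp
    exact ((hI n).ct p hn hz).mono (Aof_mono (hE n)) (Fof_mono (hE n))
  · rw [hA]; exact PA.limit fun n => (hI n).pa
  · intro x hx i h0 h1
    rw [hA, Set.mem_iUnion] at hx
    obtain ⟨n, hn⟩ := hx
    exact Fof_mono (hE n) ((hI n).fl x hn i h0 h1)

/-- The seed assembly of the simulator. -/
def sd (C : Ctx) : Config 3 := fun p => if p ∈ C.Z then some (tl p (C.phi p)) else none

lemma Inv.seed : C.Inv C.sd := by
  have hne : ∀ p, C.sd p ≠ none ↔ p ∈ C.Z := by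
    intro p; unfold sd; split_ifs with h <;> simp [h]
  have hA : C.Aof C.sd = dom C.T.seed := by
    apply Set.Subset.antisymm _ Set.subset_union_left
    intro x hx
    rcases hx with hx | hx
    · exact hx
    · have := (hne _).1 hx
      exact absurd this (notZ_net (own_rho0 x) (by simp))
  refine ⟨?_, fun p hp => (hne p).2 hp, fun p hp hz => absurd ((hne p).1 hp) hz, ?_, ?_⟩
  · intro p t hp
    unfold sd at hp
    split_ifs at hp with h
    rw [← hp]; exact Om_eq (Or.inl h)
  · rw [hA]; exact PA_seed
  · intro x hx i h0 h1
    rw [hA] at hx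
    refine (hne _).2 ⟨?_, ?_⟩
    · rw [mac_gp _ (spos_box _), blk_line h0 h1]; exact hx
    · rw [lo_gp _ (spos_box _)]; exact Z0_lock

end Ctx
end IU

namespace IU

/-! ## Part I: completeness of the simulator -/

namespace Ctx
variable {C : Ctx}

/-- No attachment is possible, except at the resolution cells outside `B`. -/
structure Mx (C : Ctx) (α : Config 3) (B : Set (Pt 3)) : Prop where
  inv : C.Inv α
  mx : ∀ p t, α p = none → C.Om p = some t → 2 ≤ wsum α p t → ∃ x, x ∉ B ∧ p = C.rho0 x

section mx
variable {α : Config 3} {B : Set (Pt 3)}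

/-- A bond from a filled neighbour. -/
lemma nb_Ew (hM : C.Mx α B) {p : Pt 3} {d : Dir} {w : ℕ} (hq : α (stp d p) ≠ none) (h1 : C.phi p d = .nrm)
    (h2 : C.phi (stp d p) (opp d) = .nrm) (hE : EC (cr p d) d (own p) (own (stp d p)) w) :
    w ≤ nb α (tl p (C.phi p)) p d := by
  unfold nb
  rw [hM.inv.val hq]
  simp only
  rw [bond_nrm h1 h2]
  exact le_Ew hE

lemma Mx.fill (hM : C.Mx α B) {p : Pt 3} (hr : C.Reg p) (hw : 2 ≤ wsum α p (tl p (C.phi p)))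
    (hno : ∀ x, p = C.rho0 x → x ∈ B) : α p ≠ none := by
  intro h0
  obtain ⟨x, hx, e⟩ := hM.mx p _ h0 (Om_eq hr) hw
  exact hx (hno x e)

lemma Mx.fill1 (hM : C.Mx α B) {p : Pt 3} (hr : C.Reg p) (hno : ∀ x, p = C.rho0 x → x ∈ B)
    (d : Dir) (hq : α (stp d p) ≠ none) (h1 : C.phi p d = .nrm)
    (h2 : C.phi (stp d p) (opp d) = .nrm) (hE : EC (cr p d) d (own p) (own (stp d p)) 2) :
    α p ≠ none := by
  refine hM.fill hr ?_ hno
  exact (nb_Ew hM hq h1 h2 hE).trans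
    (Finset.single_le_sum (f := fun d => nb α (tl p (C.phi p)) p d) (fun _ _ => Nat.zero_le _)
      (Finset.mem_univ d))

lemma notrho {p : Pt 3} (h : own p ≠ .net (.sa .rho)) : ∀ x, p = C.rho0 x → x ∈ B := by
  rintro x rfl
  exact absurd (own_rho0 x) h

/-- The net `k` is filled in the big cell `P`. -/
def FN (α : Config 3) (k : Net) (P : Pt 3) : Prop :=
  ∀ u, Box u → own0 u = .net k → α (gp P u) ≠ none

lemma Mx.net_of (hM : C.Mx α B) {k : Net} (hk : ∀ e, k ≠ .boot e) {P u : Pt 3} (hu : Box u)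
    (ho : own0 u = .net k) (hf : α (gp P u) ≠ none)
    (hno : ∀ v, Box v → own0 v = .net k → ∀ x, gp P v = C.rho0 x → x ∈ B ∨ α (gp P v) ≠ none) :
    FN α k P := by
  intro v hv ho'
  have hc := net_conn hk hu ho hv ho'
  clear hv ho'
  induction hc with
  | refl => exact hf
  | tail _ hs ih =>
    rename_i a b _
    have hs' := hs.symm
    obtain ⟨⟨d, hd⟩, ⟨h1, h2⟩, h3, h4⟩ := hs'
    by_contra h0
    have e : stp d (gp P b) = gp P a := by rw [stp_gp, hd]
    have ob : own (gp P b) = .net k := by rw [own_gp P h1, h2]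
    have oa : own (gp P a) = .net k := by rw [own_gp P h3, h4]
    refine h0 |> hM.fill1 (Or.inr (Or.inl ⟨k, ob, hk⟩)) ?_ d (by rw [e]; exact ih)
      (phi_net ob hk d) (by rw [e]; exact phi_net oa hk _) ?_
    · intro x hx
      exact (hno b h1 h2 x hx).resolve_right fun h => h h0
    · rw [e, ob, oa, cr_gp h1 (by rw [← hd]; exact h3)]
      exact .net d k hk

lemma Mx.net_fill (hM : C.Mx α B) {k : Net} (hk : ∀ e, k ≠ .boot e) (hr : k ≠ .sa .rho)
    {P u : Pt 3} (hu : Box u) (ho : own0 u = .net k) (hf : α (gp P u) ≠ none) : FN α k P := by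
  refine hM.net_of hk hu ho hf fun v hv h x hx => Or.inl ?_
  refine notrho ?_ x hx
  rw [own_gp P hv, h]; simpa using hr

lemma stp_spos_lem (P : Pt 3) (s : Stn) (d : Dir) : stp d (gp P (spos s)) = gp P (stp d (spos s)) :=
  stp_gp d P _

lemma own_st (P : Pt 3) (s : Stn) : own (gp P (spos s)) = .st s := by
  rw [own_gp P (spos_box s), own0_spos]
lemma own_sL (P : Pt 3) (s : Stn) : own (stp (0, false) (gp P (spos s))) = .net (sL s) := by
  rw [stp_gp, own_gp P (spos_in s (by simp)), own0_L]
lemma own_sR (P : Pt 3) (s : Stn) : own (stp (0, true) (gp P (spos s))) = .net (sR s) := by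
  rw [stp_gp, own_gp P (spos_in s (by simp)), own0_R]
lemma own_sC (P : Pt 3) (s : Stn) : own (stp (1, false) (gp P (spos s))) = .net (sC s) := by
  rw [stp_gp, own_gp P (spos_in s (by simp)), own0_C]
lemma own_sD (P : Pt 3) (s : Stn) : own (stp (2, false) (gp P (spos s))) = .net (.sa .oF) := by
  rw [stp_gp, own_gp P (spos_in s (by simp)), own0_D]
lemma cr_st (P : Pt 3) (s : Stn) {d : Dir} (hd : d = (0, false) ∨ d = (0, true) ∨ d = (1, false) ∨
    d = (2, false)) : cr (gp P (spos s)) d = false := cr_gp (spos_box s) (spos_in s (by tauto))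

/-- A gate fires. -/
lemma Mx.gate (hM : C.Mx α B) (P : Pt 3) (g : Gate)
    (hL : α (stp (0, false) (gp P (spos (some g)))) ≠ none)
    (hL' : C.phi (stp (0, false) (gp P (spos (some g)))) (0, true) = .nrm)
    (hR : α (stp (0, true) (gp P (spos (some g)))) ≠ none)
    (hR' : C.phi (stp (0, true) (gp P (spos (some g)))) (0, false) = .nrm)
    (hno : ∀ x, stp (1, false) (gp P (spos (some g))) = C.rho0 x → x ∈ B) :
    α (stp (1, false) (gp P (spos (some g)))) ≠ none := by
  set p := gp P (spos (some g)) with hp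
  have ho : own p = .st (some g) := own_st P _
  have hg : α p ≠ none := by
    refine hM.fill (Or.inr (Or.inr ⟨_, ho⟩)) ?_ (notrho (by rw [ho]; simp))
    have b1 : 1 ≤ nb α (tl p (C.phi p)) p (0, false) := by
      refine nb_Ew hM hL (phi_gate ho _) hL' ?_
      rw [cr_st P _ (by simp), ho, own_sL]; exact .gL g
    have b2 : 1 ≤ nb α (tl p (C.phi p)) p (0, true) := by
      refine nb_Ew hM hR (phi_gate ho _) hR' ?_
      rw [cr_st P _ (by simp), ho, own_sR]; exact .gR g
    have := Finset.sum_le_sum_of_subset (f := fun d => nb α (tl p (C.phi p)) p d)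
      (Finset.subset_univ ({(0, false), (0, true)} : Finset Dir))
    rw [Finset.sum_pair (by simp)] at this
    unfold wsum
    omega
  have oC := own_sC P (some g)
  have hk := (sC_ne (some g)).2
  have e : stp (1, true) (stp (1, false) p) = p := stp_opp_stp (1, false) p
  refine hM.fill1 (Or.inr (Or.inl ⟨_, oC, hk⟩)) hno (1, true) (by rw [e]; exact hg) (phi_net oC hk _)
    (by rw [e]; exact phi_gate ho _) ?_
  have hcr : cr (stp (1, false) p) (1, true) = false := by
    have := cr_opp p (1, false)
    exact this.trans (cr_st P _ (by simp))
  rw [e, ho, oC, hcr]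
  exact .gC' g

lemma Mx.gate_net (hM : C.Mx α B) (P : Pt 3) (g : Gate)
    (hL : FN α (sL (some g)) P) (hR : FN α (sR (some g)) P)
    (hLb : ∀ e, sL (some g) ≠ .boot e) (hRb : ∀ e, sR (some g) ≠ .boot e)
    (hr : sC (some g) ≠ .sa .rho) : FN α (sC (some g)) P := by
  have hC := own0_C (some g)
  refine hM.net_fill (sC_ne _).2 hr (spos_in _ (by simp)) hC ?_
  rw [← stp_gp]
  refine hM.gate P g ?_ (phi_net (own_sL P _) hLb _) ?_ (phi_net (own_sR P _) hRb _) ?_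
  · rw [stp_gp]; exact hL _ (spos_in _ (by simp)) (own0_L _)
  · rw [stp_gp]; exact hR _ (spos_in _ (by simp)) (own0_R _)
  · refine notrho ?_
    rw [own_sC]; simpa using hr

lemma snd_ne (d : Dir) (e : Atom) : (∀ e', snd d e ≠ .boot e') ∧ snd d e ≠ .sa .rho := by
  unfold snd; split_ifs <;> simp
lemma rcv_ne (d : Dir) (e : Atom) : (∀ e', rcv d e ≠ .boot e') ∧ rcv d e ≠ .sa .rho := by
  unfold rcv; split_ifs <;> simp

lemma gp_cross (P : Pt 3) {u : Pt 3} {i : Fin 3} (h : u i = mside - 1) :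
    gp (stp (i, true) P) (Function.update u i 0) = stp (i, true) (gp P u) := by
  funext j
  by_cases hj : j = i
  · subst hj
    simp [gp, stp_apply, sg, h]; ring
  · simp [gp, stp_apply, hj]

lemma Mx.send (hM : C.Mx α B) {P : Pt 3} {d : Dir} {e : Atom} (h : FN α (snd d e) P) :
    FN α (rcv d e) (stp d P) := by
  obtain ⟨i, b⟩ := d
  obtain ⟨u, hu, hi, h1, h2⟩ := wire_cross ((i, b), e)
  simp only at hi h2
  have hm := mside_pos
  have hu' : Box (Function.update u i 0) := box_upd hu le_rfl hm
  have hcr : ∀ Q, cr (gp Q u) (i, true) = true := by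
    intro Q
    unfold cr
    rw [← gp_cross Q hi, mac_gp _ hu', mac_gp _ hu]
    simp [stp_ne_self]
  cases b
  · have hs : snd (i, false) e = .wB ((i, false), e) := rfl
    have hr : rcv (i, false) e = .wA ((i, false), e) := rfl
    rw [hs] at h; rw [hr]
    refine hM.net_fill (by simp) (by simp) hu h1 ?_
    have oc := own_gp (stp (i, false) P) hu
    rw [h1] at oc
    have e1 : stp (i, true) (gp (stp (i, false) P) u) = gp P (Function.update u i 0) := by
      rw [← gp_cross _ hi]; congr 1; exact stp_opp_stp (i, false) P
    have od := own_gp P hu'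
    rw [h2] at od
    refine hM.fill1 (Or.inr (Or.inl ⟨_, oc, by simp⟩)) (notrho (by rw [oc]; simp)) (i, true)
      (by rw [e1]; exact h _ hu' h2) (phi_net oc (by simp) _)
      (by rw [e1]; exact phi_net od (by simp) _) ?_
    rw [hcr, e1, oc, od]
    exact .wU ((i, false), e)
  · have hs : snd (i, true) e = .wA ((i, true), e) := rfl
    have hr : rcv (i, true) e = .wB ((i, true), e) := rfl
    rw [hs] at h; rw [hr]
    refine hM.net_fill (by simp) (by simp) hu' h2 ?_
    have oc := own_gp (stp (i, true) P) hu'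
    rw [h2] at oc
    rw [gp_cross P hi] at oc ⊢
    have e1 : stp (i, false) (stp (i, true) (gp P u)) = gp P u := stp_opp_stp (i, true) _
    have od := own_gp P hu
    rw [h1] at od
    refine hM.fill1 (Or.inr (Or.inl ⟨_, oc, by simp⟩)) (notrho (by rw [oc]; simp)) (i, false)
      (by rw [e1]; exact h _ hu h1) (phi_net oc (by simp) _)
      (by rw [e1]; exact phi_net od (by simp) _) ?_
    have hc2 : cr (stp (i, true) (gp P u)) (i, false) = true := by
      exact (cr_opp (gp P u) (i, true)).trans (hcr P)
    rw [hc2, e1, oc, od]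
    exact .wD ((i, true), e)

lemma Mx.rule (hM : C.Mx α B) {a b e : Atom} {o : Option Dir} {P : Pt 3} (hr : Rl a b o e)
    (he : e ≠ .rho) (ha : FN α (.sa a) P) (hb : FN α (.sa b) P) : FN α (.sa e) (tgt o P) := by
  cases o with
  | none =>
    exact hM.gate_net P ⟨(.sa a, .sa b, .sa e), .stay hr⟩ ha hb (by simp [sL]) (by simp [sR])
      (by simpa [sC] using he)
  | some d =>
    have h1 : FN α (snd d e) P :=
      hM.gate_net P ⟨(.sa a, .sa b, snd d e), .send hr⟩ ha hb (by simp [sL]) (by simp [sR])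
        (snd_ne d e).2
    have h2 := hM.send h1
    exact hM.gate_net (stp d P) ⟨(rcv d e, rcv d e, .sa e), .recv d e he (rl_ne_oF hr)⟩ h2 h2
      (rcv_ne d e).1 (rcv_ne d e).1 (by simpa [sC] using he)

lemma phi_tip {e : Atom} {d : Dir} {q : Pt 3} (hq : q ∈ C.Z) (ho : own q = .net (.boot e))
    (ht : C.Tr (dom C.T.seed) ∅ (mac q) e) (hd : stp d q ∉ C.Z) : C.phi q d = .nrm := by
  unfold phi
  rw [if_pos hq, if_neg hd, if_pos ⟨e, ho, ht⟩]

lemma Mx.boot (hM : C.Mx α B) {P : Pt 3} {e : Atom} (hP : C.blk P ∈ dom C.T.seed)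
    (ht : C.Tr (dom C.T.seed) ∅ P e) (he : e ≠ .rho) : FN α (.sa e) P := by
  have heF : e ≠ .oF := by
    rintro rfl
    obtain ⟨_, _, t, _, h⟩ := ht
    exact h
  let g : Gate := ⟨(.boot e, .boot e, .sa e), .boot e he heF⟩
  have hgz : gp P (spos (some g)) ∉ C.Z := notZ_gate (own_st P (some g))
  have tip : ∀ b : Bool, own0 (stp (0, b) (spos (some g))) = .net (.boot e) →
      stp (0, b) (gp P (spos (some g))) ∈ C.Z ∧
      C.phi (stp (0, b) (gp P (spos (some g)))) (0, !b) = .nrm := by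
    intro b hb
    have hbox : Box (stp (0, b) (spos (some g))) := spos_in _ (by cases b <;> simp)
    have hm : mac (stp (0, b) (gp P (spos (some g)))) = P := by rw [stp_gp, mac_gp P hbox]
    have hz : stp (0, b) (gp P (spos (some g))) ∈ C.Z := by
      refine ⟨by rw [hm]; exact hP, ?_⟩
      rw [stp_gp, lo_gp P hbox]
      exact Z0_tip hbox hb (by simp [spos, stp_apply]) (by simp [spos, stp_apply])
    refine ⟨hz, phi_tip (e := e) hz ?_ (by rw [hm]; exact ht) ?_⟩
    · rw [stp_gp, own_gp P hbox]; exact hb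
    · have : stp (0, !b) (stp (0, b) (gp P (spos (some g)))) = gp P (spos (some g)) :=
        stp_opp_stp (0, b) _
      rw [this]; exact hgz
  obtain ⟨l1, l2⟩ := tip false (own0_L (some g))
  obtain ⟨r1, r2⟩ := tip true (own0_R (some g))
  have hr : sC (some g) ≠ .sa .rho := by simpa [sC, g] using he
  refine hM.net_fill (k := sC (some g)) (sC_ne _).2 hr (spos_in _ (by simp)) (own0_C (some g)) ?_
  rw [← stp_gp]
  refine hM.gate P g (hM.inv.zed _ l1) l2 (hM.inv.zed _ r1) r2 (notrho ?_)
  rw [own_sC]; simpa using hr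

lemma lock_Z {P : Pt 3} : gp P (spos none) ∈ C.Z ↔ C.blk P ∈ dom C.T.seed := by
  constructor
  · intro h; have := h.1; rwa [mac_gp _ (spos_box _)] at this
  · intro h
    refine ⟨by rwa [mac_gp _ (spos_box _)], ?_⟩
    rw [lo_gp _ (spos_box _)]; exact Z0_lock

lemma Mx.lockF (hM : C.Mx α B) {P : Pt 3} (h : FN α (.sa .fw) P ∨ FN α (.sa .cl) P) :
    P ∈ C.Fof α := by
  by_contra hF
  have hz : gp P (spos none) ∉ C.Z := fun hz => hF (hM.inv.zed _ hz)
  have ho := own_st P none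
  have hm : mac (gp P (spos none)) = P := mac_gp P (spos_box _)
  have hph := phi_lock ho hz
  rw [hm] at hph
  have tr : ∀ k, (∀ e, k ≠ .boot e) → ∀ d, (d = (0, false) ∨ d = (0, true) ∨ d = (1, false) ∨
    d = (2, false)) → own (stp d (gp P (spos none))) = .net k →
      α (stp d (gp P (spos none))) ≠ none → C.NT (C.Aof α) (C.Fof α) P k := by
    intro k hk d hd hown hne
    have := hM.inv.ct _ hne (notZ_net hown hk)
    rw [hown] at this
    rw [stp_gp, mac_gp P (spos_in _ (by tauto))] at this
    exact this
  rcases h with h | h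
  · have hne : α (stp (0, false) (gp P (spos none))) ≠ none := by
      rw [stp_gp]; exact h _ (spos_in _ (by simp)) (own0_L none)
    have hw := hM.inv.fw_win (tr (.sa .fw) (by simp) _ (by simp) (own_sL P none) hne) hF
    rw [if_pos hw] at hph
    refine hF (hM.fill1 (Or.inr (Or.inr ⟨_, ho⟩)) (notrho (by rw [ho]; simp)) (0, false) hne
      (by rw [hph]; simp [maskW]) (phi_net (own_sL P none) (by simp [sL]) _) ?_)
    rw [cr_st P _ (by simp), ho, own_sL]; exact .lF
  · have hne : α (stp (0, true) (gp P (spos none))) ≠ none := by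
      rw [stp_gp]; exact h _ (spos_in _ (by simp)) (own0_R none)
    have hw := hM.inv.cl_lose (tr (.sa .cl) (by simp) _ (by simp) (own_sR P none) hne) hF
    rw [if_neg hw] at hph
    refine hF (hM.fill1 (Or.inr (Or.inr ⟨_, ho⟩)) (notrho (by rw [ho]; simp)) (0, true) hne
      (by rw [hph]; simp [maskL]) (phi_net (own_sR P none) (by simp [sR]) _) ?_)
    rw [cr_st P _ (by simp), ho, own_sR]; exact .lC

lemma Mx.lockO (hM : C.Mx α B) {P : Pt 3} (hF : P ∈ C.Fof α) (hs : C.blk P ∉ dom C.T.seed) :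
    FN α (.sa .oF) P := by
  have hz : gp P (spos none) ∉ C.Z := fun hz => hs (lock_Z.1 hz)
  have ho := own_st P none
  have hph := phi_lock ho hz
  have oC := own_sD P none
  refine hM.net_fill (by simp) (by simp) (spos_in none (by simp)) (own0_D none) ?_
  rw [← stp_gp]
  have e : stp (2, true) (stp (2, false) (gp P (spos none))) = gp P (spos none) :=
    stp_opp_stp (2, false) _
  refine hM.fill1 (Or.inr (Or.inl ⟨_, oC, by simp⟩)) (notrho (by rw [oC]; simp)) (2, true)
    (by rw [e]; exact hF) (phi_net oC (by simp) _)
    (by rw [e, hph]; split_ifs <;> simp [maskW, maskL, opp]) ?_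
  have hcr : cr (stp (2, false) (gp P (spos none))) (2, true) = false :=
    (cr_opp (gp P (spos none)) (2, false)).trans (cr_st P _ (by simp))
  rw [e, ho, oC, hcr]
  exact .lO'

lemma Mx.lockW (hM : C.Mx α B) {P : Pt 3} (hF : P ∈ C.Fof α) (hs : C.blk P ∉ dom C.T.seed)
    (hw : C.Win P) : FN α (.sa .ow) P := by
  have hz : gp P (spos none) ∉ C.Z := fun hz => hs (lock_Z.1 hz)
  have ho := own_st P none
  have hph := phi_lock ho hz
  rw [mac_gp P (spos_box _), if_pos hw] at hph
  have oC := own_sC P none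
  refine hM.net_fill (by simp) (by simp) (spos_in none (by simp)) (own0_C none) ?_
  rw [← stp_gp]
  have e : stp (1, true) (stp (1, false) (gp P (spos none))) = gp P (spos none) :=
    stp_opp_stp (1, false) _
  refine hM.fill1 (Or.inr (Or.inl ⟨_, oC, by simp [sC]⟩)) (notrho (by rw [oC]; simp [sC])) (1, true)
    (by rw [e]; exact hF) (phi_net oC (by simp [sC]) _)
    (by rw [e, hph]; simp [maskW, opp]) ?_
  have hcr : cr (stp (1, false) (gp P (spos none))) (1, true) = false :=
    (cr_opp (gp P (spos none)) (1, false)).trans (cr_st P _ (by simp))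
  rw [e, ho, oC, hcr]
  exact .lW'

lemma Mx.res (hM : C.Mx α B) {x : Pt 3} (h : FN α (.sa .rz) (C.line x (C.n - 1))) (hx : x ∈ B) :
    x ∈ C.Aof α := by
  right
  change α (C.rho0 x) ≠ none
  have e : C.rho0 x = stp (1, false) (gp (C.line x (C.n - 1)) (spos (some rhoG))) := by
    rw [stp_gp]; rfl
  rw [e]
  refine hM.gate _ rhoG ?_ (phi_net (own_sL _ _) (by simp [sL, rhoG]) _) ?_
    (phi_net (own_sR _ _) (by simp [sR, rhoG]) _) ?_
  · rw [stp_gp]; exact h _ (spos_in _ (by simp)) (own0_L _)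
  · rw [stp_gp]; exact h _ (spos_in _ (by simp)) (own0_R _)
  · intro y hy
    rw [← e] at hy
    rw [← rho0_inj hy]; exact hx

lemma Mx.rho (hM : C.Mx α B) {x : Pt 3} (h : x ∈ C.Aof α) (hs : x ∉ dom C.T.seed) :
    FN α (.sa .rho) (C.line x (C.n - 1)) := by
  have h' : α (C.rho0 x) ≠ none := h.resolve_left hs
  refine hM.net_of (by simp) rhoLo_box rhoLo_own h' fun v hv _ y hy => Or.inr ?_
  have e : y = x := by
    have h1 := congrArg mac hy
    rw [mac_gp _ hv, mac_rho0] at h1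
    have h2 := congrArg C.blk h1
    have := C.n_ge
    rw [blk_line (by omega) (by omega), blk_line (by omega) (by omega)] at h2
    exact h2.symm
  rw [hy, e]; exact h'

lemma Mx.closed (hM : C.Mx α B) :
    C.Closed (C.Aof α) B (C.Fof α) (fun P e => FN α (.sa e) P) where
  rule hr he ha hb := hM.rule hr he ha hb
  lockF h := hM.lockF h
  lockO h h' := hM.lockO h h'
  lockW h h' h1 h2 := hM.lockW h h' ⟨_, h1, h2⟩
  res h h' := hM.res h h'
  rho h h' := hM.rho h h'
  boot h h' he := hM.boot h h' he

theorem Mx.complete (hM : C.Mx α B) (hB : C.PA B) : B ⊆ C.Aof α :=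
  hM.closed.complete hB hM.inv.seed_sub

end mx
end Ctx
end IU

namespace IU

/-! ## Part J: the seed of the simulator -/

namespace Ctx
variable {C : Ctx}

/-- One step inside the seed region. -/
def ZS (C : Ctx) (a b : Pt 3) : Prop := (∃ d, b = stp d a) ∧ a ∈ C.Z ∧ b ∈ C.Z

lemma ZS.symm {a b : Pt 3} (h : C.ZS a b) : C.ZS b a := by
  obtain ⟨⟨d, rfl⟩, h1, h2⟩ := h
  exact ⟨⟨opp d, (stp_opp_stp d a).symm⟩, h2, h1⟩

abbrev ZC (C : Ctx) := Relation.ReflTransGen C.ZS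

lemma ZC.symm {u v : Pt 3} (h : C.ZC u v) : C.ZC v u := by
  induction h with
  | refl => exact .refl
  | tail _ h ih => exact Relation.ReflTransGen.head h.symm ih

lemma mem_Z_gp {P u : Pt 3} (hP : C.blk P ∈ dom C.T.seed) (h : Z0 u) : gp P u ∈ C.Z :=
  ⟨by rwa [mac_gp _ h.1], by rwa [lo_gp _ h.1]⟩

lemma zc_seg {P : Pt 3} (hP : C.blk P ∈ dom C.T.seed) (u : Pt 3) (i : Fin 3) {a b : ℤ} (hab : a ≤ b)
    (h : ∀ w, a ≤ w → w ≤ b → Z0 (Function.update u i w)) :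
    C.ZC (gp P (Function.update u i a)) (gp P (Function.update u i b)) := by
  have key : ∀ m : ℕ, a + m ≤ b →
      C.ZC (gp P (Function.update u i a)) (gp P (Function.update u i (a + m))) := by
    intro m
    induction m with
    | zero => intro _; simp; exact Relation.ReflTransGen.refl
    | succ m ih =>
      intro hm
      push_cast at hm ⊢
      refine (ih (by omega)).tail ⟨⟨(i, true), ?_⟩, mem_Z_gp hP (h _ (by omega) (by omega)),
        mem_Z_gp hP (h _ (by omega) (by omega))⟩
      rw [stp_gp]
      simp [stp, sg, add_assoc]
  have := key (b - a).toNat (by omega)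
  rwa [show a + ((b - a).toNat : ℤ) = b by omega] at this

lemma Z0_axis {i : Fin 3} {w : ℤ} (h0 : 0 ≤ w) (h1 : w < mside) : Z0 (Function.update hub i w) :=
  ⟨box_upd hub_box h0 h1, Or.inl ⟨i, fun j hj => by simp [hj]⟩⟩

lemma zc_axis {P : Pt 3} (hP : C.blk P ∈ dom C.T.seed) (i : Fin 3) {w : ℤ} (h0 : 0 ≤ w) (h1 : w < mside) :
    C.ZC (gp P (Function.update hub i w)) (gp P hub) := by
  have hb := hub_box i
  have e : gp P hub = gp P (Function.update hub i (hub i)) := by simp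
  rw [e]
  rcases le_total w (hub i) with h | h
  · exact zc_seg hP hub i h fun v hv hv' => Z0_axis (by omega) (by omega)
  · exact (zc_seg hP hub i h fun v hv hv' => Z0_axis (by omega) (by omega)).symm

lemma zc_hub {P u : Pt 3} (hP : C.blk P ∈ dom C.T.seed) (h : Z0 u) : C.ZC (gp P u) (gp P hub) := by
  have hK := K_lt; have hK0 := K_pos
  obtain ⟨hb, ⟨i, hi⟩ | ⟨h2, h1, hT⟩⟩ := h
  · have e : u = Function.update hub i (u i) := by
      funext j
      by_cases hj : j = i
      · subst hj; simp
      · simp [hj, hi j hj]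
    rw [e]
    exact zc_axis hP i (hb i).1 (hb i).2
  · have b0 := hb 0
    have s1 : C.ZC (gp P ![u 0, u 1, 1]) (gp P ![u 0, K + 1, 1]) := by
      have := zc_seg hP ![u 0, 0, 1] 1 (a := u 1) (b := K + 1) (by omega) (fun w hw hw' => by
        refine ⟨?_, Or.inr ⟨by simp, by simp; omega, by simpa using hT⟩⟩
        intro i; fin_cases i <;> simp <;> omega)
      convert this using 2 <;> (funext i; fin_cases i <;> simp)
    have s2 : C.ZC (gp P ![u 0, K + 1, 1]) (gp P ![u 0, K + 1, 2]) := by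
      have := zc_seg hP ![u 0, K + 1, 0] 2 (a := 1) (b := 2) (by omega) (fun w hw hw' => by
        have hB : Box (Function.update ![u 0, K + 1, 0] 2 w) := by
          intro i; fin_cases i <;> simp <;> omega
        have hw3 : w = 1 ∨ w = 2 := by omega
        rcases hw3 with rfl | rfl
        · exact ⟨hB, Or.inr ⟨by simp, by simp, by simpa using hT⟩⟩
        · refine ⟨hB, Or.inl ⟨0, fun j hj => ?_⟩⟩
          fin_cases j <;> simp [hub] at hj ⊢)
      convert this using 2 <;> (funext i; fin_cases i <;> simp)
    have s3 := zc_axis hP 0 b0.1 b0.2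
    have e3 : Function.update hub 0 (u 0) = ![u 0, K + 1, 2] := by
      funext i; fin_cases i <;> simp [hub]
    rw [e3] at s3
    rw [pt_eta u rfl rfl h2]
    exact s1.trans (s2.trans s3)

lemma Z0_hub : Z0 hub := ⟨hub_box, Or.inl ⟨0, fun _ _ => rfl⟩⟩

lemma zc_cross {P : Pt 3} {i : Fin 3} (hP : C.blk P ∈ dom C.T.seed)
    (hP' : C.blk (stp (i, true) P) ∈ dom C.T.seed) : C.ZC (gp P hub) (gp (stp (i, true) P) hub) := by
  have hm := mside_pos
  refine (zc_axis hP i (w := mside - 1) (by omega) (by omega)).symm.trans ?_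
  have h2 := zc_axis hP' i (w := 0) (by omega) (by omega)
  refine Relation.ReflTransGen.head ⟨⟨(i, true), ?_⟩, mem_Z_gp hP (Z0_axis (by omega) (by omega)),
    mem_Z_gp hP' (Z0_axis (by omega) (by omega))⟩ h2
  rw [← gp_cross P (by simp)]
  simp

lemma zc_cross' {P : Pt 3} {i : Fin 3} (hP : C.blk P ∈ dom C.T.seed)
    (hP' : C.blk (stp (i, false) P) ∈ dom C.T.seed) : C.ZC (gp P hub) (gp (stp (i, false) P) hub) := by
  have e : stp (i, true) (stp (i, false) P) = P := stp_opp_stp (i, false) P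
  have := zc_cross (C := C) (i := i) hP' (by rwa [e])
  rw [e] at this
  exact this.symm

lemma zero_inBox : C.InBox 0 := fun _ => ⟨le_rfl, C.n_pos⟩

lemma zc_block_step {x : Pt 3} (hx : x ∈ dom C.T.seed) (b : Fin 3) {u : Pt 3} (hu : C.InBox u)
    (hQ : C.ZC (gp (C.mc x 0) hub) (gp (C.mc x u) hub)) {v : ℤ} (h0 : 0 ≤ v) (h1 : v < C.n) :
    C.ZC (gp (C.mc x 0) hub) (gp (C.mc x (Function.update u b v)) hub) := by
  refine box_fill (C := C) (fun u => C.ZC (gp (C.mc x 0) hub) (gp (C.mc x u) hub)) b ?_ ?_ hu hQ h0 h1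
  · intro u hu hq hb
    refine hq.trans ?_
    have hu' := inBox_stp_up hu hb
    rw [← stp_mk]
    exact zc_cross (by rwa [blk_mk hu]) (by rwa [stp_mk, blk_mk hu'])
  · intro u hu hq hb
    refine hq.trans ?_
    have hu' := inBox_stp_dn hu hb
    rw [← stp_mk]
    exact zc_cross' (by rwa [blk_mk hu]) (by rwa [stp_mk, blk_mk hu'])

lemma zc_block {x u : Pt 3} (hx : x ∈ dom C.T.seed) (hu : C.InBox u) :
    C.ZC (gp (C.mc x 0) hub) (gp (C.mc x u) hub) := by
  have a0 := hu 0; have a1 := hu 1; have a2 := hu 2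
  have z := C.zero_inBox
  have s0 := zc_block_step hx 0 z .refl a0.1 a0.2
  have z0 := inBox_update z (a := 0) a0.1 a0.2
  have s1 := zc_block_step hx 1 z0 s0 a1.1 a1.2
  have z1 := inBox_update z0 (a := 1) a1.1 a1.2
  have s2 := zc_block_step hx 2 z1 s1 a2.1 a2.2
  convert s2 using 3
  funext i; fin_cases i <;> simp

lemma zc_blocks_up {x : Pt 3} {i : Fin 3} (hx : x ∈ dom C.T.seed) (hx' : stp (i, true) x ∈ dom C.T.seed) :
    C.ZC (gp (C.mc x 0) hub) (gp (C.mc (stp (i, true) x) 0) hub) := by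
  have hn := C.n_pos
  have hu := inBox_update (C.zero_inBox) (a := i) (v := C.n - 1) (by omega) (by omega)
  refine (zc_block hx hu).trans ?_
  have e : stp (i, true) (C.mc x (Function.update 0 i (C.n - 1))) = C.mc (stp (i, true) x) 0 := by
    rw [stp_mk_cross]
    congr 1
    funext j
    by_cases hj : j = i
    · subst hj; simp [sg]
    · simp [hj]
  rw [← e]
  refine zc_cross (by rwa [blk_mk hu]) ?_
  rw [e, blk_mk C.zero_inBox]
  exact hx'

lemma zc_blocks {x : Pt 3} {d : Dir} (hx : x ∈ dom C.T.seed) (hx' : stp d x ∈ dom C.T.seed) :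
    C.ZC (gp (C.mc x 0) hub) (gp (C.mc (stp d x) 0) hub) := by
  obtain ⟨i, b⟩ := d
  cases b
  · have e : stp (i, true) (stp (i, false) x) = x := stp_opp_stp (i, false) x
    have := zc_blocks_up (C := C) (i := i) hx' (by rwa [e])
    rw [e] at this
    exact this.symm
  · exact zc_blocks_up hx hx'

lemma zc_all {x y : Pt 3} (hx : x ∈ dom C.T.seed) (hy : y ∈ dom C.T.seed) :
    C.ZC (gp (C.mc x 0) hub) (gp (C.mc y 0) hub) := by
  have h := C.T.seed_connected x hx y hy
  clear hy
  induction h with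
  | refl => exact .refl
  | tail _ h ih =>
    obtain ⟨ha, h1, h2⟩ := h
    obtain ⟨d, rfl⟩ := adj_iff.1 ha
    exact ih.trans (zc_blocks h1 h2)

lemma zc_root {p : Pt 3} (hp : p ∈ C.Z) : C.ZC p (gp (C.mc (C.blk (mac p)) 0) hub) := by
  have h1 := zc_hub hp.1 hp.2
  rw [gp_mac_lo] at h1
  have h2 := zc_block hp.1 (C.loc_inBox (mac p))
  rw [mk_blk_loc] at h2
  exact h1.trans h2.symm

lemma zc_conn {p q : Pt 3} (hp : p ∈ C.Z) (hq : q ∈ C.Z) : C.ZC p q :=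
  (zc_root hp).trans ((zc_all hp.1 hq.1).trans (zc_root hq).symm)

lemma dom_sd : dom C.sd = C.Z := by
  ext p; rw [mem_dom_iff]; unfold sd; split_ifs with h <;> simp [h]

lemma sd_eq {p : Pt 3} (h : p ∈ C.Z) : C.sd p = some (tl p (C.phi p)) := if_pos h

lemma inBox_finite : {u : Pt 3 | C.InBox u}.Finite := by
  apply (Set.finite_Icc (0 : Pt 3) (fun _ => C.n - 1)).subset
  intro u hu
  refine ⟨fun i => (hu i).1, fun i => ?_⟩
  have := (hu i).2
  change u i ≤ C.n - 1
  omega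

lemma Z_finite : C.Z.Finite := by
  apply ((C.T.seed_finite.prod (inBox_finite (C := C))).prod box_finite).image
    (fun x => gp (C.mc x.1.1 x.1.2) x.2) |>.subset
  intro p hp
  refine ⟨((C.blk (mac p), C.loc (mac p)), lo p), ⟨⟨hp.1, C.loc_inBox _⟩, lo_box p⟩, ?_⟩
  simp only [mk_blk_loc, gp_mac_lo]

lemma ZS_bond {a b : Pt 3} (h : C.ZS a b) : 2 ≤ bondAt C.sd a b := by
  obtain ⟨⟨d, rfl⟩, h1, h2⟩ := h
  rw [bondAt_stp (sd_eq h1)]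
  unfold nb
  rw [sd_eq h2]
  simp only
  rw [bond_str]
  · unfold phi; rw [if_pos h1, if_pos h2]
  · unfold phi; rw [if_pos h2, if_pos (by rwa [stp_opp_stp])]

/-- The simulating system. -/
def US (C : Ctx) : TAS 3 where
  tileset := U
  seed := C.sd
  temp := 2
  temp_pos := by norm_num
  seed_nonempty := by
    obtain ⟨x, hx⟩ := C.T.seed_nonempty
    rw [dom_sd]
    exact ⟨gp (C.mc x 0) hub, mem_Z_gp (by rwa [blk_mk C.zero_inBox]) Z0_hub⟩
  seed_connected := by
    rw [dom_sd]
    intro p hp q hq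
    refine Relation.ReflTransGen.mono ?_ _ _ (zc_conn hp hq)
    rintro a b ⟨h, h1, h2⟩
    exact ⟨adj_iff.2 h, h1, h2⟩
  seed_finite := by rw [dom_sd]; exact Z_finite
  seed_tiles := fun p t h => Om_mem_U (Inv.seed.ext p t h)
  seed_stable := by
    refine stable_of_connected C.ZS (fun p q h => ZS_bond h) ?_
    rw [dom_sd]
    intro p hp q hq
    refine Relation.ReflTransGen.mono ?_ _ _ (zc_conn hp hq)
    intro a b h
    exact ⟨h, h.2.1, h.2.2⟩

end Ctx
end IU

namespace IU

/-! ## Part K: the simulation -/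

lemma terminal_max {T : TAS 3} {α β γ : Config 3} (hα : Pble T α) (hT : Terminal (Attach T) α)
    (hβ : Pble T β) (h1 : Extends α γ) (h2 : Extends β γ) : Extends β α := by
  rw [terminal_iff hα.nonempty hα.stable] at hT
  refine pble_induction (T := T) (P := fun β => Extends β γ → Extends β α) ?_ ?_ ?_ hβ h2
  · intro _; exact hα.ext
  · intro β p t _ ih hp ht hw hE
    have ih := ih (extends_trans (extends_update hp t) hE)
    intro q s hq
    by_cases hqp : q = p
    · subst hqp
      have hs := hE q s hq
      cases e : α q with
      | none =>
        exact absurd (hw.trans (wsum_mono ih q t)) (not_le.2 (hT q t e ht))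
      | some r => rw [← hs, h1 q r e]
    · rw [Function.update_of_ne hqp] at hq
      exact ih q s hq
  · intro f β _ ih _ hl _ hE p t hp
    obtain ⟨n, hn⟩ := (hl p t).1 hp
    exact ih n (extends_trans (limit_extends hl n) hE) p t hn

namespace Ctx
variable {C : Ctx}

lemma pble_inv {α : Config 3} (h : Pble C.US α) : C.Inv α :=
  pble_induction (T := C.US) (P := fun α => C.Inv α) Inv.seed
    (fun _ _ _ _ hI hp ht hw => hI.step hp ht hw)
    (fun _ _ hf hI _ hl _ => Inv.limit hf hI hl) h

lemma us_directed : DirectedSys (Attach C.US) C.US.seed := by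
  obtain ⟨β, hβ, -, hT⟩ := (pble_seed (T := C.US)).exists_terminal
  refine ⟨β, ⟨hβ, hT⟩, ?_⟩
  rintro γ ⟨hγ, hT'⟩
  have e1 := (pble_inv hβ).ext
  have e2 := (pble_inv (C := C) hγ).ext
  exact extends_antisymm (terminal_max hβ hT hγ e1 e2) (terminal_max hγ hT' hβ e2 e1)

/-- Growth up to a prescribed set of resolved blocks. -/
lemma grow {α : Config 3} {B : Set (Pt 3)} (hα : Pble C.US α) (hB : C.PA B) (hs : C.Aof α ⊆ B) :
    ∃ β, Pble C.US β ∧ Extends α β ∧ C.Aof β = B := by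
  obtain ⟨β, hβ, hE, hm⟩ := exists_maximal (T := C.US) (α := α) {α | Pble C.US α ∧ C.Aof α ⊆ B}
    (fun _ h => h.1) (by
      intro c γ hc hne hγ hP
      refine ⟨hP, ?_⟩
      rintro x (hx | hx)
      · exact hB.seed_sub hx
      · obtain ⟨t, ht⟩ := Option.ne_none_iff_exists'.1 hx
        obtain ⟨δ, hδ, hd⟩ := (hγ _ _).1 ht
        exact (hc hδ).2 (Or.inr (by change δ _ ≠ none; rw [hd]; simp))) ⟨hα, hs⟩
  refine ⟨β, hβ.1, hE, Set.Subset.antisymm hβ.2 ?_⟩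
  have hM : C.Mx β B := by
    refine ⟨pble_inv hβ.1, ?_⟩
    intro p t hp hO hw
    have hU := hβ.1.update (p := p) hp (t := t) (Om_mem_U hO) hw
    by_contra hno
    push Not at hno
    have := hm _ ⟨hU, ?_⟩ (extends_update hp t)
    · have h2 := congrFun this p
      simp [hp] at h2
    · rintro x (hx | hx)
      · exact hB.seed_sub hx
      · by_contra hxB
        have hne := hno x hxB
        apply hxB
        apply hβ.2
        right
        change Function.update β p (some t) (C.rho0 x) ≠ none at hx
        rwa [Function.update_of_ne (Ne.symm hne)] at hx
  exact hM.complete hB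

lemma terminal_Aof {α : Config 3} (hα : Pble C.US α) (hT : Terminal (Attach C.US) α) :
    C.Aof α = dom C.top := by
  have hI := pble_inv hα
  refine Set.Subset.antisymm hI.pa.1 ?_
  have hM : C.Mx α (dom C.top) := by
    refine ⟨hI, ?_⟩
    intro p t hp hO hw
    rw [terminal_iff hα.nonempty hα.stable] at hT
    exact absurd hw (not_le.2 (hT p t hp (Om_mem_U hO)))
  exact hM.complete (PA_dom C.htop)

/-! ### The representation function -/

/-- Position of lock number `i` inside a block. -/
def lkp (i : ℤ) : Pt 3 := gp ![i, 0, 0] (spos none)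

def RC (C : Ctx) (γ : Config 3) : Prop :=
  (γ (gp ![C.n - 1, 0, 0] rhoLo) ≠ none ∨ γ (gp 0 hub) ≠ none) ∧
    ∀ i, 0 ≤ i → i < C.n → γ (lkp i) ≠ none

def RW (C : Ctx) (γ : Config 3) (t : TileType 3) : Prop :=
  t ∈ C.T.tileset ∧ ∃ s, γ (lkp (C.ix t)) = some s ∧ face s (0, true) = (lab (.inl 1), 0)

def Rf (C : Ctx) : RepFn 3 := fun γ =>
  if C.RC γ ∧ ∃ t, C.RW γ t then some (Classical.epsilon (C.RW γ)) else none

lemma Rf_valid : ValidRep C.T.tileset C.Rf := by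
  constructor
  · intro γ γ' hE t ht
    unfold Rf at ht
    split_ifs at ht with h
    obtain ⟨⟨h1, h2⟩, h3⟩ := h
    have hc : C.RC γ' :=
      ⟨h1.imp (fun h => dom_mono hE h) (fun h => dom_mono hE h), fun i a b => dom_mono hE (h2 i a b)⟩
    have hw : C.RW γ' = C.RW γ := by
      funext s
      apply propext
      unfold RW
      refine and_congr_right fun hs => ?_
      obtain ⟨r, hr⟩ := Option.ne_none_iff_exists'.1 (h2 (C.ix s) (ix_nonneg s) (ix_lt hs))
      rw [hr, hE _ _ hr]
    unfold Rf
    rw [hw, if_pos ⟨hc, h3⟩]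
    exact ht
  · intro γ t ht
    unfold Rf at ht
    split_ifs at ht with h
    have := Classical.epsilon_spec h.2
    simp only [Option.some.injEq] at ht
    rw [ht] at this
    exact this.1

/-- The scale. -/
def sc (C : Ctx) : ℕ := (C.n * mside).toNat

lemma sc_eq : (C.sc : ℤ) = C.n * mside := by
  unfold sc
  exact Int.toNat_of_nonneg (mul_nonneg C.n_pos.le mside_pos.le)

lemma sc_pos : 0 < C.sc := by
  have := mul_pos (C.n_pos) mside_pos
  have h := C.sc_eq
  omega

lemma mblock_gp {α : Config 3} (x : Pt 3) {u v : Pt 3} (hu : C.InBox u) (hv : Box v) :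
    mblock C.sc α x (gp u v) = α (gp (C.mc x u) v) := by
  unfold mblock
  have hm := mside_pos
  rw [if_pos]
  · congr 1
    funext i
    simp only [gp, mc, sc_eq]
    ring
  · intro i
    have h1 := hu i; have h2 := hv i
    rw [sc_eq]
    unfold gp
    constructor
    · nlinarith
    · nlinarith

lemma nonempty_block {α : Config 3} {x : Pt 3} (h : NonemptyBlock C.sc α x) :
    ∃ p, α p ≠ none ∧ C.blk (mac p) = x := by
  obtain ⟨y, hy⟩ := h
  unfold mblock at hy
  split_ifs at hy with hb
  · refine ⟨_, hy, ?_⟩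
    have hm := mside_pos
    have hn := C.n_pos
    funext i
    have hbi := hb i
    simp only [blk, mac]
    rw [sc_eq] at hbi ⊢
    rw [Int.ediv_ediv_of_nonneg hm.le, mul_comm mside]
    rw [Int.mul_add_ediv_left _ _ (by positivity), Int.ediv_eq_zero_of_lt hbi.1 hbi.2, add_zero]
  · simp at hy

lemma phi_lock_nul1 (P : Pt 3) : C.phi (gp P (spos none)) (0, true) = .nul1 ↔ C.Win P := by
  have ho := own_st P none
  have hz : stp (0, true) (gp P (spos none)) ∉ C.Z := notZ_net (own_sR P none) (by simp [sR])
  have hmac : mac (gp P (spos none)) = P := mac_gp _ (spos_box _)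
  by_cases hp : gp P (spos none) ∈ C.Z
  · unfold phi
    rw [if_pos hp, if_neg hz, if_neg (by rw [ho]; simp), hmac, ho]
    by_cases hw : C.Win P <;> simp [hw]
  · rw [phi_lock ho hp, hmac]
    by_cases hw : C.Win P <;> simp [hw, maskW, maskL]

lemma gl_nul1 {p : Pt 3} {d : Dir} {k : Fk} : gl p d k = (lab (.inl 1), 0) ↔ k = .nul1 := by
  constructor
  · intro h
    have h1 := congrArg Prod.fst h
    cases k with
    | nul1 => rfl
    | nul0 => exact absurd (lab_inj h1) (by simp)
    | nrm => exact absurd (lab_inj h1) (by simp)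
    | str => exact absurd (lab_inj h1) (by simp)
  · rintro rfl; rfl

section rep
variable {α : Config 3}

lemma Inv.lock_tile (hI : C.Inv α) {x : Pt 3} {i : ℤ} (h : C.line x i ∈ C.Fof α) (h0 : 0 ≤ i) (h1 : i < C.n) :
    (∃ s, mblock C.sc α x (lkp i) = some s ∧ face s (0, true) = (lab (.inl 1), 0)) ↔
      ∃ t, C.top x = some t ∧ i = C.ix t := by
  unfold lkp
  rw [mblock_gp x (line_inBox h0 h1) (spos_box _)]
  change (∃ s, α (gp (C.line x i) (spos none)) = some s ∧ _) ↔ _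
  rw [hI.val h]
  simp only [Option.some.injEq, exists_eq_left']
  rw [face_tl, gl_nul1, phi_lock_nul1]
  unfold Win
  rw [blk_line h0 h1, loc_line h0 h1]
  rfl

lemma Inv.rep (hI : C.Inv α) : repStar C.Rf C.sc α = C.rst (C.Aof α) := by
  have hn := C.n_ge
  funext x
  unfold repStar
  have er : mblock C.sc α x (gp ![C.n - 1, 0, 0] rhoLo) = α (C.rho0 x) :=
    mblock_gp x (line_inBox (by omega) (by omega)) rhoLo_box
  have eh : mblock C.sc α x (gp 0 hub) = α (gp (C.mc x 0) hub) :=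
    mblock_gp x C.zero_inBox hub_box
  by_cases hx : x ∈ C.Aof α
  · obtain ⟨t, ht⟩ := mem_dom_iff.1 (hI.pa.1 hx)
    have hc : C.RC (mblock C.sc α x) := by
      refine ⟨?_, ?_⟩
      · rw [er, eh]
        rcases hx with hx | hx
        · right
          exact hI.zed _ (mem_Z_gp (by rwa [blk_mk C.zero_inBox]) Z0_hub)
        · left; exact hx
      · intro i h0 h1
        unfold lkp
        rw [mblock_gp x (line_inBox h0 h1) (spos_box _)]
        exact hI.fl x hx i h0 h1
    have hw : ∀ s, C.RW (mblock C.sc α x) s ↔ s = t := by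
      intro s
      unfold RW
      constructor
      · rintro ⟨hs, h⟩
        rw [hI.lock_tile (hI.fl x hx _ (ix_nonneg s) (ix_lt hs)) (ix_nonneg s) (ix_lt hs)] at h
        obtain ⟨r, hr, e⟩ := h
        rw [ht] at hr
        simp only [Option.some.injEq] at hr
        subst hr
        exact ix_inj hs (top_mem ht) e
      · rintro rfl
        have hs := top_mem ht
        refine ⟨hs, ?_⟩
        rw [hI.lock_tile (hI.fl x hx _ (ix_nonneg s) (ix_lt hs)) (ix_nonneg s) (ix_lt hs)]
        exact ⟨s, ht, rfl⟩
    have hex : ∃ s, C.RW (mblock C.sc α x) s := ⟨t, (hw t).2 rfl⟩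
    unfold Rf rst
    rw [if_pos ⟨hc, hex⟩, if_pos hx, ht, (hw _).1 (Classical.epsilon_spec hex)]
  · unfold Rf rst
    rw [if_neg hx, if_neg]
    rintro ⟨⟨h | h, -⟩, -⟩
    · rw [er] at h; exact hx (Or.inr h)
    · rw [eh] at h
      by_cases hz : gp (C.mc x 0) hub ∈ C.Z
      · have := hz.1
        rw [mac_gp _ hub_box, blk_mk C.zero_inBox] at this
        exact hx (Or.inl this)
      · have := hI.ct _ h hz
        rw [own_gp _ hub_box, own0_line ⟨0, fun _ _ => rfl⟩] at this
        exact this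

lemma Inv.near (hI : C.Inv α) {p : Pt 3} (h : α p ≠ none) : Near (C.Aof α) (C.blk (mac p)) := by
  by_cases hz : p ∈ C.Z
  · exact Or.inl (Or.inl hz.1)
  · exact (hI.ct p h hz).near Set.subset_union_left

end rep

lemma us_sim : Simulates C.US C.T C.Rf C.sc := by
  have hrep : ∀ {α'}, Pble C.US α' → repStar C.Rf C.sc α' = C.rst (C.Aof α') :=
    fun h => (pble_inv h).rep
  have hPA : ∀ {α'}, Pble C.US α' → C.PA (C.Aof α') := fun h => (pble_inv h).pa
  have hinj : ∀ {α' α}, Pble C.US α' → repStar C.Rf C.sc α' = α → C.Aof α' = dom α := by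
    intro α' α h e
    rw [← e, hrep h, dom_rst (hPA h).1]
  have hAs : C.Aof C.sd = dom C.T.seed := by
    apply Set.Subset.antisymm _ Set.subset_union_left
    rintro x (hx | hx)
    · exact hx
    · have : C.rho0 x ∈ C.Z := by rw [← dom_sd]; exact hx
      exact absurd this (notZ_net (own_rho0 x) (by simp))
  refine ⟨?_, ?_, ?_, ?_, ?_⟩
  · intro α
    constructor
    · intro (hα : Pble C.T α)
      have hB := PA_dom hα
      obtain ⟨β, h1, -, h3⟩ := grow (pble_seed (T := C.US)) hB (by
        change C.Aof C.sd ⊆ _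
        rw [hAs]; exact hB.seed_sub)
      exact ⟨β, h1, by rw [hrep h1, h3, rst_dom hα]⟩
    · rintro ⟨α', h, rfl⟩
      rw [hrep h]
      exact (hPA h).2
  · have htop : C.rst (dom C.top) = C.top := rst_dom C.htop
    intro α
    constructor
    · rintro ⟨hα, hT⟩
      have e : α = C.top := extends_antisymm (C.huniq α hα)
        (terminal_max hα hT C.htop (C.huniq α hα) (extends_refl _))
      obtain ⟨β, hβ, -, hTβ⟩ := (pble_seed (T := C.US)).exists_terminal
      exact ⟨β, ⟨hβ, hTβ⟩, by rw [hrep hβ, terminal_Aof hβ hTβ, htop, e]⟩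
    · rintro ⟨α', ⟨h, hT⟩, rfl⟩
      rw [hrep h, terminal_Aof h hT, htop]
      exact ⟨C.htop, C.hterm⟩
  · intro α' h
    left
    intro x hx
    obtain ⟨p, hp, rfl⟩ := nonempty_block hx
    have hd := dom_rst (hPA h).1
    have hmem : ∀ y, y ∈ C.Aof α' → repStar C.Rf C.sc α' y ≠ none := by
      intro y hy
      rw [hrep h]
      rw [← hd] at hy
      exact hy
    rcases (pble_inv h).near hp with h1 | ⟨d, h1⟩
    · exact Or.inl (hmem _ h1)
    · exact Or.inr ⟨_, adj_iff.2 ⟨d, rfl⟩, hmem _ h1⟩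
  · intro α' β' hα hβ h
    rw [hrep hα, hrep hβ]
    exact ((hPA hα).2.from_iff (hPA hβ).2).2 (rst_mono (Aof_mono ((Pble.from_iff hα hβ).1 h)))
  · intro α hα
    refine ⟨{α' | Pble C.US α' ∧ repStar C.Rf C.sc α' = α}, fun _ h => h, ?_⟩
    intro β hβ hαβ
    constructor
    · rintro α' ⟨h1, h2⟩
      obtain ⟨β', g1, g2, g3⟩ := grow h1 (PA_dom hβ) (by
        rw [hinj h1 h2]
        exact dom_mono ((Pble.from_iff hα hβ).1 hαβ))
      exact ⟨β', (h1.from_iff g1).2 g2, by rw [hrep g1, g3, rst_dom hβ]⟩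
    · intro α'' β' h1 h2 _ _
      exact ⟨α'', ⟨h1, h2⟩, (Pble.from_iff h1 h1).2 (extends_refl _)⟩

end Ctx

/-- Representation functions for all systems. -/
def Rall (T : TAS 3) : RepFn 3 :=
  if h : ∃ C : Ctx, C.T = T then h.choose.Rf else fun _ => none
/-- Seeds for all systems. -/
def Sall (T : TAS 3) : Config 3 :=
  if h : ∃ C : Ctx, C.T = T then h.choose.sd else fun _ => none

theorem main_thm : ∃ (U : Finset (TileType 3)) (τ' : ℕ), 0 < τ' ∧
      ∃ (Rfun : TAS 3 → RepFn 3) (Sfun : TAS 3 → Config 3),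
        ∀ T : TAS 3, DirectedSys (Attach T) T.seed →
          ∃ (UT : TAS 3) (m : ℕ), 0 < m ∧
            UT.tileset = U ∧ UT.seed = Sfun T ∧ UT.temp = τ' ∧
            ValidRep T.tileset (Rfun T) ∧ Simulates UT T (Rfun T) m ∧
            DirectedSys (Attach UT) UT.seed := by
  refine ⟨U, 2, by norm_num, Rall, Sall, ?_⟩
  intro T hT
  have h := exists_ctx T hT
  have e := h.choose_spec
  have hR : Rall T = h.choose.Rf := dif_pos h
  have hS : Sall T = h.choose.sd := dif_pos h
  rw [hR, hS]
  generalize h.choose = C at e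
  subst e
  exact ⟨C.US, C.sc, C.sc_pos, rfl, rfl, rfl, C.Rf_valid, C.us_sim, C.us_directed⟩

end IU

/-- **The class of directed 3D aTAM systems is intrinsically universal by
directed simulators.** There exist a finite tile set `U` of 3-dimensional tile
types, a temperature `τ' ∈ ℤ⁺`, and functions `Rfun` and `Sfun` such that for
every directed 3D aTAM system `T` there is `m` for which
`UT = (U, Sfun T, τ')` simulates `T` at scale `m` under `Rfun T` and `UT` is
itself directed. -/
theorem directed_threeD_aTAM_intrinsically_universal :
    ∃ (U : Finset (TileType 3)) (τ' : ℕ), 0 < τ' ∧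
      ∃ (Rfun : TAS 3 → RepFn 3) (Sfun : TAS 3 → Config 3),
        ∀ T : TAS 3, DirectedSys (Attach T) T.seed →
          ∃ (UT : TAS 3) (m : ℕ), 0 < m ∧
            UT.tileset = U ∧ UT.seed = Sfun T ∧ UT.temp = τ' ∧
            ValidRep T.tileset (Rfun T) ∧ Simulates UT T (Rfun T) m ∧
            DirectedSys (Attach UT) UT.seed := by
  exact IU.main_thm
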